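/- arXiv:2406.09210 — 3 statements merged into one kernel-verified Lean document; each statement's English description precedes it below -/
import Mathlib

section
/- Let p be a prime and n > 1 a positive integer, and let G = Z_p semidirect Z_n = <x, y | x^n = y^p = 1, x^g y = y x> with ord_n(g) = p. Then d(G) = n + p - 1 and f(G) = n. -/
open List Subgroup

/-- The set of all products of the terms of `S` in all orders. -/
def PiSet {G : Type*} [Group G] (S : List G) : Set G :=
  {g | ∃ l : List G, l.Perm S ∧ l.prod = g}

/-- `S` is a product-one sequence if `1 ∈ Π(S)`. -/
def IsProdOne {G : Type*} [Group G] (S : List G) : Prop :=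
  (1 : G) ∈ PiSet S

/-- The Davenport constant `d(G)`: the smallest `m` such that every sequence of
length `m` over `G` contains a nonempty product-one subsequence. -/
noncomputable def dC (G : Type*) [Group G] : ℕ :=
  sInf {m | 0 < m ∧ ∀ S : List G, S.length = m →
    ∃ T : List G, T ≠ [] ∧ T.Sublist S ∧ IsProdOne T}

/-- `e(G)`: the smallest `m` such that every nonempty product-one sequence over `G`
contains a nonempty product-one subsequence of length at most `m`. -/
noncomputable def eC (G : Type*) [Group G] : ℕ :=
  sInf {m | 0 < m ∧ ∀ S : List G, S ≠ [] → IsProdOne S →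
    ∃ T : List G, T ≠ [] ∧ T.Sublist S ∧ T.length ≤ m ∧ IsProdOne T}

/-- `f(G)`: the smallest `m` such that every sequence of length `d(G)` over `G`
contains a nonempty product-one subsequence of length at most `m`. -/
noncomputable def fC (G : Type*) [Group G] : ℕ :=
  sInf {m | 0 < m ∧ ∀ S : List G, S.length = dC G →
    ∃ T : List G, T ≠ [] ∧ T.Sublist S ∧ T.length ≤ m ∧ IsProdOne T}

/-- The `k`-th Davenport constant `d_k(G)`: the smallest `m` such that every sequence of
length `m` over `G` contains `k` pairwise disjoint nonempty product-one subsequences. -/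
noncomputable def dkC (G : Type*) [Group G] (k : ℕ) : ℕ :=
  sInf {m | 0 < m ∧ ∀ S : List G, S.length = m →
    ∃ Ts : List (List G), Ts.length = k ∧ (∀ T ∈ Ts, T ≠ [] ∧ IsProdOne T) ∧
      (Ts.flatten : Multiset G) ≤ (S : Multiset G)}

namespace ShortProductOne

open scoped Pointwise

section Sequences

variable {ι G A : Type*}

theorem exists_perm_append_of_subperm {l L : List ι} (h : l.Subperm L) :
    ∃ R, L.Perm (l ++ R) := by
  obtain ⟨l', hl', hs⟩ := h
  obtain ⟨R, hR⟩ := hs.exists_perm_append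
  exact ⟨R, hR.trans (hl'.append_right R)⟩

theorem subperm_of_perm_append {l L R : List ι} (h : L.Perm (l ++ R)) : l.Subperm L :=
  (List.sublist_append_left l R).subperm.trans h.symm.subperm

theorem subperm_map_index {m : ℕ} (s : ℕ → ι) {I : List ℕ} (hI : I.Nodup)
    (hlt : ∀ i ∈ I, i < m) : (I.map s).Subperm ((List.range m).map s) := by
  obtain ⟨l', hl', hs⟩ := List.subperm_of_subset (l₂ := List.range m) hI
    (fun i hi => List.mem_range.2 (hlt i hi))
  exact ⟨l'.map s, hl'.map s, hs.map s⟩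

theorem exists_monotone_enum [Nonempty ι] (S : List ι) (f : ι → ℕ) :
    ∃ s : ℕ → ι, ((List.range S.length).map s).Perm S ∧
      ∀ i j, i ≤ j → j < S.length → f (s i) ≤ f (s j) := by
  classical
  let d : ι := Classical.arbitrary ι
  let r : ι → ι → Prop := fun a b => f a ≤ f b
  have : Std.Total r := ⟨fun a b => le_total _ _⟩
  have : IsTrans ι r := ⟨fun a b c hab hbc => le_trans hab hbc⟩
  set L := S.insertionSort r with hL
  have hlen : L.length = S.length := (List.perm_insertionSort r S).length_eq
  have hp : L.Pairwise r := List.pairwise_insertionSort r S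
  refine ⟨fun i => L.getD i d, ?_, ?_⟩
  · have : (List.range S.length).map (fun i => L.getD i d) = L := by
      apply List.ext_getElem
      · simp [hlen]
      · intro i h1 h2
        simp [List.getD_eq_getElem?_getD, h2]
    rw [this]
    exact List.perm_insertionSort r S
  · intro i j hij hj
    rcases hij.eq_or_lt with rfl | hlt
    · exact le_rfl
    · have := List.pairwise_iff_getElem.1 hp i j (by omega) (by omega) hlt
      simpa [List.getD_eq_getElem?_getD, hlen, hj, hlt.trans hj, r] using this

theorem exists_zero_sum_sublist [AddCommGroup A] (K : AddSubgroup A) [Finite K] (L : List ι)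
    (f : ι → A) (hf : ∀ i ∈ L, f i ∈ K) (hK : Nat.card K ≤ L.length) :
    ∃ l, l ≠ [] ∧ l.Sublist L ∧ (l.map f).sum = 0 := by
  classical
  have hmem : ∀ i, ((L.take i).map f).sum ∈ K := fun i =>
    AddSubgroup.list_sum_mem K (by
      intro x hx
      obtain ⟨y, hy, rfl⟩ := List.mem_map.1 hx
      exact hf y (List.mem_of_mem_take hy))
  let g : Fin (L.length + 1) → K := fun i => ⟨_, hmem i⟩
  have hni : ¬ Function.Injective g := fun hg => by
    have := Nat.card_le_card_of_injective g hg
    simp at this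
    omega
  obtain ⟨i, j, hij, hne⟩ : ∃ i j, g i = g j ∧ i < j := by
    simp only [Function.Injective, not_forall] at hni
    obtain ⟨i, j, h, hne⟩ := hni
    rcases lt_or_gt_of_ne hne with h' | h'
    exacts [⟨i, j, h, h'⟩, ⟨j, i, h.symm, h'⟩]
  have hlt : (i : ℕ) < j := hne
  have hj : (j : ℕ) ≤ L.length := by omega
  refine ⟨(L.take j).drop i, ?_, ?_, ?_⟩
  · intro h
    have := congrArg List.length h
    simp at this
    omega
  · exact (List.drop_sublist _ _).trans (List.take_sublist _ _)
  · have h1 : ((L.take i).map f).sum = ((L.take j).map f).sum := congrArg Subtype.val hij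
    have h2 : L.take j = L.take i ++ (L.take j).drop i := by
      conv_lhs => rw [← List.take_append_drop i (L.take j)]
      rw [List.take_take, min_eq_left hlt.le]
    rw [h2, List.map_append, List.sum_append] at h1
    simpa using h1

/-- If every long enough list contains a short list satisfying `P`, then it contains many disjoint
ones. -/
theorem exists_disjoint_blocks (P : List ι → Prop) (m c : ℕ)
    (hP : ∀ S : List ι, m ≤ S.length → ∃ T, T.Subperm S ∧ T.length ≤ c ∧ P T) (j : ℕ) :
    ∀ S : List ι, m + j * c ≤ S.length + c →
      ∃ (Ts : List (List ι)) (R : List ι), Ts.length = j ∧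
        (∀ T ∈ Ts, T.length ≤ c ∧ P T) ∧ S.Perm (Ts.flatten ++ R) := by
  induction j with
  | zero => exact fun S _ => ⟨[], S, by simp⟩
  | succ j ih =>
    intro S hS
    obtain ⟨T, hTS, hTc, hT⟩ := hP S (by nlinarith [Nat.zero_le (j * c)])
    obtain ⟨R, hR⟩ := exists_perm_append_of_subperm hTS
    have hlen := hR.length_eq
    rw [List.length_append] at hlen
    obtain ⟨Ts, R', h1, h2, h3⟩ := ih R (by rw [Nat.succ_mul] at hS; omega)
    refine ⟨T :: Ts, R', by simp [h1], ?_, ?_⟩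
    · intro U hU
      rcases List.mem_cons.1 hU with rfl | hU
      exacts [⟨hTc, hT⟩, h2 U hU]
    · rw [List.flatten_cons, List.append_assoc]
      exact hR.trans (h3.append_left T)

theorem length_flatten_le {c : ℕ} (Ts : List (List ι)) (h : ∀ T ∈ Ts, T.length ≤ c) :
    Ts.flatten.length ≤ Ts.length * c := by
  rw [List.length_flatten]
  simpa using List.sum_le_card_nsmul (Ts.map List.length) c (by simpa using h)

end Sequences

section Choice

theorem cauchy_davenport_choice {q : ℕ} (hq : q.Prime) (m : ℕ) (J : ℕ → Finset ℕ)
    (F : ℕ → ℕ → ZMod q) (hJ : ∀ i, (J i).Nonempty)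
    (hF : ∀ i < m, Set.InjOn (F i) (J i)) :
    ∃ X : Finset (ZMod q), min q (1 + ∑ i ∈ Finset.range m, ((J i).card - 1)) ≤ X.card ∧
      ∀ x ∈ X, ∃ c : ℕ → ℕ, (∀ i < m, c i ∈ J i) ∧ ∑ i ∈ Finset.range m, F i (c i) = x := by
  classical
  induction m with
  | zero => exact ⟨{0}, by simp, by simp⟩
  | succ m ih =>
    obtain ⟨X, hX, hc⟩ := ih fun i hi => hF i (by omega)
    have hXne : X.Nonempty := Finset.card_pos.1 (lt_of_lt_of_le (by have := hq.pos; omega) hX)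
    have hcard : ((J m).image (F m)).card = (J m).card :=
      Finset.card_image_of_injOn (hF m (by omega))
    have hpos := (hJ m).card_pos
    have := ZMod.cauchy_davenport hq hXne ((hJ m).image (F m))
    refine ⟨X + (J m).image (F m), ?_, ?_⟩
    · rw [Finset.sum_range_succ]
      omega
    · intro x hx
      obtain ⟨y, hy, z, hz, rfl⟩ := Finset.mem_add.1 hx
      obtain ⟨c, hcJ, rfl⟩ := hc y hy
      obtain ⟨i, hi, rfl⟩ := Finset.mem_image.1 hz
      refine ⟨Function.update c m i, fun k hk => ?_, ?_⟩
      · rcases eq_or_ne k m with rfl | hne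
        · simpa using hi
        · rw [Function.update_of_ne hne]
          exact hcJ k (by omega)
      · rw [Finset.sum_range_succ, Function.update_self]
        congr 1
        exact Finset.sum_congr rfl fun k hk => by
          rw [Function.update_of_ne (Finset.mem_range.1 hk).ne]

end Choice

/-- Coordinates `s = x ^ a * y ^ b` on a group, multiplying as in the semidirect product of
`ZMod n` by `ZMod p` in which `1 : ZMod p` acts on `ZMod n` as multiplication by `u`. -/
structure SplitCoords (n p : ℕ) (u : ZMod n) (G : Type*) [Group G] where
  a : G → ZMod n
  b : G → ZMod p
  a_mul : ∀ s t, a (s * t) = a s + u ^ (b s).val * a t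
  b_mul : ∀ s t, b (s * t) = b s + b t

namespace SplitCoords

variable {G : Type*} [Group G] {n p : ℕ} {u : ZMod n} (C : SplitCoords n p u G)

theorem b_one : C.b 1 = 0 := by simpa using C.b_mul 1 1

theorem a_one : C.a 1 = 0 := by simpa [C.b_one] using C.a_mul 1 1

theorem b_prod (l : List G) : C.b l.prod = (l.map C.b).sum := by
  induction l with
  | nil => simp [C.b_one]
  | cons s l ih => simp [C.b_mul, ih]

theorem b_prod_perm {l l' : List G} (h : l.Perm l') : C.b l.prod = C.b l'.prod := by
  rw [C.b_prod, C.b_prod, (h.map C.b).sum_eq]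

theorem a_mul_of_b_eq_zero {s : G} (h : C.b s = 0) (t : G) : C.a (s * t) = C.a s + C.a t := by
  simp [C.a_mul, h]

theorem prod_flatten (Ts : List (List G)) (h : ∀ T ∈ Ts, C.b T.prod = 0) :
    C.b Ts.flatten.prod = 0 ∧ C.a Ts.flatten.prod = (Ts.map fun T => C.a T.prod).sum := by
  induction Ts with
  | nil => simp [C.a_one, C.b_one]
  | cons T Ts ih =>
    obtain ⟨h1, h2⟩ := ih fun U hU => h U (List.mem_cons_of_mem _ hU)
    have h0 := h T List.mem_cons_self
    rw [List.flatten_cons, List.prod_append, C.b_mul, C.a_mul_of_b_eq_zero h0]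
    exact ⟨by rw [h0, h1, add_zero], by rw [h2, List.map_cons, List.sum_cons]⟩

/-- `S` has a nonempty subsequence of length at most `m` which, in some order, has product with
trivial coordinates. -/
def HasShort (S : List G) (m : ℕ) : Prop :=
  ∃ l : List G, l ≠ [] ∧ l.Subperm S ∧ l.length ≤ m ∧ C.a l.prod = 0 ∧ C.b l.prod = 0

variable {C} in
theorem HasShort.mono {S S' : List G} {m m' : ℕ} (h : C.HasShort S m) (hS : S.Subperm S')
    (hm : m ≤ m') : C.HasShort S' m' := by
  obtain ⟨l, h0, h1, h2, h3⟩ := h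
  exact ⟨l, h0, h1.trans hS, h2.trans hm, h3⟩

theorem pow_val_add [NeZero p] (hu : u ^ p = 1) (c d : ZMod p) :
    u ^ (c + d).val = u ^ c.val * u ^ d.val := by
  rw [ZMod.val_add, ← pow_add, ← pow_mod_orderOf u (_ % p), ← pow_mod_orderOf u (c.val + d.val),
    Nat.mod_mod_of_dvd _ (orderOf_dvd_of_pow_eq_one hu)]

theorem pow_val_injective [NeZero p] (hu : orderOf u = p) {c d : ZMod p}
    (h : u ^ c.val = u ^ d.val) : c = d :=
  ZMod.val_injective p <| pow_injOn_Iio_orderOf (x := u) (by simp [hu, ZMod.val_lt])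
    (by simp [hu, ZMod.val_lt]) h

theorem a_rotate [NeZero p] (hu : u ^ p = 1) {l : List G} (hl : C.b l.prod = 0) {i : ℕ}
    (hi : i ≤ l.length) :
    u ^ (C.b (l.take i).prod).val * C.a (l.rotate i).prod = C.a l.prod := by
  have h0 : C.b (l.take i).prod + C.b (l.drop i).prod = 0 := by
    rw [← C.b_mul, ← List.prod_append, List.take_append_drop, hl]
  rw [List.rotate_eq_drop_append_take hi, List.prod_append, C.a_mul, mul_add, ← mul_assoc,
    ← pow_val_add hu, h0]
  conv_rhs => rw [← List.take_append_drop i l, List.prod_append, C.a_mul]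
  simp [add_comm]

section Prime

variable {q : ℕ} [Fact q.Prime] {w : ZMod q} (D : SplitCoords q p w G)

open Classical in
/-- The `a`-coordinates of the products with trivial `b`-coordinate of the nonempty subsequences
of `S`. -/
noncomputable def subproducts (S : List G) : Finset (ZMod q) :=
  {c | ∃ l : List G, l ≠ [] ∧ l.Subperm S ∧ D.b l.prod = 0 ∧ D.a l.prod = c}

theorem mem_subproducts {S : List G} {c : ZMod q} : c ∈ D.subproducts S ↔
    ∃ l : List G, l ≠ [] ∧ l.Subperm S ∧ D.b l.prod = 0 ∧ D.a l.prod = c := by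
  simp [subproducts]

theorem hasShort_of_zero_mem {S : List G} (h : 0 ∈ D.subproducts S) :
    D.HasShort S S.length := by
  obtain ⟨l, h0, h1, h2, h3⟩ := D.mem_subproducts.1 h
  exact ⟨l, h0, h1, h1.length_le, h3, h2⟩

theorem length_le_card_subproducts [NeZero p] (hw : orderOf w = p) {l : List G}
    (hl : D.b l.prod = 0) (hmin : ∀ l' : List G, l' ≠ [] → l'.Subperm l → D.b l'.prod = 0 →
      l.length ≤ l'.length) (h0 : 0 ∉ D.subproducts l) :
    l.length ≤ (D.subproducts l).card := by
  rcases eq_or_ne l [] with rfl | hne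
  · simp
  have hw' : w ^ p = 1 := hw ▸ pow_orderOf_eq_one w
  have hrot : ∀ i, D.b (l.rotate i).prod = 0 := fun i => by
    rw [D.b_prod_perm (List.rotate_perm l i), hl]
  have key : ∀ i j, i < j → j < l.length →
      D.a (l.rotate i).prod ≠ D.a (l.rotate j).prod := by
    intro i j hij hj heq
    have hi := D.a_rotate hw' hl (i := i) (by omega)
    have hj' := D.a_rotate hw' hl (i := j) hj.le
    have hv : D.a (l.rotate j).prod ≠ 0 := fun hv => h0 <| D.mem_subproducts.2
      ⟨l, hne, List.Subperm.refl l, hl, by rw [← hj', hv, mul_zero]⟩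
    rw [heq, ← hj'] at hi
    have hb := pow_val_injective hw (mul_right_cancel₀ hv hi)
    have hsplit : l.take j = l.take i ++ (l.take j).drop i := by
      conv_lhs => rw [← List.take_append_drop i (l.take j)]
      rw [List.take_take, min_eq_left hij.le]
    rw [hsplit, List.prod_append, D.b_mul, left_eq_add] at hb
    have hlen : ((l.take j).drop i).length = j - i := by simp [hj.le]
    have := hmin _ (by intro h; rw [h] at hlen; simp at hlen; omega)
      ((List.drop_sublist _ _).trans (List.take_sublist _ _)).subperm hb
    omega
  rw [← Finset.card_range l.length]
  refine Finset.card_le_card_of_injOn (fun i => D.a (l.rotate i).prod) ?_ ?_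
  · intro i _
    exact Finset.mem_coe.2 <| D.mem_subproducts.2 ⟨l.rotate i, by simpa using hne,
      (List.rotate_perm l i).subperm, hrot i, rfl⟩
  · intro i hi j hj heq
    rw [Finset.mem_coe, Finset.mem_range] at hi hj
    by_contra hne'
    rcases lt_or_gt_of_ne hne' with h | h
    exacts [key i j h hj heq, key j i h hi heq.symm]

theorem card_subproducts [NeZero p] (hw : orderOf w = p) (N : ℕ) :
    ∀ S : List G, S.length = N → D.b S.prod = 0 → 0 ∉ D.subproducts S →
      min q N ≤ (D.subproducts S).card := by
  classical
  induction N using Nat.strong_induction_on with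
  | _ N ih =>
  intro S hN hb h0
  rcases eq_or_ne S [] with rfl | hne
  · subst hN
    simp
  have hex : ∃ k, ∃ l : List G, l ≠ [] ∧ l.Subperm S ∧ D.b l.prod = 0 ∧ l.length = k :=
    ⟨_, S, hne, List.Subperm.refl S, hb, rfl⟩
  obtain ⟨l, hl0, hlS, hlb, hlk⟩ := Nat.find_spec hex
  have hmin : ∀ l' : List G, l' ≠ [] → l'.Subperm l → D.b l'.prod = 0 → l.length ≤ l'.length :=
    fun l' h1 h2 h3 => hlk ▸ Nat.find_min' hex ⟨l', h1, h2.trans hlS, h3, rfl⟩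
  obtain ⟨R, hR⟩ := exists_perm_append_of_subperm hlS
  have hRS : R.Subperm S := subperm_of_perm_append (hR.trans List.perm_append_comm)
  have hlR : l.length + R.length = N := by rw [← hN, hR.length_eq, List.length_append]
  have hlpos : 0 < l.length := List.length_pos_of_ne_nil hl0
  have hRb : D.b R.prod = 0 := by
    rw [D.b_prod_perm hR, List.prod_append, D.b_mul, hlb, zero_add] at hb
    exact hb
  have hmono : ∀ T : List G, T.Subperm S → 0 ∉ D.subproducts T := fun T hT h => by
    obtain ⟨t, h1, h2, h3⟩ := D.mem_subproducts.1 h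
    exact h0 (D.mem_subproducts.2 ⟨t, h1, h2.trans hT, h3⟩)
  have hl := D.length_le_card_subproducts hw hlb hmin (hmono l hlS)
  have hRc := ih R.length (by omega) R rfl hRb (hmono R hRS)
  have hcd := ZMod.cauchy_davenport (Fact.out : q.Prime)
    (s := D.subproducts l) (t := insert 0 (D.subproducts R))
    (Finset.card_pos.1 (by omega)) (Finset.insert_nonempty _ _)
  rw [Finset.card_insert_of_notMem (hmono R hRS)] at hcd
  have hsub : D.subproducts l + insert 0 (D.subproducts R) ⊆ D.subproducts S := by
    intro c hc
    obtain ⟨c₁, hc₁, c₂, hc₂, rfl⟩ := Finset.mem_add.1 hc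
    obtain ⟨l₁, h1, h2, h3, rfl⟩ := D.mem_subproducts.1 hc₁
    rcases Finset.mem_insert.1 hc₂ with rfl | hc₂
    · exact D.mem_subproducts.2 ⟨l₁, h1, h2.trans hlS, h3, by simp⟩
    · obtain ⟨l₂, -, h5, h6, rfl⟩ := D.mem_subproducts.1 hc₂
      refine D.mem_subproducts.2 ⟨l₁ ++ l₂, by simp [h1], (h2.append h5).trans hR.symm.subperm,
        ?_, ?_⟩
      · rw [List.prod_append, D.b_mul, h3, h6, add_zero]
      · rw [List.prod_append, D.a_mul_of_b_eq_zero h3]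
  have := Finset.card_le_card hsub
  omega

/-- A sequence of length `q` whose product has trivial `b`-coordinate has a subsequence with
trivial product. -/
theorem hasShort_of_b_eq_zero [NeZero p] (hw : orderOf w = p) {S : List G} (hS : S.length = q)
    (hb : D.b S.prod = 0) : D.HasShort S q := by
  by_contra hcon
  have h0 : 0 ∉ D.subproducts S := fun h => hcon (hS ▸ D.hasShort_of_zero_mem h)
  have h1 := D.card_subproducts hw q S hS hb h0
  have h2 : (insert 0 (D.subproducts S)).card ≤ q := by
    simpa [ZMod.card] using Finset.card_le_univ (insert 0 (D.subproducts S))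
  rw [Finset.card_insert_of_notMem h0] at h2
  simp at h1
  omega

end Prime

end SplitCoords

namespace SplitCoords

variable {G : Type*} [Group G] {n p : ℕ} {u : ZMod n} (C : SplitCoords n p u G)

theorem pow_val_nsmul [NeZero p] (hu : u ^ p = 1) (m : ℕ) (c : ZMod p) :
    u ^ (m • c).val = (u ^ c.val) ^ m := by
  induction m with
  | zero => simp
  | succ m ih => rw [succ_nsmul, pow_val_add hu, ih, pow_succ]

theorem b_prod_of_forall {l : List G} {β : ZMod p} (h : ∀ s ∈ l, C.b s = β) :
    C.b l.prod = l.length • β := by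
  rw [C.b_prod, List.map_congr_left h, List.map_const', List.sum_replicate]

theorem a_prod_range [NeZero p] (hu : u ^ p = 1) {β : ZMod p} (f : ℕ → G) (m : ℕ)
    (hf : ∀ i < m, C.b (f i) = β) :
    C.a ((List.range m).map f).prod = ∑ i ∈ Finset.range m, (u ^ β.val) ^ i * C.a (f i) := by
  induction m with
  | zero => simp [C.a_one]
  | succ m ih =>
    have hb : C.b ((List.range m).map f).prod = m • β := by
      simpa using C.b_prod_of_forall (l := (List.range m).map f) (β := β)
        (by simpa using fun i hi => hf i (by omega))
    rw [List.range_succ, List.map_append, List.prod_append, C.a_mul, hb, pow_val_nsmul hu,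
      ih fun i hi => hf i (by omega), Finset.sum_range_succ]
    simp

section Prime

variable {q : ℕ} [Fact q.Prime] {w : ZMod q} (D : SplitCoords q p w G)

theorem hasShort_of_repeat [NeZero p] {β : ZMod p} (hw : w ^ p = 1) (h1 : w ^ β.val ≠ 1)
    (f : ℕ → G) {c : ZMod q} (hb : ∀ i < p, D.b (f i) = β) (ha : ∀ i < p, D.a (f i) = c) :
    D.HasShort ((List.range p).map f) p := by
  refine ⟨_, ?_, List.Subperm.refl _, by simp, ?_, ?_⟩
  · simpa using NeZero.ne p
  · rw [D.a_prod_range hw f p hb, Finset.sum_congr rfl fun i hi => by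
      rw [ha i (Finset.mem_range.1 hi)], ← Finset.sum_mul]
    have := mul_neg_geom_sum (w ^ β.val) p
    rw [← pow_mul, mul_comm β.val, pow_mul, hw, one_pow, sub_self, mul_eq_zero, sub_eq_zero] at this
    rw [this.resolve_left (Ne.symm h1), zero_mul]
  · rw [D.b_prod_of_forall (β := β) (by simpa using hb)]
    simp

/-- Among `k * p` elements with constant `b`-coordinate whose `a`-coordinates are distinct along
each residue class of indices, some `p` multiply to `a`-coordinate `0` or a prescribed `c`. -/
theorem exists_prod_eq [NeZero p] (hp : p.Prime) {β : ZMod p} (hw : orderOf (w ^ β.val) = p)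
    (hw' : w ^ p = 1) {k : ℕ} (hq : q = k * p + 1) (hk : 0 < k) (v : ℕ → G)
    (hb : ∀ i < k * p, D.b (v i) = β)
    (hinj : ∀ j < p, Set.InjOn (fun i => D.a (v (j + p * i))) (Finset.range k : Finset ℕ))
    {c : ZMod q} (hc : c ≠ 0) :
    ∃ l : List G, l.Subperm ((List.range (k * p)).map v) ∧ l.length = p ∧
      D.b l.prod = 0 ∧ (D.a l.prod = 0 ∨ D.a l.prod = c) := by
  classical
  have hlb : ∀ l : List G, l.Subperm ((List.range (k * p)).map v) → ∀ s ∈ l, D.b s = β := by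
    intro l hl s hs
    obtain ⟨i, hi, rfl⟩ := List.mem_map.1 (hl.subset hs)
    exact hb i (List.mem_range.1 hi)
  have hζ0 : w ^ β.val ≠ 0 := fun h => by
    have := pow_orderOf_eq_one (w ^ β.val)
    rw [hw, h, zero_pow hp.ne_zero] at this
    exact zero_ne_one this
  obtain ⟨X, hX, hXc⟩ := cauchy_davenport_choice (Fact.out : q.Prime) p (fun _ => Finset.range k)
    (fun j i => (w ^ β.val) ^ j * D.a (v (j + p * i))) (fun _ => ⟨0, by simpa using hk⟩)
    (fun j hj i hi i' hi' h => hinj j hj hi hi' (mul_left_cancel₀ (pow_ne_zero j hζ0) h))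
  have hXl : ∀ x ∈ X, ∃ l : List G, l.Subperm ((List.range (k * p)).map v) ∧ l.length = p ∧
      D.a l.prod = x := by
    intro x hx
    obtain ⟨e, he, rfl⟩ := hXc x hx
    simp only [Finset.mem_range] at he
    have hlt : ∀ j < p, j + p * e j < k * p := fun j hj => by
      have := Nat.mul_le_mul_left p (he j hj)
      rw [Nat.mul_succ, mul_comm p k] at this
      omega
    refine ⟨((List.range p).map fun j => j + p * e j).map v, subperm_map_index v ?_ ?_,
      by simp, ?_⟩
    · refine List.Nodup.map_on (fun i hi j hj h => ?_) List.nodup_range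
      have := congrArg (· % p) h
      simpa [Nat.mod_eq_of_lt (List.mem_range.1 hi), Nat.mod_eq_of_lt (List.mem_range.1 hj)]
        using this
    · simpa using hlt
    · rw [List.map_map]
      exact D.a_prod_range hw' (fun j => v (j + p * e j)) p fun j hj => hb _ (hlt j hj)
  by_contra hcon
  push Not at hcon
  have hl0 : ∀ l : List G, l.Subperm ((List.range (k * p)).map v) → l.length = p →
      D.b l.prod = 0 := fun l hl hlp => by
    rw [D.b_prod_of_forall (hlb l hl), hlp]
    simp
  have h0 : 0 ∉ X := fun h => by
    obtain ⟨l, h1, h2, h3⟩ := hXl 0 h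
    exact (hcon l h1 h2 (hl0 l h1 h2)).1 h3
  have hZ : ∀ i < p, (w ^ β.val) ^ i * c ∉ X := fun i hi h => by
    obtain ⟨l, h1, h2, h3⟩ := hXl _ h
    have hr := D.a_rotate hw' (hl0 l h1 h2) (i := i) (by omega)
    have hrot : (l.rotate i).Subperm ((List.range (k * p)).map v) :=
      (List.rotate_perm l i).subperm.trans h1
    rw [D.b_prod_of_forall fun s hs => hlb l h1 s (List.mem_of_mem_take hs), List.length_take,
      min_eq_left (by omega), pow_val_nsmul hw', h3] at hr
    exact (hcon _ hrot (by simpa using h2) (hl0 _ hrot (by simpa using h2))).2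
      (mul_left_cancel₀ (pow_ne_zero i hζ0) hr)
  let Z := (Finset.range p).image fun i => (w ^ β.val) ^ i * c
  have hZc : Z.card = p := by
    rw [Finset.card_image_of_injOn, Finset.card_range]
    intro i hi j hj h
    exact pow_injOn_Iio_orderOf (by simpa [hw] using hi) (by simpa [hw] using hj)
      (mul_right_cancel₀ hc h)
  have hZ0 : 0 ∉ Z := fun h => by
    obtain ⟨i, -, hi⟩ := Finset.mem_image.1 h
    exact mul_ne_zero (pow_ne_zero i hζ0) hc hi
  have hdisj : Disjoint X (insert 0 Z) := by
    rw [Finset.disjoint_right]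
    intro x hx
    rcases Finset.mem_insert.1 hx with rfl | hx
    · exact h0
    · obtain ⟨i, hi, rfl⟩ := Finset.mem_image.1 hx
      exact hZ i (Finset.mem_range.1 hi)
  have hcard := Finset.card_le_univ (X ∪ insert 0 Z)
  rw [Finset.card_union_of_disjoint hdisj, Finset.card_insert_of_notMem hZ0, hZc,
    ZMod.card] at hcard
  obtain ⟨k, rfl⟩ := Nat.exists_eq_succ_of_ne_zero hk.ne'
  simp only [Finset.card_range, Finset.sum_const, smul_eq_mul, Nat.succ_eq_add_one,
    Nat.add_sub_cancel, mul_comm p, Nat.add_mul] at hX hq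
  omega

theorem hasShort_of_b_eq_const [NeZero p] (hp : p.Prime) (hw : orderOf w = p) {β : ZMod p}
    (hβ : β ≠ 0) {k : ℕ} (hq : q = k * p + 1) (hk : 0 < k) {V R : List G}
    (hV : V.length = q + 1) (hR : R.length + 2 = p) (hb : ∀ s ∈ V, D.b s = β) :
    D.HasShort (V ++ R) q := by
  have hw' : w ^ p = 1 := hw ▸ pow_orderOf_eq_one w
  have hpq : p ≤ q := by nlinarith
  have hζ : orderOf (w ^ β.val) = p := by
    rw [Nat.Coprime.orderOf_pow, hw]
    rw [hw, hp.coprime_iff_not_dvd]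
    exact Nat.not_dvd_of_pos_of_lt (Nat.pos_of_ne_zero (by simpa using hβ)) (ZMod.val_lt β)
  have hζ1 : w ^ β.val ≠ 1 := fun h => by
    rw [h, orderOf_one] at hζ
    exact hp.one_lt.ne hζ
  obtain ⟨v, hv, hmono⟩ := exists_monotone_enum V fun s => (D.a s).val
  rw [hV] at hv hmono
  have hbv : ∀ t < q + 1, D.b (v t) = β := fun t ht =>
    hb _ (hv.subset (List.mem_map.2 ⟨t, List.mem_range.2 ht, rfl⟩))
  by_contra hcon
  have hstrict : ∀ t, t + (p - 1) ≤ q → (D.a (v t)).val < (D.a (v (t + (p - 1)))).val := by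
    intro t ht
    by_contra hlt
    refine hcon ((D.hasShort_of_repeat hw' hζ1 (fun i => v (t + i)) (c := D.a (v t))
      (fun i hi => hbv _ (by omega)) fun i hi => ZMod.val_injective q ?_).mono ?_ hpq)
    · have h1 := hmono t (t + i) (by omega) (by omega)
      have h2 := hmono (t + i) (t + (p - 1)) (by omega) (by omega)
      omega
    · have := (subperm_map_index (m := q + 1) v (I := (List.range p).map (t + ·))
        (List.nodup_range.map (add_right_injective t))
        (by simpa using fun i hi => by omega)).trans hv.subperm
      rw [List.map_map] at this
      exact this.trans (List.sublist_append_left V R).subperm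
  rcases Nat.lt_or_ge k 2 with hk2 | hk2
  · obtain rfl : k = 1 := by omega
    rw [one_mul] at hq
    have hp2 : p = 2 := by
      rcases hp.eq_two_or_odd with h | h
      · exact h
      · rcases (Fact.out : q.Prime).eq_two_or_odd with h' | h'
        · have := hp.two_le
          omega
        · omega
    have h0 := hstrict 0
    have h1 := hstrict 1
    have h2 := hstrict 2
    have h3 := ZMod.val_lt (D.a (v 3))
    simp only [hp2, hq] at h0 h1 h2 h3
    norm_num at h0 h1 h2
    omega
  · have hinj : ∀ j < p, Set.InjOn (fun i => D.a (v (j + p * i))) (Finset.range k : Finset ℕ) := by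
      have hlt : ∀ j < p, ∀ i i', i < i' → i' < k →
          D.a (v (j + p * i)) ≠ D.a (v (j + p * i')) := by
        intro j hj i i' hi hi' h
        have h1 := Nat.mul_le_mul_left p hi
        have h2 := Nat.mul_le_mul_left p hi'
        rw [Nat.mul_succ] at h1 h2
        rw [mul_comm k] at hq
        have h3 := hstrict (j + p * i) (by omega)
        have h4 := hmono (j + p * i + (p - 1)) (j + p * i') (by omega) (by omega)
        rw [h] at h3
        omega
      intro j hj i hi i' hi' h
      rw [Finset.mem_coe, Finset.mem_range] at hi hi'
      by_contra hne
      rcases lt_or_gt_of_ne hne with h' | h'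
      exacts [hlt j hj i i' h' hi' h, hlt j hj i' i h' hi h.symm]
    have hsplit : (V ++ R).Perm
        ((List.range (k * p)).map v ++ ([v (k * p), v (k * p + 1)] ++ R)) := by
      rw [← List.append_assoc]
      refine List.Perm.append_right R (hv.symm.trans (List.Perm.of_eq ?_))
      rw [hq, List.range_succ, List.range_succ]
      simp
    obtain ⟨T, hT0, hTR, hTb⟩ := exists_zero_sum_sublist (⊤ : AddSubgroup (ZMod p))
      ([v (k * p), v (k * p + 1)] ++ R) D.b (by simp) (by
        rw [AddSubgroup.card_top, Nat.card_zmod]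
        simp
        omega)
    rw [← D.b_prod] at hTb
    have hTl : T.length ≤ p := by
      have := hTR.length_le
      simp at this
      omega
    by_cases hTa : D.a T.prod = 0
    · exact hcon ⟨T, hT0, hTR.subperm.trans (subperm_of_perm_append
        (hsplit.trans List.perm_append_comm)), hTl.trans hpq, hTa, hTb⟩
    obtain ⟨l, hl, hlp, hlb, hla⟩ := D.exists_prod_eq hp hζ hw' hq hk v
      (fun i hi => hbv i (by omega)) hinj (neg_ne_zero.2 hTa)
    have hl0 : l ≠ [] := List.ne_nil_of_length_pos (hlp ▸ hp.pos)
    rcases hla with hla | hla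
    · exact hcon ⟨l, hl0, hl.trans (subperm_of_perm_append hsplit), by omega, hla, hlb⟩
    · refine hcon ⟨l ++ T, by simp [hl0], (hl.append hTR.subperm).trans hsplit.symm.subperm, ?_,
        ?_, ?_⟩
      · have := Nat.mul_le_mul_right p hk2
        rw [List.length_append]
        omega
      · rw [List.prod_append, D.a_mul_of_b_eq_zero hlb, hla, neg_add_cancel]
      · rw [List.prod_append, D.b_mul, hlb, hTb, add_zero]

/-- The bound for `n` prime. -/
theorem hasShort_of_prime (hp : p.Prime) (hw : orderOf w = p) {S : List G}
    (hS : S.length = q + p - 1) : D.HasShort S q := by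
  have hq : q.Prime := Fact.out
  have : NeZero p := ⟨hp.ne_zero⟩
  have hp2 := hp.two_le
  have hw0 : w ≠ 0 := fun h => by
    have := pow_orderOf_eq_one w
    rw [hw, h, zero_pow hp.ne_zero] at this
    exact zero_ne_one this
  obtain ⟨k, hk⟩ := hw ▸ ZMod.orderOf_dvd_card_sub_one hw0
  have hqk : q = k * p + 1 := by
    have := hq.one_lt
    rw [mul_comm]
    omega
  have hk0 : 0 < k := Nat.pos_of_ne_zero fun h => by
    subst h
    have := hq.one_lt
    omega
  obtain ⟨s, hs, hmono⟩ := exists_monotone_enum S fun t => (D.b t).val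
  rw [hS] at hs hmono
  by_cases hrep : ∃ i < p - 1, D.b (s i) = D.b (s (i + q))
  · obtain ⟨i, hi, heq⟩ := hrep
    have hconst : ∀ j < q + 1, D.b (s (i + j)) = D.b (s i) := fun j hj => by
      refine ZMod.val_injective p ?_
      have h1 := hmono i (i + j) (by omega) (by omega)
      have h2 := hmono (i + j) (i + q) (by omega) (by omega)
      rw [heq] at h1 ⊢
      omega
    have hsub := (subperm_map_index (m := q + p - 1) s (I := (List.range (q + 1)).map (i + ·))
        (List.nodup_range.map (add_right_injective i))
        (by simpa using fun i hi => by omega)).trans hs.subperm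
    obtain ⟨R, hR⟩ := exists_perm_append_of_subperm hsub
    have hb : ∀ t ∈ ((List.range (q + 1)).map (i + ·)).map s, D.b t = D.b (s i) := by
      simpa using hconst
    by_cases hβ : D.b (s i) = 0
    · refine (D.hasShort_of_b_eq_zero hw
        (S := (((List.range (q + 1)).map (i + ·)).map s).take q) (by simp) ?_).mono
        ((List.take_sublist _ _).subperm.trans hsub) le_rfl
      rw [D.b_prod_of_forall fun t ht => hb t (List.mem_of_mem_take ht), hβ, smul_zero]
    · refine (D.hasShort_of_b_eq_const hp hw hβ hqk hk0 (R := R) (by simp) ?_ hb).mono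
        hR.symm.subperm le_rfl
      have := hR.length_eq
      simp at this
      omega
  · push Not at hrep
    obtain ⟨X, hX, hXc⟩ := cauchy_davenport_choice hp q
      (fun i => if i < p - 1 then {i, i + q} else {i}) (fun _ j => D.b (s j))
      (fun i => by split_ifs <;> simp) (fun i _ => by
        split_ifs with h
        · rw [Finset.coe_pair, Set.injOn_pair]
          exact fun h' => absurd h' (hrep i h)
        · simp)
    have hsum : ∑ i ∈ Finset.range q,
        ((if i < p - 1 then ({i, i + q} : Finset ℕ) else {i}).card - 1) = p - 1 := by
      have : ∀ i, ((if i < p - 1 then ({i, i + q} : Finset ℕ) else {i}).card - 1) =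
          if i < p - 1 then 1 else 0 := fun i => by
        split_ifs
        · rw [Finset.card_pair (by have := hq.pos; omega)]
        · simp
      simp_rw [this]
      rw [← Finset.card_filter]
      have : (Finset.range q).filter (· < p - 1) = Finset.range (p - 1) := by
        ext i
        rw [Finset.mem_filter, Finset.mem_range, Finset.mem_range]
        have : p ≤ q := by nlinarith
        omega
      rw [this, Finset.card_range]
    have h0 : (0 : ZMod p) ∈ X := by
      have : X = Finset.univ := by
        rw [← Finset.card_eq_iff_eq_univ, ZMod.card]
        refine le_antisymm ((Finset.card_le_univ X).trans (ZMod.card p).le) ?_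
        rw [hsum] at hX
        omega
      simp [this]
    obtain ⟨c, hc, hc0⟩ := hXc 0 h0
    have hc' : ∀ i < q, (c i = i ∨ c i = i + q) ∧ c i < q + p - 1 := fun i hi => by
      have := hc i hi
      split_ifs at this with h
      · simp at this
        omega
      · simp at this
        omega
    have hsub := (subperm_map_index (m := q + p - 1) s (I := (List.range q).map c)
        (List.Nodup.map_on (fun i hi j hj h => by
          have h1 := hc' i (List.mem_range.1 hi)
          have h2 := hc' j (List.mem_range.1 hj)
          rw [List.mem_range] at hi hj
          omega) List.nodup_range)
        (by simpa using fun i hi => (hc' i hi).2)).trans hs.subperm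
    refine (D.hasShort_of_b_eq_zero hw (by simp) ?_).mono hsub le_rfl
    rw [D.b_prod, ← hc0, List.map_map, List.map_map, Finset.sum_range]
    rw [← List.sum_ofFn, List.ofFn_eq_map]
    rw [← List.map_coe_finRange_eq_range, List.map_map]
    rfl

end Prime

end SplitCoords

section ZeroSum

variable {ι : Type*} {p : ℕ} [Fact p.Prime]

theorem exists_simultaneous_zero_sum_sublist {κ : Type*} [Fintype κ] (f : κ → ι → ZMod p)
    (L : List ι)
    (hL : Fintype.card κ * (p - 1) < L.length) :
    ∃ l, l ≠ [] ∧ l.Sublist L ∧ ∀ k, (l.map (f k)).sum = 0 := by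
  classical
  have hp : p.Prime := Fact.out
  let F : κ → MvPolynomial (Fin L.length) (ZMod p) := fun k =>
    ∑ i, MvPolynomial.C (f k (L.get i)) * MvPolynomial.X i ^ (p - 1)
  have hF : ∀ k, (F k).totalDegree ≤ p - 1 := fun k => by
    refine MvPolynomial.totalDegree_finsetSum_le fun i _ => ?_
    refine (MvPolynomial.totalDegree_mul _ _).trans ?_
    rw [MvPolynomial.totalDegree_C, MvPolynomial.totalDegree_X_pow, zero_add]
  have hdvd := char_dvd_card_solutions_of_fintype_sum_lt p (f := F) (by
    refine (Finset.sum_le_sum fun k _ => hF k).trans_lt ?_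
    simpa using hL)
  let z : {x : Fin L.length → ZMod p // ∀ k, MvPolynomial.eval x (F k) = 0} :=
    ⟨0, fun k => by simp [F, map_sum, Nat.sub_ne_zero_of_lt hp.one_lt]⟩
  obtain ⟨⟨x, hx⟩, hxz⟩ := Fintype.exists_ne_of_one_lt_card (hp.one_lt.trans_le
    (Nat.le_of_dvd (Fintype.card_pos_iff.2 ⟨z⟩) hdvd)) z
  have hx0 : ∃ i, x i ≠ 0 := by
    by_contra! h
    exact hxz (Subtype.ext (funext h))
  refine ⟨((List.finRange L.length).filter (x · ≠ 0)).map L.get, ?_, ?_, fun k => ?_⟩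
  · obtain ⟨i, hi⟩ := hx0
    exact List.ne_nil_of_mem (List.mem_map_of_mem (a := i) (by simpa using hi))
  · conv_rhs => rw [← List.map_get_finRange L]
    exact List.filter_sublist.map _
  · have hsum : ∀ l : List (Fin L.length),
        (((l.filter (x · ≠ 0)).map L.get).map (f k)).sum =
          (l.map fun i => f k (L.get i) * x i ^ (p - 1)).sum := fun l => by
      induction l with
      | nil => simp
      | cons i l ih =>
        by_cases hi : x i = 0
        · simpa [hi, Nat.sub_ne_zero_of_lt hp.one_lt] using ih
        · simpa [hi, ZMod.pow_card_sub_one_eq_one hi] using ih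
    rw [hsum, ← Fin.sum_univ_def]
    simpa [F, map_sum] using hx k

theorem exists_zero_sum_length_le_two_mul (f g : ι → ZMod p) (L : List ι)
    (hL : 2 * p - 1 ≤ L.length) :
    ∃ l, l.Subperm L ∧ l.length ≤ 2 * p - 1 ∧
      l ≠ [] ∧ (l.map f).sum = 0 ∧ (l.map g).sum = 0 := by
  have hp : p.Prime := Fact.out
  have := hp.one_lt
  obtain ⟨l, h0, hl, h⟩ := exists_simultaneous_zero_sum_sublist ![f, g] (L.take (2 * p - 1)) (by
    rw [List.length_take, Fintype.card_fin]
    omega)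
  refine ⟨l, (hl.trans (List.take_sublist _ _)).subperm, ?_, h0, h 0, h 1⟩
  exact hl.length_le.trans (List.length_take_le _ _)

theorem exists_zero_sum_length_le (f g : ι → ZMod p) (L : List ι) (hL : 3 * p - 2 ≤ L.length) :
    ∃ l, l.Subperm L ∧ l.length ≤ p ∧ l ≠ [] ∧ (l.map f).sum = 0 ∧ (l.map g).sum = 0 := by
  have hp : p.Prime := Fact.out
  have hp1 := hp.one_lt
  obtain ⟨l, h0, hl, h⟩ := exists_simultaneous_zero_sum_sublist ![f, g, fun _ => 1]
    (L.take (3 * p - 2)) (by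
      rw [List.length_take, Fintype.card_fin]
      omega)
  have hlL : l.Subperm L := (hl.trans (List.take_sublist _ _)).subperm
  have hf : (l.map f).sum = 0 := h 0
  have hg : (l.map g).sum = 0 := h 1
  have hdvd : p ∣ l.length := by
    have := h 2
    simpa [ZMod.natCast_eq_zero_iff] using this
  have hlen := hl.length_le.trans (List.length_take_le _ _)
  have hpos := List.length_pos_of_ne_nil h0
  by_cases hlp : l.length ≤ p
  · exact ⟨l, hlL, hlp, h0, hf, hg⟩
  have hl2 : l.length = 2 * p := by
    obtain ⟨k, hk⟩ := hdvd
    have h1 : 1 < k := by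
      by_contra! hk1
      nlinarith
    have h3 : k < 3 := by
      by_contra! hk3
      have := Nat.mul_le_mul_left p hk3
      omega
    obtain rfl : k = 2 := by omega
    omega
  obtain ⟨t, ht, htl, ht0, htf, htg⟩ := exists_zero_sum_length_le_two_mul f g l.tail (by
    rw [List.length_tail]
    omega)
  obtain ⟨r, hr⟩ := exists_perm_append_of_subperm (ht.trans (List.tail_sublist l).subperm)
  have hrl := hr.length_eq
  rw [List.length_append] at hrl
  by_cases htp : t.length ≤ p
  · exact ⟨t, (ht.trans (List.tail_sublist l).subperm).trans hlL, htp, ht0, htf, htg⟩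
  · refine ⟨r, (subperm_of_perm_append (hr.trans List.perm_append_comm)).trans hlL, by omega,
      List.ne_nil_of_length_pos (by omega), ?_, ?_⟩
    · have := (hr.map f).sum_eq
      rwa [hf, List.map_append, List.sum_append, htf, zero_add, eq_comm] at this
    · have := (hr.map g).sum_eq
      rwa [hg, List.map_append, List.sum_append, htg, zero_add, eq_comm] at this

end ZeroSum

section Cast

variable {n : ℕ}

theorem card_ker_castHom [NeZero n] {m : ℕ} (h : m ∣ n) :
    Nat.card (ZMod.castHom h (ZMod m)).toAddMonoidHom.ker = n / m := by
  have h1 := AddSubgroup.card_mul_index (ZMod.castHom h (ZMod m)).toAddMonoidHom.ker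
  have h2 : (ZMod.castHom h (ZMod m)).toAddMonoidHom.range = ⊤ :=
    AddMonoidHom.range_eq_top.2 (ZMod.castHom_surjective h)
  rw [AddSubgroup.index_ker, h2, AddSubgroup.card_top, Nat.card_zmod, Nat.card_zmod] at h1
  exact (Nat.div_eq_of_eq_mul_left (Nat.pos_of_dvd_of_pos h (NeZero.pos n)) h1.symm).symm

theorem eq_zero_of_coprime_mul {r s : ℕ} (h : r.Coprime s) {x : ZMod n} (hr : r * x = 0)
    (hs : s * x = 0) : x = 0 := by
  obtain ⟨a, b, hab⟩ := Nat.isCoprime_iff_coprime.2 h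
  have := congrArg (Int.cast (R := ZMod n)) hab
  push_cast at this
  linear_combination (-x) * this + a * hr + b * hs

end Cast

namespace SplitCoords

variable {G : Type*} [Group G] {n p : ℕ} {u : ZMod n} (C : SplitCoords n p u G)

theorem exists_sublist_of_blocks [NeZero n] {m : ℕ} (hm : m ∣ n) (Ts : List (List G))
    (hb : ∀ T ∈ Ts, C.b T.prod = 0) (ha : ∀ T ∈ Ts, ZMod.castHom hm (ZMod m) (C.a T.prod) = 0)
    (hlen : n / m ≤ Ts.length) :
    ∃ l, l ≠ [] ∧ l.Sublist Ts ∧ (l.map fun T => C.a T.prod).sum = 0 ∧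
      C.b l.flatten.prod = 0 ∧ C.a l.flatten.prod = 0 := by
  obtain ⟨l, h0, hl, hsum⟩ := exists_zero_sum_sublist (ZMod.castHom hm (ZMod m)).toAddMonoidHom.ker
    Ts (fun T => C.a T.prod) (fun T hT => ha T hT) ((card_ker_castHom hm).trans_le hlen)
  have h := C.prod_flatten l fun T hT => hb T (hl.subset hT)
  exact ⟨l, h0, hl, hsum, h.1, h.2.trans hsum⟩

theorem hasShort_of_blocks [NeZero n] {m c : ℕ} (hm : m ∣ n) (Ts : List (List G)) {S : List G}
    (hne : ∀ T ∈ Ts, T ≠ []) (hc : ∀ T ∈ Ts, T.length ≤ c) (hb : ∀ T ∈ Ts, C.b T.prod = 0)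
    (ha : ∀ T ∈ Ts, ZMod.castHom hm (ZMod m) (C.a T.prod) = 0) (hlen : n / m ≤ Ts.length)
    (hS : Ts.flatten.Subperm S) : C.HasShort S (Ts.length * c) := by
  obtain ⟨l, h0, hl, -, hlb, hla⟩ := C.exists_sublist_of_blocks hm Ts hb ha hlen
  refine ⟨l.flatten, ?_, hl.flatten.subperm.trans hS, ?_, hla, hlb⟩
  · obtain ⟨T, hT⟩ := List.exists_mem_of_ne_nil l h0
    exact fun h => hne T (hl.subset hT) (List.flatten_eq_nil_iff.1 h T hT)
  · exact (length_flatten_le l fun T hT => hc T (hl.subset hT)).trans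
      (Nat.mul_le_mul_right c hl.length_le)

section Unipotent

theorem pow_eq_one_add {δ : ZMod n} (h : δ * δ = 0) (k : ℕ) : (1 + δ) ^ k = 1 + k * δ := by
  induction k with
  | zero => simp
  | succ k ih =>
    rw [pow_succ, ih]
    push_cast
    linear_combination (k : ZMod n) * h

/-- If `p ^ 2 ∣ n`, an element killed by `p` has square zero and is divisible by `p`. -/
theorem exists_eq_mul_of_mul_eq_zero [NeZero n] (hp : 0 < p) (hpn : p * p ∣ n) {δ : ZMod n}
    (h : (p : ZMod n) * δ = 0) : δ * δ = 0 ∧ ∃ e, δ = p * e := by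
  obtain ⟨m, hm⟩ := hpn
  have h1 : p * (p * m) ∣ p * δ.val := by
    rw [← mul_assoc, ← hm, ← ZMod.natCast_eq_zero_iff]
    push_cast
    rwa [ZMod.natCast_zmod_val]
  obtain ⟨e, he⟩ := Nat.dvd_of_mul_dvd_mul_left hp h1
  have h2 : δ = p * m * e := by
    rw [← ZMod.natCast_zmod_val δ, he]
    push_cast
    rfl
  refine ⟨?_, m * e, by rw [h2, mul_assoc]⟩
  rw [h2]
  rw [h2] at h
  linear_combination (m * e : ZMod n) * h

variable (hdvd : p ∣ n)

theorem cast_a_prod (hu : ZMod.castHom hdvd (ZMod p) u = 1) (l : List G) :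
    ZMod.castHom hdvd (ZMod p) (C.a l.prod) =
      (l.map fun s => ZMod.castHom hdvd (ZMod p) (C.a s)).sum := by
  induction l with
  | nil => simp [C.a_one]
  | cons s l ih =>
    rw [List.prod_cons, C.a_mul, map_add, map_mul, map_pow, hu, one_pow, one_mul, ih,
      List.map_cons, List.sum_cons]

theorem a_prod_swap_ne [NeZero n] [Fact p.Prime] (hp0 : (p : ZMod n) * (u - 1) = 0)
    (hsq : (u - 1) * (u - 1) = 0) (hu : u ≠ 1) {s t : G}
    (hst : ZMod.castHom hdvd (ZMod p) (C.a s) * C.b t ≠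
      ZMod.castHom hdvd (ZMod p) (C.a t) * C.b s) (l : List G) :
    C.a (s :: t :: l).prod ≠ C.a (t :: s :: l).prod := by
  intro h
  have hpow : ∀ k : ℕ, u ^ k = 1 + k * (u - 1) := fun k => by
    rw [← pow_eq_one_add hsq, add_sub_cancel]
  rw [List.prod_cons, List.prod_cons, List.prod_cons, List.prod_cons, ← mul_assoc, ← mul_assoc,
    C.a_mul, C.a_mul (t * s), C.b_mul, C.b_mul, add_comm (C.b t), C.a_mul, C.a_mul,
    hpow (C.b s).val, hpow (C.b t).val] at h
  set z : ZMod n := (C.b s).val * C.a t - (C.b t).val * C.a s with hz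
  have h1 : z * (u - 1) = 0 := by
    linear_combination h
  have h2 : ¬ p ∣ z.val := by
    rw [← ZMod.natCast_eq_zero_iff, ← map_natCast (ZMod.castHom hdvd (ZMod p)),
      ZMod.natCast_zmod_val, hz, map_sub, map_mul, map_mul, map_natCast, map_natCast,
      ZMod.natCast_zmod_val, ZMod.natCast_zmod_val]
    intro h3
    exact hst (by linear_combination -h3)
  refine hu (sub_eq_zero.1 (eq_zero_of_coprime_mul
    (((Fact.out : p.Prime).coprime_iff_not_dvd).2 h2) hp0 ?_))
  rwa [ZMod.natCast_zmod_val]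

/-- The bound when `p * p ∣ n` and the action is trivial modulo `n / p`. -/
theorem hasShort_of_mul_sub_one_eq_zero [NeZero n] (hp : p.Prime) (hpn : p * p ∣ n)
    (hp0 : (p : ZMod n) * (u - 1) = 0) (hu : u ≠ 1) {S : List G}
    (hS : S.length = n + p - 1) : C.HasShort S n := by
  classical
  have : Fact p.Prime := ⟨hp⟩
  have hp2 := hp.two_le
  have hdvd : p ∣ n := (Dvd.intro _ rfl).trans hpn
  obtain ⟨hsq, e, he⟩ := exists_eq_mul_of_mul_eq_zero hp.pos hpn hp0
  have hu1 : ZMod.castHom hdvd (ZMod p) u = 1 := by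
    rw [← sub_eq_zero, ← map_one (ZMod.castHom hdvd (ZMod p)), ← map_sub, he, map_mul, map_natCast,
      CharP.cast_eq_zero, zero_mul]
  obtain ⟨M, hM⟩ := hdvd
  have hM2 : 2 ≤ M := by
    have h1 := Nat.le_of_dvd (NeZero.pos n) hpn
    have h2 : p ≤ M := Nat.le_of_mul_le_mul_left (hM ▸ h1) hp.pos
    omega
  have hnM : n / p = M := by rw [hM, Nat.mul_div_cancel_left _ hp.pos]
  obtain ⟨K, rfl⟩ : ∃ K, M = K + 1 := ⟨M - 1, by omega⟩
  have hdvd : p ∣ n := ⟨_, hM⟩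
  have hnK : n = K * p + p := by rw [hM]; ring
  set f : G → ZMod p := fun s => ZMod.castHom hdvd (ZMod p) (C.a s)
  have hgood : ∀ {T : List G}, (T.map f).sum = 0 ∧ (T.map C.b).sum = 0 ↔
      C.b T.prod = 0 ∧ ZMod.castHom hdvd (ZMod p) (C.a T.prod) = 0 := fun {T} => by
    rw [C.cast_a_prod hdvd hu1, C.b_prod, and_comm]
  obtain ⟨Ts, R, hTsl, hTs, hR⟩ := exists_disjoint_blocks
    (fun T : List G => T ≠ [] ∧ (T.map f).sum = 0 ∧ (T.map C.b).sum = 0) (3 * p - 2) p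
    (fun S hS => exists_zero_sum_length_le f C.b S hS) K S (by omega)
  have hTs0 : ∀ T ∈ Ts, C.b T.prod = 0 := fun T hT => (hgood.1 (hTs T hT).2.2).1
  have hTs1 : ∀ T ∈ Ts, ZMod.castHom hdvd (ZMod p) (C.a T.prod) = 0 := fun T hT =>
    (hgood.1 (hTs T hT).2.2).2
  have hRl : 2 * p - 1 ≤ R.length := by
    have h1 := hR.length_eq
    have h2 := length_flatten_le Ts fun T hT => (hTs T hT).1
    rw [List.length_append] at h1
    rw [hTsl] at h2
    omega
  have hsub : ∀ T : List G, T.Subperm R → (T :: Ts).flatten.Subperm S := fun T hT => by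
    rw [List.flatten_cons]
    exact (hT.append (List.Subperm.refl _)).trans
      (List.perm_append_comm.trans hR.symm).subperm
  have hlen : n / p ≤ Ts.length + 1 := by rw [hnM, hTsl]
  by_contra hcon
  have hlong : ∀ T : List G, T ≠ [] → T.Subperm R → (T.map f).sum = 0 → (T.map C.b).sum = 0 →
      p < T.length := by
    intro T h0 hT hf hb
    by_contra! hle
    have hT' := hgood.1 ⟨hf, hb⟩
    refine hcon ((C.hasShort_of_blocks (c := p) hdvd (T :: Ts)
      (List.forall_mem_cons.2 ⟨h0, fun T hT => (hTs T hT).2.1⟩)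
      (List.forall_mem_cons.2 ⟨hle, fun T hT => (hTs T hT).1⟩)
      (List.forall_mem_cons.2 ⟨hT'.1, hTs0⟩) (List.forall_mem_cons.2 ⟨hT'.2, hTs1⟩) hlen
      (hsub T hT)).mono (List.Subperm.refl _) ?_)
    rw [List.length_cons, hTsl, hnK, Nat.succ_mul]
  obtain ⟨T, hTR, hTl, hT0, hTf, hTb⟩ := exists_zero_sum_length_le_two_mul f C.b R hRl
  have hTp := hlong T hT0 hTR hTf hTb
  have horder : ∀ l : List G, l.Perm T → C.a l.prod = - (Ts.map fun T => C.a T.prod).sum := by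
    intro l hl
    have hlb := hgood.1 ⟨(hl.map f).sum_eq.trans hTf, (hl.map C.b).sum_eq.trans hTb⟩
    obtain ⟨L, hL0, hL, hLs, hLb, hLa⟩ := C.exists_sublist_of_blocks hdvd (l :: Ts)
      (List.forall_mem_cons.2 ⟨hlb.1, hTs0⟩) (List.forall_mem_cons.2 ⟨hlb.2, hTs1⟩) hlen
    have hbig : n < L.flatten.length := by
      by_contra! hle
      refine hcon ⟨L.flatten, ?_, hL.flatten.subperm.trans (hsub l (hl.subperm.trans hTR)), hle,
        hLa, hLb⟩
      obtain ⟨U, hU⟩ := List.exists_mem_of_ne_nil L hL0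
      intro h
      have hU' := List.flatten_eq_nil_iff.1 h U hU
      rcases List.mem_cons.1 (hL.subset hU) with h' | h'
      · rw [← h', hU'] at hl
        exact hT0 hl.symm.eq_nil
      · exact (hTs U h').2.1 hU'
    rcases List.sublist_cons_iff.1 hL with hL' | ⟨L', rfl, hL'⟩
    · have h1 := length_flatten_le L fun U hU => (hTs U (hL'.subset hU)).1
      have h2 := Nat.mul_le_mul_right p hL'.length_le
      rw [hTsl] at h2
      omega
    · have h1 := length_flatten_le L' fun U hU => (hTs U (hL'.subset hU)).1
      have h2 := hl.length_eq
      rw [List.flatten_cons, List.length_append] at hbig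
      have h3 : L' = Ts := by
        refine hL'.eq_of_length (le_antisymm hL'.length_le ?_)
        by_contra! hlt
        rw [hTsl] at hlt
        have h4 := Nat.mul_le_mul_right p hlt
        rw [Nat.succ_mul] at h4
        omega
      rw [List.map_cons, List.sum_cons, h3] at hLs
      exact eq_neg_of_add_eq_zero_left hLs
  by_cases hcomm : ∀ s ∈ T, ∀ t ∈ T, f s * C.b t = f t * C.b s
  · have hpig : ∀ h : G → ZMod p, ∃ l : List G, l ≠ [] ∧ l.Sublist T ∧ l.length ≤ p ∧
        (l.map h).sum = 0 := fun h => by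
      obtain ⟨l, h0, hl, hs⟩ := exists_zero_sum_sublist (⊤ : AddSubgroup (ZMod p)) (T.take p) h
        (by simp) (by
          rw [AddSubgroup.card_top, Nat.card_zmod, List.length_take]
          omega)
      exact ⟨l, h0, hl.trans (List.take_sublist _ _),
        hl.length_le.trans (List.length_take_le _ _), hs⟩
    by_cases hb0 : ∃ s ∈ T, C.b s ≠ 0
    · obtain ⟨s, hs, hbs⟩ := hb0
      obtain ⟨l, h0, hl, hlp, hlb⟩ := hpig C.b
      refine absurd (hlong l h0 (hl.subperm.trans hTR) ?_ hlb) (by omega)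
      refine (mul_eq_zero.1 ?_).resolve_left hbs
      rw [← List.sum_map_mul_left, List.map_congr_left fun t ht =>
        show C.b s * f t = f s * C.b t by rw [hcomm s hs t (hl.subset ht), mul_comm],
        List.sum_map_mul_left, hlb, mul_zero]
    · push Not at hb0
      obtain ⟨l, h0, hl, hlp, hlf⟩ := hpig f
      refine absurd (hlong l h0 (hl.subperm.trans hTR) hlf ?_) (by omega)
      rw [List.map_congr_left fun t ht => hb0 t (hl.subset ht)]
      simp
  · push Not at hcomm
    obtain ⟨s, hs, t, ht, hst⟩ := hcomm
    have hts : t ∈ T.erase s := (List.mem_erase_of_ne (by rintro rfl; exact hst rfl)).2 ht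
    have hperm : (s :: t :: (T.erase s).erase t).Perm T :=
      ((List.perm_cons_erase hts).symm.cons s).trans (List.perm_cons_erase hs).symm
    exact C.a_prod_swap_ne hdvd hp0 hsq hu hst _
      ((horder _ hperm).trans (horder _ ((List.Perm.swap s t _).trans hperm)).symm)

end Unipotent

end SplitCoords

theorem mul_eq_zero_of_castHom_eq_zero {n m : ℕ} [NeZero n] (h : m ∣ n) {x : ZMod n}
    (hx : ZMod.castHom h (ZMod m) x = 0) : ((n / m : ℕ) : ZMod n) * x = 0 := by
  rw [← ZMod.natCast_zmod_val x, map_natCast, ZMod.natCast_eq_zero_iff] at hx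
  rw [← ZMod.natCast_zmod_val x, ← Nat.cast_mul, ZMod.natCast_eq_zero_iff]
  conv_lhs => rw [← Nat.div_mul_cancel h]
  exact Nat.mul_dvd_mul_left _ hx

namespace SplitCoords

variable {G : Type*} [Group G] {n p : ℕ} {u : ZMod n} (C : SplitCoords n p u G)

/-- Reduction of the first coordinate modulo a divisor of `n`. -/
def reduce {m : ℕ} (h : m ∣ n) : SplitCoords m p (ZMod.castHom h (ZMod m) u) G where
  a s := ZMod.castHom h (ZMod m) (C.a s)
  b := C.b
  a_mul s t := by rw [C.a_mul, map_add, map_mul, map_pow]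
  b_mul := C.b_mul

theorem hasShort_of_reduce [NeZero n] (hp : p.Prime) (hu : orderOf u = p) {r : ℕ} (hr : r ∣ n)
    (hr0 : (r : ZMod n) * (u - 1) ≠ 0)
    (ih : ∀ m < n, 1 < m → ∀ v : ZMod m, orderOf v = p → ∀ (D : SplitCoords m p v G) (S : List G),
      S.length = m + p - 1 → D.HasShort S m)
    (hr1 : 1 < r) {S : List G} (hS : S.length = n + p - 1) : C.HasShort S n := by
  have : Fact p.Prime := ⟨hp⟩
  obtain ⟨m, hm⟩ := hr
  have hn := NeZero.pos n
  have hm0 : 0 < m := Nat.pos_of_ne_zero fun h => by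
    rw [h, mul_zero] at hm
    omega
  have hmn : m ∣ n := ⟨r, hm.trans (mul_comm _ _)⟩
  have hnm : n / m = r := by rw [hm, Nat.mul_div_cancel _ hm0]
  set v := ZMod.castHom hmn (ZMod m) u with hv
  have hv1 : v ≠ 1 := fun h => hr0 <| by
    rw [← hnm]
    exact mul_eq_zero_of_castHom_eq_zero hmn (by rw [map_sub, map_one, ← hv, h, sub_self])
  have hm1 : 1 < m := by
    by_contra! h
    obtain rfl : m = 1 := by omega
    exact hv1 (Subsingleton.elim _ _)
  have hvp : orderOf v = p :=
    orderOf_eq_prime (by rw [hv, ← map_pow, ← hu, pow_orderOf_eq_one, map_one]) hv1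
  obtain ⟨Ts, R, hTl, hTs, hR⟩ := exists_disjoint_blocks
    (fun T : List G => T ≠ [] ∧ ZMod.castHom hmn (ZMod m) (C.a T.prod) = 0 ∧ C.b T.prod = 0)
    (m + p - 1) m (fun S hS => by
      obtain ⟨l, h0, h1, h2, h3⟩ := ih m (by rw [hm]; nlinarith) hm1 v hvp (C.reduce hmn)
        (S.take (m + p - 1)) (by rw [List.length_take]; omega)
      exact ⟨l, h1.trans (List.take_sublist _ _).subperm, h2, h0, h3⟩) r S (by
      have := hp.two_le
      omega)
  refine (C.hasShort_of_blocks (c := m) hmn Ts (fun T hT => (hTs T hT).2.1)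
    (fun T hT => (hTs T hT).1) (fun T hT => (hTs T hT).2.2.2) (fun T hT => (hTs T hT).2.2.1)
    (by rw [hnm, hTl]) ((List.sublist_append_left _ _).subperm.trans hR.symm.subperm)).mono
    (List.Subperm.refl _) (by rw [hTl, hm])

theorem hasShort (hp : p.Prime) (n : ℕ) (hn : 1 < n) (u : ZMod n) (hu : orderOf u = p)
    (C : SplitCoords n p u G) (S : List G) (hS : S.length = n + p - 1) : C.HasShort S n := by
  induction n using Nat.strong_induction_on generalizing S with
  | _ n ih =>
  have : NeZero n := ⟨by omega⟩
  have hu1 : u ≠ 1 := fun h => by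
    rw [h, orderOf_one] at hu
    exact hp.one_lt.ne hu
  by_cases hred : ∃ r, r.Prime ∧ r ∣ n ∧ (r : ZMod n) * (u - 1) ≠ 0
  · obtain ⟨r, hr, hrn, hr0⟩ := hred
    exact C.hasShort_of_reduce hp hu hrn hr0
      (fun m hmn hm v hv D S hS => ih m hmn hm v hv D S hS) hr.one_lt hS
  push Not at hred
  have hcop : ∀ r s : ℕ, r ≠ s → r.Prime → s.Prime → (r : ZMod n) * (u - 1) = 0 →
      (s : ZMod n) * (u - 1) ≠ 0 := fun r s hrs hr hs h1 h2 =>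
    hu1 (sub_eq_zero.1 (eq_zero_of_coprime_mul ((Nat.coprime_primes hr hs).2 hrs) h1 h2))
  by_cases hsq : ∃ r, r.Prime ∧ r * r ∣ n
  · obtain ⟨r, hr, hrn⟩ := hsq
    have hr0 := hred r hr ((Dvd.intro _ rfl).trans hrn)
    have hp0 : (p : ZMod n) * (u - 1) = 0 := by
      have h := pow_eq_one_add (exists_eq_mul_of_mul_eq_zero hr.pos hrn hr0).1 p
      rw [add_sub_cancel, ← hu, pow_orderOf_eq_one, hu, left_eq_add] at h
      exact h
    obtain rfl : r = p := by
      by_contra hrp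
      exact hcop r p hrp hr hp hr0 hp0
    exact C.hasShort_of_mul_sub_one_eq_zero hp hrn hp0 hu1 hS
  push Not at hsq
  have hprime : n.Prime := by
    have hr := Nat.minFac_prime hn.ne'
    obtain ⟨m, hm⟩ := n.minFac_dvd
    rcases eq_or_ne m 1 with rfl | hm1
    · rw [mul_one] at hm
      rwa [hm]
    have hs := Nat.minFac_prime hm1
    have hsm := m.minFac_dvd
    refine absurd (hred _ hs (hsm.trans (Dvd.intro_left _ hm.symm)))
      (hcop _ _ (fun h => hsq _ hr ?_) hr hs (hred _ hr n.minFac_dvd))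
    conv_rhs => rw [hm]
    exact Nat.mul_dvd_mul_left _ (h ▸ hsm)
  have : Fact n.Prime := ⟨hprime⟩
  exact C.hasShort_of_prime hp hu hS

end SplitCoords

section Metacyclic

variable {G : Type*} [Group G] {p n g : ℕ} {x y : G}

theorem exists_splitCoords (hp : p.Prime) (hn : 1 < n) (hg : orderOf (g : ZMod n) = p)
    (hordx : orderOf x = n) (hordy : orderOf y = p) (hrel : x ^ g * y = y * x)
    (hgen : Subgroup.closure ({x, y} : Set G) = ⊤) :
    ∃ C : SplitCoords n p (g : ZMod n) G, C.b x = 0 ∧ C.b y = 1 ∧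
      ∀ s, C.a s = 0 → C.b s = 0 → s = 1 := by
  have : NeZero n := ⟨by omega⟩
  have : NeZero p := ⟨hp.ne_zero⟩
  have : Fact (1 < n) := ⟨hn⟩
  have : Fact (1 < p) := ⟨hp.one_lt⟩
  have hgp : (g : ZMod n) ^ p = 1 := hg ▸ pow_orderOf_eq_one _
  have hx : ∀ {i j : ℕ}, x ^ i = x ^ j ↔ (i : ZMod n) = j := fun {i j} => by
    rw [pow_eq_pow_iff_modEq, hordx, ZMod.natCast_eq_natCast_iff]
  have hy : ∀ {i j : ℕ}, y ^ i = y ^ j ↔ (i : ZMod p) = j := fun {i j} => by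
    rw [pow_eq_pow_iff_modEq, hordy, ZMod.natCast_eq_natCast_iff]
  have hconj : ∀ j, SemiconjBy (y ^ j) x (x ^ g ^ j) := fun j => by
    induction j with
    | zero => simp [SemiconjBy]
    | succ j ih =>
      have h : SemiconjBy y (x ^ g ^ j) ((x ^ g) ^ g ^ j) :=
        SemiconjBy.pow_right hrel.symm (g ^ j)
      rw [← pow_mul, ← pow_succ'] at h
      rw [pow_succ']
      exact h.mul_left ih
  let E : ZMod n × ZMod p → G := fun c => x ^ c.1.val * y ^ c.2.val
  have hE : ∀ c d : ZMod n × ZMod p,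
      E c * E d = E (c.1 + (g : ZMod n) ^ c.2.val * d.1, c.2 + d.2) := fun c d => by
    have h1 := (hconj c.2.val).pow_right d.1.val
    have h2 : x ^ c.1.val * (x ^ g ^ c.2.val) ^ d.1.val =
        x ^ (c.1 + (g : ZMod n) ^ c.2.val * d.1).val := by
      rw [← pow_mul, ← pow_add, hx]
      simp
    have h3 : y ^ c.2.val * y ^ d.2.val = y ^ (c.2 + d.2).val := by
      rw [← pow_add, hy]
      simp
    simp only [E]
    rw [← h2, ← h3, mul_assoc, ← mul_assoc (y ^ _), h1.eq]
    simp only [mul_assoc]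
  have hE1 : E (0, 0) = 1 := by simp [E]
  have hEx : E (1, 0) = x := by simp [E, ZMod.val_one]
  have hEy : E (0, 1) = y := by simp [E, ZMod.val_one]
  have hinj : Function.Injective E := fun c d h => by
    have hb : ∀ e, E e * x = x ^ g ^ e.2.val * E e := fun e => by
      simp only [E]
      rw [mul_assoc, (hconj e.2.val).eq, ← mul_assoc, ← mul_assoc, ← pow_add, ← pow_add, add_comm]
    have h1 := hb c
    rw [h, hb d, mul_left_inj, hx, Nat.cast_pow, Nat.cast_pow] at h1
    have h2 := SplitCoords.pow_val_injective hg h1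
    simp only [E] at h
    rw [h2, mul_left_inj, hx, ZMod.natCast_zmod_val, ZMod.natCast_zmod_val] at h
    exact Prod.ext h h2.symm
  have hsurj : Function.Surjective E := fun s => by
    have hs : s ∈ Subgroup.closure ({x, y} : Set G) := hgen ▸ Subgroup.mem_top s
    induction hs using Subgroup.closure_induction with
    | mem s hs =>
      rcases hs with rfl | rfl
      exacts [⟨_, hEx⟩, ⟨_, hEy⟩]
    | one => exact ⟨_, hE1⟩
    | mul s t _ _ hs ht =>
      obtain ⟨c, rfl⟩ := hs
      obtain ⟨d, rfl⟩ := ht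
      exact ⟨_, (hE c d).symm⟩
    | inv s _ hs =>
      obtain ⟨c, rfl⟩ := hs
      refine ⟨(-((g : ZMod n) ^ (-c.2).val * c.1), -c.2), eq_inv_of_mul_eq_one_right ?_⟩
      rw [hE, mul_neg, ← mul_assoc, ← SplitCoords.pow_val_add hgp]
      simp [hE1]
  let e := Equiv.ofBijective E ⟨hinj, hsurj⟩
  have he : ∀ c, e.symm (E c) = c := e.symm_apply_apply
  have hmul : ∀ s t, e.symm (s * t) = ((e.symm s).1 + (g : ZMod n) ^ (e.symm s).2.val *
      (e.symm t).1, (e.symm s).2 + (e.symm t).2) := fun s t => by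
    rw [Equiv.symm_apply_eq]
    exact (congrArg₂ (· * ·) (e.apply_symm_apply s) (e.apply_symm_apply t)).symm.trans (hE _ _)
  refine ⟨⟨fun s => (e.symm s).1, fun s => (e.symm s).2, fun s t => by rw [hmul],
    fun s t => by rw [hmul]⟩, ?_, ?_, fun s ha hb => ?_⟩
  · change (e.symm x).2 = 0
    rw [← hEx, he]
  · change (e.symm y).2 = 1
    rw [← hEy, he]
  · rw [← e.apply_symm_apply s, ← hE1]
    exact congrArg E (Prod.ext ha hb)

theorem length_of_isProdOne (hordx : orderOf x = n) {u : ZMod n} (C : SplitCoords n p u G)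
    (hx : C.b x = 0) (hy : C.b y = 1) {i j : ℕ} (hj : j < p) {T : List G} (h0 : T ≠ [])
    (hT : T.Sublist (List.replicate i x ++ List.replicate j y)) (h1 : IsProdOne T) :
    n ≤ T.length ∧ T.length ≤ i := by
  obtain ⟨T₁, T₂, rfl, hT₁, hT₂⟩ := List.sublist_append_iff.1 hT
  obtain ⟨k, hk, rfl⟩ := List.sublist_replicate_iff.1 hT₁
  obtain ⟨m, hm, rfl⟩ := List.sublist_replicate_iff.1 hT₂
  obtain ⟨l, hl, hl1⟩ := h1
  have hb := C.b_prod_perm hl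
  rw [hl1, C.b_one, C.b_prod, List.map_append, List.map_replicate, List.map_replicate, hx, hy,
    List.sum_append, List.sum_replicate, List.sum_replicate, smul_zero, zero_add, nsmul_one,
    eq_comm, ZMod.natCast_eq_zero_iff] at hb
  obtain rfl := Nat.eq_zero_of_dvd_of_lt hb (by omega)
  rw [List.replicate_zero, List.append_nil] at hl h0 ⊢
  rw [List.perm_replicate.1 hl, List.prod_replicate, ← orderOf_dvd_iff_pow_eq_one, hordx] at hl1
  rw [List.length_replicate]
  exact ⟨Nat.le_of_dvd (Nat.pos_of_ne_zero fun h => h0 (by simp [h])) hl1, hk⟩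

end Metacyclic

end ShortProductOne

/-- For any prime `p` and `n > 1`, with `G = Z_p ⋉ Z_n` (where `ord_n(g) = p`),
`d(G) = n + p - 1` and `f(G) = n`. -/
theorem df_general_n (p n g : ℕ) (hp : p.Prime) (hn : 1 < n)
    (hg : orderOf (g : ZMod n) = p)
    (G : Type*) [Group G] [Finite G] (x y : G)
    (hordx : orderOf x = n) (hordy : orderOf y = p)
    (hrel : x ^ g * y = y * x)
    (hgen : Subgroup.closure ({x, y} : Set G) = ⊤) :
    dC G = n + p - 1 ∧ fC G = n := by
  obtain ⟨C, hx, hy, hC⟩ :=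
    ShortProductOne.exists_splitCoords hp hn hg hordx hordy hrel hgen
  have hp1 := hp.one_lt
  have hshort : ∀ S : List G, S.length = n + p - 1 →
      ∃ T : List G, T ≠ [] ∧ T.Sublist S ∧ T.length ≤ n ∧ IsProdOne T := fun S hS => by
    obtain ⟨l, h0, ⟨T, hTl, hTS⟩, hl, ha, hb⟩ := C.hasShort hp n hn _ hg S hS
    exact ⟨T, fun h => h0 (h ▸ hTl).nil_eq.symm, hTS, hTl.length_eq.trans_le hl, l, hTl.symm,
      hC _ ha hb⟩
  have hlong : ∀ {i : ℕ} {T : List G}, T ≠ [] →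
      T.Sublist (List.replicate i x ++ List.replicate (p - 1) y) → IsProdOne T →
      n ≤ T.length ∧ T.length ≤ i := fun h0 hT h1 =>
    ShortProductOne.length_of_isProdOne hordx C hx hy (by omega) h0 hT h1
  have hd : dC G = n + p - 1 := by
    have hmem : n + p - 1 ∈ {m | 0 < m ∧ ∀ S : List G, S.length = m →
        ∃ T : List G, T ≠ [] ∧ T.Sublist S ∧ IsProdOne T} := by
      refine ⟨by omega, fun S hS => ?_⟩
      obtain ⟨T, h0, hT, -, h1⟩ := hshort S hS
      exact ⟨T, h0, hT, h1⟩
    refine le_antisymm (Nat.sInf_le hmem) (le_csInf ⟨_, hmem⟩ fun m hm => ?_)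
    by_contra! hlt
    obtain ⟨T, h0, hT, h1⟩ := hm.2
      ((List.replicate (n - 1) x ++ List.replicate (p - 1) y).take m) (by
        rw [List.length_take, List.length_append, List.length_replicate, List.length_replicate]
        omega)
    have := hlong h0 (hT.trans (List.take_sublist _ _)) h1
    omega
  refine ⟨hd, ?_⟩
  have hmem : n ∈ {m | 0 < m ∧ ∀ S : List G, S.length = dC G →
      ∃ T : List G, T ≠ [] ∧ T.Sublist S ∧ T.length ≤ m ∧ IsProdOne T} :=
    ⟨by omega, fun S hS => hshort S (hS.trans hd)⟩
  refine le_antisymm (Nat.sInf_le hmem) (le_csInf ⟨_, hmem⟩ fun m hm => ?_)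
  obtain ⟨T, h0, hT, hle, h1⟩ := hm.2 (List.replicate n x ++ List.replicate (p - 1) y) (by
    rw [hd, List.length_append, List.length_replicate, List.length_replicate]
    omega)
  exact (hlong h0 hT h1).1.trans hle
end

section
/- Let p be a prime with p > 5 and G = Hol(Z_p) = <x, y | x^p = y^{p-1} = 1, x^g y = y x> with ord_p(g) = p - 1. Then e(G) <= p + (p-3)/2, and consequently f(G) <= p + (p-3)/2. -/
open List Subgroup

theorem Multiset.exists_le_map_eq {A B : Type*} (f : A → B) {s : Multiset A} {t : Multiset B}
    (h : t ≤ s.map f) : ∃ u ≤ s, u.map f = t := by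
  classical
  induction s using Multiset.induction generalizing t with
  | empty => exact ⟨0, le_rfl, by simpa [eq_comm] using h⟩
  | cons a s ih =>
    rw [Multiset.map_cons] at h
    by_cases ha : f a ∈ t
    · obtain ⟨t', rfl⟩ := Multiset.exists_cons_of_mem ha
      obtain ⟨u, hu, rfl⟩ := ih ((Multiset.cons_le_cons_iff _).1 h)
      exact ⟨a ::ₘ u, (Multiset.cons_le_cons_iff _).2 hu, Multiset.map_cons _ _ _⟩
    · obtain ⟨u, hu, rfl⟩ := ih ((Multiset.le_cons_of_notMem ha).1 h)
      exact ⟨u, hu.trans (Multiset.le_cons_self _ _), rfl⟩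

theorem Multiset.exists_coe_eq_and_map_eq {A B : Type*} (f : A → B) {s : Multiset A} {l : List B}
    (h : s.map f = l) : ∃ l' : List A, (l' : Multiset A) = s ∧ l'.map f = l := by
  classical
  induction l generalizing s with
  | nil => exact ⟨[], by simpa [eq_comm] using h, rfl⟩
  | cons b l ih =>
    rw [← Multiset.cons_coe, ← Multiset.map_eq_cons] at h
    obtain ⟨a, ha, hab, hs⟩ := h
    obtain ⟨l', hl', rfl⟩ := ih hs
    exact ⟨a :: l', by rw [← Multiset.cons_coe, hl', Multiset.cons_erase ha], by simp [hab]⟩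

/-- A multiset no value of which occurs more than `card U - q` times contains `q` disjoint
pairs of distinct elements. -/
theorem Multiset.exists_distinct_pairs {A : Type*} [DecidableEq A] (q : ℕ) (U : Multiset A)
    (hq : 2 * q ≤ U.card) (hc : ∀ a, U.count a + q ≤ U.card) :
    ∃ P : Multiset (A × A), P.card = q ∧ (∀ w ∈ P, w.1 ≠ w.2) ∧
      P.map Prod.fst + P.map Prod.snd ≤ U := by
  induction q generalizing U with
  | zero => exact ⟨0, rfl, by simp, by simp⟩
  | succ q ih =>
    have hU : U.toFinset.Nonempty := by
      rw [Multiset.toFinset_nonempty]; rintro rfl; simp at hq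
    obtain ⟨a, ha, hamax⟩ := U.toFinset.exists_max_image (U.count ·) hU
    have hU' : (U.toFinset.erase a).Nonempty := by
      by_contra h
      rw [Finset.not_nonempty_iff_eq_empty] at h
      have : U = Multiset.replicate U.card a := by
        rw [Multiset.eq_replicate_card]
        intro b hb
        by_contra hba
        have : b ∈ U.toFinset.erase a := by simp [hba, hb]
        simp [h] at this
      have h2 := hc a
      rw [this] at h2
      simp at h2
    obtain ⟨b, hb, hbmax⟩ := (U.toFinset.erase a).exists_max_image (U.count ·) hU'
    have hba : b ≠ a := (Finset.mem_erase.1 hb).1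
    rw [Multiset.mem_toFinset] at ha
    have hbU : b ∈ U := by simpa using (Finset.mem_erase.1 hb).2
    obtain ⟨V, rfl⟩ := Multiset.exists_cons_of_mem ha
    have hbV : b ∈ V := by simpa [hba] using hbU
    obtain ⟨V, rfl⟩ := Multiset.exists_cons_of_mem hbV
    simp only [Multiset.card_cons] at hq hc
    obtain ⟨P, hP, hne, hle⟩ := ih V (by omega) (by
      intro c
      have hca := hc a
      have hcb := hc b
      have hcc := hc c
      by_cases h1 : c = a
      · subst h1; simp [hba.symm] at hca ⊢; omega
      by_cases h2 : c = b
      · subst h2; simp [hba] at hcb ⊢; omega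
      by_cases hcV : c ∈ V
      · have h3 := hbmax c (by simp [h1, hcV])
        have h4 := hamax c (by simp [hcV])
        simp [hba, hba.symm, h1, h2] at h3 h4 hcc
        have h5 : V.count a + V.count b + V.count c ≤ V.card := by
          calc V.count a + V.count b + V.count c = ∑ x ∈ {a, b, c}, V.count x := by
                rw [Finset.sum_insert, Finset.sum_insert, Finset.sum_singleton]
                · ring
                · simpa using Ne.symm h2
                · simp [hba.symm, Ne.symm h1]
            _ ≤ ∑ x ∈ V.toFinset ∪ {a, b, c}, V.count x :=
                Finset.sum_le_sum_of_subset Finset.subset_union_right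
            _ = V.card := by
                refine Multiset.sum_count_eq_card ?_
                intro x hx
                simp [hx]
        omega
      · rw [Multiset.count_eq_zero_of_notMem hcV]; omega)
    refine ⟨(a, b) ::ₘ P, by simp [hP], by simpa [hba.symm] using hne, ?_⟩
    simp only [Multiset.map_cons, Multiset.cons_add, Multiset.add_cons]
    rw [Multiset.cons_swap]
    simpa using hle

section SubProducts

variable {A : Type*} [CommGroup A] [DecidableEq A]

/-- The products of the sub-multisets of `U`. -/
def subProds (U : Multiset A) : Finset A := (U.powerset.map Multiset.prod).toFinset

theorem mem_subProds {U : Multiset A} {a : A} : a ∈ subProds U ↔ ∃ V ≤ U, V.prod = a := by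
  simp [subProds]

theorem card_le_card_subProds (U : Multiset A) (h : ∀ V ≤ U, V ≠ 0 → V.prod ≠ 1) :
    1 + U.card ≤ (subProds U).card := by
  induction U using Multiset.induction with
  | empty => simp [subProds]
  | cons a U ih =>
    have ih := ih fun V hV => h V (hV.trans (Multiset.le_cons_self _ _))
    have hsub : insert 1 ((subProds U).image (a * ·)) ⊆ subProds (a ::ₘ U) := by
      intro c hc
      simp only [Finset.mem_insert, Finset.mem_image, mem_subProds] at hc ⊢
      rcases hc with rfl | ⟨_, ⟨V, hV, rfl⟩, rfl⟩
      · exact ⟨0, by simp, by simp⟩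
      · exact ⟨a ::ₘ V, by simpa using hV, by simp⟩
    have h1 : (1 : A) ∉ (subProds U).image (a * ·) := by
      simp only [Finset.mem_image, mem_subProds, not_exists, not_and]
      rintro _ ⟨V, hV, rfl⟩ hc
      exact h (a ::ₘ V) (by simpa using hV) (by simp) (by simpa using hc)
    have := Finset.card_le_card hsub
    rw [Finset.card_insert_of_notMem h1, Finset.card_image_of_injective _ (mul_right_injective a)]
      at this
    simp; omega

theorem card_subProds_cons_cons {U : Multiset A} {a b : A} (hab : a ≠ b)
    (h : ∀ V ≤ a ::ₘ b ::ₘ U, V ≠ 0 → V.prod ≠ 1) :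
    (subProds U).card + 3 ≤ (subProds (a ::ₘ b ::ₘ U)).card := by
  have hsub : insert 1 (insert a (insert b ((subProds U).image (a * b * ·)))) ⊆
      subProds (a ::ₘ b ::ₘ U) := by
    intro c hc
    simp only [Finset.mem_insert, Finset.mem_image, mem_subProds] at hc ⊢
    rcases hc with rfl | rfl | rfl | ⟨_, ⟨V, hV, rfl⟩, rfl⟩
    · exact ⟨0, by simp, by simp⟩
    · exact ⟨{c}, by simp, by simp⟩
    · exact ⟨{c}, by simp, by simp⟩
    · exact ⟨a ::ₘ b ::ₘ V, by simpa using hV, by simp [mul_assoc]⟩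
  have ha : a ≠ 1 := by simpa using h {a} (by simp) (by simp)
  have hb : b ≠ 1 := by simpa using h {b} (by simp) (by simp)
  have h3 : b ∉ (subProds U).image (a * b * ·) := by
    simp only [Finset.mem_image, mem_subProds, not_exists, not_and]
    rintro _ ⟨V, hV, rfl⟩ hc
    refine h (a ::ₘ V) ?_ (by simp) ?_
    · simpa using hV.trans (Multiset.le_cons_self _ _)
    · rw [Multiset.prod_cons]; apply mul_left_cancel (a := b); rw [mul_one, ← mul_assoc,
        mul_comm b a]; exact hc
  have h2 : a ∉ insert b ((subProds U).image (a * b * ·)) := by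
    simp only [Finset.mem_insert, Finset.mem_image, mem_subProds, not_or, not_exists, not_and]
    refine ⟨hab, ?_⟩
    rintro _ ⟨V, hV, rfl⟩ hc
    refine h (b ::ₘ V) ?_ (by simp) ?_
    · exact (by simpa using hV : b ::ₘ V ≤ b ::ₘ U).trans (Multiset.le_cons_self _ _)
    · rw [Multiset.prod_cons]; apply mul_left_cancel (a := a); rw [mul_one, ← mul_assoc]; exact hc
  have h1 : (1 : A) ∉ insert a (insert b ((subProds U).image (a * b * ·))) := by
    simp only [Finset.mem_insert, Finset.mem_image, mem_subProds, not_or, not_exists, not_and]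
    refine ⟨ha.symm, hb.symm, ?_⟩
    rintro _ ⟨V, hV, rfl⟩ hc
    exact h (a ::ₘ b ::ₘ V) (by simpa using hV) (by simp) (by simpa [mul_assoc] using hc)
  have := Finset.card_le_card hsub
  rwa [Finset.card_insert_of_notMem h1, Finset.card_insert_of_notMem h2,
    Finset.card_insert_of_notMem h3, Finset.card_image_of_injective _ (mul_right_injective _)]
    at this

theorem card_le_card_subProds_of_pairs (P : Multiset (A × A)) (R : Multiset A)
    (hP : ∀ w ∈ P, w.1 ≠ w.2)
    (h : ∀ V ≤ P.map Prod.fst + P.map Prod.snd + R,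
      V ≠ 0 → V.prod ≠ 1) :
    1 + 3 * P.card + R.card ≤
      (subProds (P.map Prod.fst + P.map Prod.snd + R)).card := by
  induction P using Multiset.induction with
  | empty => simpa using card_le_card_subProds R (by simpa using h)
  | cons w P ih =>
    simp only [Multiset.map_cons, Multiset.cons_add, Multiset.add_cons] at h ⊢
    rw [Multiset.cons_swap] at h ⊢
    have h1 := card_subProds_cons_cons (hP w (by simp)) h
    have h2 := ih (fun w hw => hP w (by simp [hw])) fun V hV =>
      h V (hV.trans ((Multiset.le_cons_self _ _).trans (Multiset.le_cons_self _ _)))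
    simp only [Multiset.card_cons]
    omega

/-- A long zero-sum free multiset over a finite abelian group has an element of high
multiplicity (Bovey, Erdős, Niven). -/
theorem exists_lt_count_of_prod_ne_one [Fintype A] (U : Multiset A)
    (hU : 2 * Fintype.card A ≤ 3 * U.card) (h : ∀ V ≤ U, V ≠ 0 → V.prod ≠ 1) :
    ∃ a, 2 * U.card < U.count a + Fintype.card A := by
  by_contra! hc
  have hcard := card_le_card_subProds U h
  have hle := Finset.card_le_univ (subProds U)
  obtain ⟨P, hP, hne, hPU⟩ := U.exists_distinct_pairs (Fintype.card A - U.card) (by omega)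
    (fun a => by have := hc a; omega)
  obtain ⟨R, rfl⟩ := Multiset.le_iff_exists_add.1 hPU
  have h1 := card_le_card_subProds_of_pairs P R hne h
  have h2 := Finset.card_le_univ (subProds
    (P.map Prod.fst + P.map Prod.snd + R))
  simp only [Multiset.card_add, Multiset.card_map] at *
  omega

end SubProducts

/-- Over the integers modulo `2 * M`, represented by `1, …, 2 * M`: if at least `M` terms are equal
to `1` and every zero-sum sub-multiset has more than `M` terms, then fewer than `M` terms differ
from `1`. -/
theorem card_lt_of_dvd_sum {M v : ℕ} (hM : 0 < M) (hv : M ≤ v) (L : Multiset ℕ)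
    (hL : ∀ e ∈ L, 2 ≤ e ∧ e ≤ 2 * M)
    (h : ∀ j ≤ v, ∀ V ≤ L, j + V.card ≠ 0 → j + V.sum = 2 * M → M < j + V.card) :
    L.card < M := by
  have two_mul_card_le : ∀ V ≤ L, 2 * V.card ≤ V.sum := by
    intro V hV
    have := V.card_nsmul_le_sum (a := 2) fun e he => (hL e (Multiset.mem_of_le hV he)).1
    simpa [mul_comm] using this
  have le_half : ∀ e ∈ L, e ≤ M := by
    intro e he
    by_contra hlt
    have := h (2 * M - e) (by omega) {e} (by simpa using he) (by simp)
      (by have := (hL e he).2; simp; omega)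
    simp at this
    omega
  have sum_lt : ∀ V ≤ L, V.sum < 2 * M := by
    by_contra! hV
    obtain ⟨V, hV, hmin⟩ := WellFounded.has_min (r := (· < · : Multiset ℕ → _ → Prop))
      wellFounded_lt {V | V ≤ L ∧ 2 * M ≤ V.sum} hV
    obtain ⟨hVL, hVs⟩ := hV
    have hne : V ≠ 0 := by rintro rfl; simp at hVs; omega
    obtain ⟨e, he, hemin⟩ := V.toFinset.exists_min_image id (Multiset.toFinset_nonempty.2 hne)
    rw [Multiset.mem_toFinset] at he
    obtain ⟨V, rfl⟩ := Multiset.exists_cons_of_mem he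
    have hVL' : V ≤ L := (Multiset.le_cons_self _ _).trans hVL
    have hs : V.sum < 2 * M := by
      by_contra! hs
      exact hmin V ⟨hVL', hs⟩ (Multiset.lt_cons_self _ _)
    have he2 := (hL e (Multiset.mem_of_le hVL he)).1
    have heM := le_half e (Multiset.mem_of_le hVL he)
    have hj : V.card * e ≤ V.sum := by
      have := V.card_nsmul_le_sum (a := e) fun c hc => hemin c (by simp [hc])
      simpa using this
    have h2 := two_mul_card_le _ hVL
    rw [Multiset.sum_cons] at hVs
    simp only [Multiset.sum_cons, Multiset.card_cons] at h2
    rcases hVs.eq_or_lt with heq | hlt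
    · have := h 0 (by omega) _ hVL (by simp) (by simp [heq])
      simp at this
      omega
    · have := h (2 * M - V.sum) (by omega) V hVL' (by omega) (by omega)
      obtain ⟨f, rfl⟩ := Nat.exists_eq_add_of_le he2
      obtain ⟨d, rfl⟩ := Nat.exists_eq_add_of_le heM
      obtain ⟨c, hc⟩ : ∃ c, 2 + f + V.sum = 2 * (2 + f + d) + 1 + c :=
        Nat.exists_eq_add_of_le hlt
      have hk : d + 2 + c ≤ V.card := by omega
      have := Nat.mul_le_mul_right (2 + f) hk
      nlinarith
  have h2 := two_mul_card_le L le_rfl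
  have hs := sum_lt L le_rfl
  by_cases hc : L.sum < M
  · omega
  · have := h (2 * M - L.sum) (by omega) L le_rfl (by omega) (by omega)
    omega

section SlotSums

variable {p : ℕ} [Fact p.Prime]

/-- `z` is a sum of products `u * b`, where `u` runs over `S` and the factors `b`
are distinct terms of `B`. -/
def IsSlotSum (S B : Multiset (ZMod p)) (z : ZMod p) : Prop :=
  ∃ W : Multiset (ZMod p × ZMod p), W.map Prod.fst = S ∧ W.map Prod.snd ≤ B ∧
    (W.map fun w => w.1 * w.2).sum = z

theorem IsSlotSum.add {S₁ S₂ B₁ B₂ : Multiset (ZMod p)} {z₁ z₂ : ZMod p}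
    (h₁ : IsSlotSum S₁ B₁ z₁) (h₂ : IsSlotSum S₂ B₂ z₂) :
    IsSlotSum (S₁ + S₂) (B₁ + B₂) (z₁ + z₂) := by
  obtain ⟨W₁, rfl, hB₁, rfl⟩ := h₁
  obtain ⟨W₂, rfl, hB₂, rfl⟩ := h₂
  exact ⟨W₁ + W₂, by simp, by simpa using add_le_add hB₁ hB₂, by simp⟩

theorem IsSlotSum.mono {S B B' : Multiset (ZMod p)} {z : ZMod p}
    (h : IsSlotSum S B z) (hB : B ≤ B') : IsSlotSum S B' z := by
  obtain ⟨W, hS, hW, hz⟩ := h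
  exact ⟨W, hS, hW.trans hB, hz⟩

open scoped Pointwise in
theorem exists_finset_isSlotSum_add {S₁ S₂ B₁ B₂ : Multiset (ZMod p)} {X₁ X₂ : Finset (ZMod p)}
    {m₁ m₂ : ℕ} (hm₁ : 0 < m₁) (hm₂ : 0 < m₂)
    (hc₁ : min p m₁ ≤ X₁.card) (h₁ : ∀ z ∈ X₁, IsSlotSum S₁ B₁ z)
    (hc₂ : min p m₂ ≤ X₂.card) (h₂ : ∀ z ∈ X₂, IsSlotSum S₂ B₂ z) :
    ∃ X : Finset (ZMod p), min p (m₁ + m₂ - 1) ≤ X.card ∧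
      ∀ z ∈ X, IsSlotSum (S₁ + S₂) (B₁ + B₂) z := by
  have hp : p.Prime := Fact.out
  have := hp.pos
  refine ⟨X₁ + X₂, ?_, ?_⟩
  · have := ZMod.cauchy_davenport hp (s := X₁) (t := X₂)
      (Finset.card_pos.1 (by omega)) (Finset.card_pos.1 (by omega))
    omega
  · intro z hz
    obtain ⟨z₁, hz₁, z₂, hz₂, rfl⟩ := Finset.mem_add.1 hz
    exact (h₁ _ hz₁).add (h₂ _ hz₂)

theorem isSlotSum_pair (u a b : ZMod p) : IsSlotSum {u, -u} {a, b} ((a - b) * u) :=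
  ⟨{(u, a), (-u, b)}, by simp, by simp, by simp; ring⟩

theorem isSlotSum_quad (u v a b c d : ZMod p) {B : Multiset (ZMod p)}
    (hB : ({a, b} : Multiset (ZMod p)) + {c, d} = B) {z : ZMod p}
    (hz : (a - b) * u + (c - d) * v = z) :
    IsSlotSum ({u, -u} + {v, -v}) B z := by
  subst hB hz
  exact (isSlotSum_pair u a b).add (isSlotSum_pair v c d)

theorem five_le_card {s t w : ZMod p} (h2 : (2 : ZMod p) ≠ 0) (hs : s ≠ 0) (ht : t ≠ 0)
    (hst : s ^ 2 ≠ t ^ 2) (hws : w ^ 2 ≠ s ^ 2) (hwt : w ^ 2 ≠ t ^ 2) :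
    5 ≤ ({s, -s, t, -t, w} : Finset (ZMod p)).card := by
  have neg_ne : ∀ x : ZMod p, x ≠ 0 → x ≠ -x := by
    intro x hx h
    have : 2 * x = 0 := by linear_combination h
    exact mul_ne_zero h2 hx this
  have ne_of_sq : ∀ {x y : ZMod p}, x ^ 2 ≠ y ^ 2 → x ≠ y ∧ x ≠ -y ∧ -x ≠ y ∧ -x ≠ -y := by
    intro x y h
    refine ⟨?_, ?_, ?_, ?_⟩ <;> intro h' <;> apply h
    · rw [h']
    · rw [h', neg_sq]
    · rw [← h', neg_sq]
    · rw [neg_inj.1 h']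
  obtain ⟨a1, a2, a3, a4⟩ := ne_of_sq hst
  obtain ⟨b1, b2, -, -⟩ := ne_of_sq hws
  obtain ⟨c1, c2, -, -⟩ := ne_of_sq hwt
  rw [Finset.card_insert_of_notMem, Finset.card_insert_of_notMem, Finset.card_insert_of_notMem,
    Finset.card_insert_of_notMem, Finset.card_singleton]
  · simpa using c2.symm
  · simpa using ⟨neg_ne t ht, c1.symm⟩
  · simp only [Finset.mem_insert, Finset.mem_singleton, not_or]
    exact ⟨a3, a4, b2.symm⟩
  · simp only [Finset.mem_insert, Finset.mem_singleton, not_or]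
    exact ⟨neg_ne s hs, a1, a2, b1.symm⟩

theorem exists_five_of_sq_ne {P : ZMod p → Prop} {s t w : ZMod p} (h2 : (2 : ZMod p) ≠ 0)
    (hs : s ≠ 0) (ht : t ≠ 0)
    (hst : s ^ 2 ≠ t ^ 2) (hws : w ^ 2 ≠ s ^ 2) (hwt : w ^ 2 ≠ t ^ 2)
    (h1 : P s) (h1' : P (-s)) (h3 : P t) (h3' : P (-t)) (hw : P w) :
    ∃ X : Finset (ZMod p), 5 ≤ X.card ∧ ∀ z ∈ X, P z := by
  refine ⟨_, five_le_card h2 hs ht hst hws hwt, ?_⟩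
  simp only [Finset.mem_insert, Finset.mem_singleton]
  rintro z (rfl | rfl | rfl | rfl | rfl) <;> assumption

theorem exists_five_isSlotSum_of_sq_ne {u v a b c d : ZMod p} (h2 : (2 : ZMod p) ≠ 0)
    (hu : u ≠ 0) (hv : v ≠ 0) (huv : u ^ 2 ≠ v ^ 2) (hab : a ≠ b) (hcd : c ≠ d)
    (hne : (a - b) ^ 2 ≠ (c - d) ^ 2) :
    ∃ X : Finset (ZMod p), 5 ≤ X.card ∧
      ∀ z ∈ X, IsSlotSum ({u, -u} + {v, -v}) ({a, b} + {c, d}) z := by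
  have he := sub_ne_zero.2 hab
  have hf := sub_ne_zero.2 hcd
  have q1 : IsSlotSum ({u, -u} + {v, -v}) ({a, b} + {c, d}) ((a - b) * u + (c - d) * v) :=
    isSlotSum_quad u v a b c d rfl rfl
  have q2 : IsSlotSum ({u, -u} + {v, -v}) ({a, b} + {c, d}) (-((a - b) * u + (c - d) * v)) :=
    isSlotSum_quad u v b a d c
      (by simp only [Multiset.insert_eq_cons, ← Multiset.singleton_add]; abel) (by ring)
  have q3 : IsSlotSum ({u, -u} + {v, -v}) ({a, b} + {c, d}) ((a - b) * u - (c - d) * v) :=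
    isSlotSum_quad u v a b d c
      (by simp only [Multiset.insert_eq_cons, ← Multiset.singleton_add]; abel) (by ring)
  have q4 : IsSlotSum ({u, -u} + {v, -v}) ({a, b} + {c, d}) (-((a - b) * u - (c - d) * v)) :=
    isSlotSum_quad u v b a c d
      (by simp only [Multiset.insert_eq_cons, ← Multiset.singleton_add]; abel) (by ring)
  have r1 : IsSlotSum ({u, -u} + {v, -v}) ({a, b} + {c, d}) ((a - b) * v + (c - d) * u) :=
    isSlotSum_quad u v c d a b (add_comm _ _) (by ring)
  have r2 : IsSlotSum ({u, -u} + {v, -v}) ({a, b} + {c, d}) (-((a - b) * v + (c - d) * u)) :=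
    isSlotSum_quad u v d c b a
      (by simp only [Multiset.insert_eq_cons, ← Multiset.singleton_add]; abel)
      (by ring)
  have r3 : IsSlotSum ({u, -u} + {v, -v}) ({a, b} + {c, d}) ((a - b) * v - (c - d) * u) :=
    isSlotSum_quad u v d c a b
      (by simp only [Multiset.insert_eq_cons, ← Multiset.singleton_add]; abel) (by ring)
  have r4 : IsSlotSum ({u, -u} + {v, -v}) ({a, b} + {c, d}) (-((a - b) * v - (c - d) * u)) :=
    isSlotSum_quad u v c d b a
      (by simp only [Multiset.insert_eq_cons, ← Multiset.singleton_add]; abel) (by ring)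
  generalize a - b = e at *
  generalize c - d = f at *
  have h4 : (4 : ZMod p) * (e * f * u * v) ≠ 0 := by
    have : (4 : ZMod p) = 2 * 2 := by norm_num
    rw [this]; simp [*]
  have hdq : (e * u + f * v) ^ 2 ≠ (e * u - f * v) ^ 2 := fun h => h4 (by linear_combination h)
  have hdr : (e * v + f * u) ^ 2 ≠ (e * v - f * u) ^ 2 := fun h => h4 (by linear_combination h)
  have hsum : (e * u + f * v) ^ 2 + (e * u - f * v) ^ 2 ≠
      (e * v + f * u) ^ 2 + (e * v - f * u) ^ 2 := fun h =>
    mul_ne_zero h2 (mul_ne_zero (sub_ne_zero.2 hne) (sub_ne_zero.2 huv))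
      (by linear_combination h)
  have huv' : (2 * e * v) ^ 2 ≠ (2 * e * u) ^ 2 := fun h =>
    mul_ne_zero (pow_ne_zero 2 (mul_ne_zero h2 he)) (sub_ne_zero.2 huv)
      (by linear_combination -h)
  have hz : ∀ {x : ZMod p}, x ≠ 0 → (0 : ZMod p) ^ 2 ≠ x ^ 2 := fun hx h =>
    hx (by simpa using h.symm)
  have heu : 2 * e * u ≠ 0 := by simp [*]
  have hev : 2 * e * v ≠ 0 := by simp [*]
  by_cases hs : e * u + f * v = 0 ∨ e * u - f * v = 0
  · have z0 : IsSlotSum ({u, -u} + {v, -v}) ({a, b} + {c, d}) 0 := by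
      rcases hs with hs | hs
      · exact hs ▸ q1
      · exact hs ▸ q3
    by_cases hr : e * v + f * u = 0 ∨ e * v - f * u = 0
    · have hq : IsSlotSum ({u, -u} + {v, -v}) ({a, b} + {c, d}) (2 * e * u) ∧
          IsSlotSum ({u, -u} + {v, -v}) ({a, b} + {c, d}) (-(2 * e * u)) := by
        rcases hs with hs | hs
        · have : 2 * e * u = e * u - f * v := by linear_combination hs
          rw [this]; exact ⟨q3, q4⟩
        · have : 2 * e * u = e * u + f * v := by linear_combination hs
          rw [this]; exact ⟨q1, q2⟩
      have hr : IsSlotSum ({u, -u} + {v, -v}) ({a, b} + {c, d}) (2 * e * v) ∧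
          IsSlotSum ({u, -u} + {v, -v}) ({a, b} + {c, d}) (-(2 * e * v)) := by
        rcases hr with hs | hs
        · have : 2 * e * v = e * v - f * u := by linear_combination hs
          rw [this]; exact ⟨r3, r4⟩
        · have : 2 * e * v = e * v + f * u := by linear_combination hs
          rw [this]; exact ⟨r1, r2⟩
      exact exists_five_of_sq_ne h2 hev heu huv' (hz hev) (hz heu) hr.1 hr.2 hq.1 hq.2 z0
    · push Not at hr
      exact exists_five_of_sq_ne h2 hr.1 hr.2 hdr (hz hr.1) (hz hr.2) r1 r2 r3 r4 z0
  · push Not at hs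
    by_cases hr1 : (e * v + f * u) ^ 2 ≠ (e * u + f * v) ^ 2 ∧
        (e * v + f * u) ^ 2 ≠ (e * u - f * v) ^ 2
    · exact exists_five_of_sq_ne h2 hs.1 hs.2 hdq hr1.1 hr1.2 q1 q2 q3 q4 r1
    by_cases hr3 : (e * v - f * u) ^ 2 ≠ (e * u + f * v) ^ 2 ∧
        (e * v - f * u) ^ 2 ≠ (e * u - f * v) ^ 2
    · exact exists_five_of_sq_ne h2 hs.1 hs.2 hdq hr3.1 hr3.2 q1 q2 q3 q4 r3
    exfalso
    rw [not_and_or, not_not, not_not] at hr1 hr3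
    rcases hr1 with hr1 | hr1 <;> rcases hr3 with hr3 | hr3
    · exact hdr (hr1.trans hr3.symm)
    · exact hsum (by linear_combination -hr1 - hr3)
    · exact hsum (by linear_combination -hr1 - hr3)
    · exact hdr (hr1.trans hr3.symm)

theorem exists_five_isSlotSum_of_arith {u v x e : ZMod p} (h2 : (2 : ZMod p) ≠ 0)
    (h5 : (5 : ZMod p) ≠ 0)
    (hu : u ≠ 0) (hv : v ≠ 0) (huv : u ^ 2 ≠ v ^ 2) (he : e ≠ 0) :
    ∃ X : Finset (ZMod p), 5 ≤ X.card ∧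
      ∀ z ∈ X, IsSlotSum ({u, -u} + {v, -v}) ({x, x} + {x + e, x - e}) z := by
  have q1 : IsSlotSum ({u, -u} + {v, -v}) ({x, x} + {x + e, x - e}) (e * (u + v)) :=
    isSlotSum_quad u v (x + e) x x (x - e)
      (by simp only [Multiset.insert_eq_cons, ← Multiset.singleton_add]; abel) (by ring)
  have q2 : IsSlotSum ({u, -u} + {v, -v}) ({x, x} + {x + e, x - e}) (-(e * (u + v))) :=
    isSlotSum_quad u v x (x + e) (x - e) x
      (by simp only [Multiset.insert_eq_cons, ← Multiset.singleton_add]; abel) (by ring)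
  have q3 : IsSlotSum ({u, -u} + {v, -v}) ({x, x} + {x + e, x - e}) (e * (u - v)) :=
    isSlotSum_quad u v (x + e) x (x - e) x
      (by simp only [Multiset.insert_eq_cons, ← Multiset.singleton_add]; abel) (by ring)
  have q4 : IsSlotSum ({u, -u} + {v, -v}) ({x, x} + {x + e, x - e}) (-(e * (u - v))) :=
    isSlotSum_quad u v x (x + e) x (x - e)
      (by simp only [Multiset.insert_eq_cons, ← Multiset.singleton_add]; abel) (by ring)
  have q5 : IsSlotSum ({u, -u} + {v, -v}) ({x, x} + {x + e, x - e}) (2 * e * u) :=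
    isSlotSum_quad u v (x + e) (x - e) x x
      (by simp only [Multiset.insert_eq_cons, ← Multiset.singleton_add]; abel) (by ring)
  have q6 : IsSlotSum ({u, -u} + {v, -v}) ({x, x} + {x + e, x - e}) (2 * e * v) :=
    isSlotSum_quad u v x x (x + e) (x - e)
      (by simp only [Multiset.insert_eq_cons, ← Multiset.singleton_add]) (by ring)
  have h1 : u + v ≠ 0 := fun h => huv (by linear_combination (u - v) * h)
  have h3 : u - v ≠ 0 := fun h => huv (by linear_combination (u + v) * h)
  have hne : (e * (u + v)) ^ 2 ≠ (e * (u - v)) ^ 2 := fun h => by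
    have : 2 ^ 2 * e ^ 2 * u * v = 0 := by linear_combination h
    simp_all
  by_cases h9 : (v - 3 * u) * (v + 3 * u) = 0
  · have h9' : (u - 3 * v) * (u + 3 * v) ≠ 0 := fun h => by
      have : 2 ^ 4 * 5 * u ^ 2 = 0 := by linear_combination -9 * h9 - h
      simp_all
    refine exists_five_of_sq_ne h2 (mul_ne_zero he h1) (mul_ne_zero he h3) hne ?_ ?_ q1 q2 q3 q4 q6
    · intro h
      have : e ^ 2 * ((u - v) * (u + 3 * v)) = 0 := by linear_combination -h
      simp_all
    · intro h
      have : e ^ 2 * ((u + v) * (u - 3 * v)) = 0 := by linear_combination -h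
      simp_all
  · refine exists_five_of_sq_ne h2 (mul_ne_zero he h1) (mul_ne_zero he h3) hne ?_ ?_ q1 q2 q3 q4 q5
    · intro h
      have : e ^ 2 * ((u - v) * (v + 3 * u)) = 0 := by linear_combination h
      simp_all
    · intro h
      have : e ^ 2 * ((u + v) * (v - 3 * u)) = 0 := by linear_combination -h
      simp_all

theorem exists_five_isSlotSum {u v a b c d : ZMod p} (h2 : (2 : ZMod p) ≠ 0)
    (h5 : (5 : ZMod p) ≠ 0)
    (hu : u ≠ 0) (hv : v ≠ 0) (huv : u ^ 2 ≠ v ^ 2) (hab : a ≠ b) (hcd : c ≠ d) :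
    ∃ X : Finset (ZMod p), 5 ≤ X.card ∧
      ∀ z ∈ X, IsSlotSum ({u, -u} + {v, -v}) ({a, b} + {c, d}) z := by
  by_cases hne : (a - b) ^ 2 ≠ (c - d) ^ 2
  · exact exists_five_isSlotSum_of_sq_ne h2 hu hv huv hab hcd hne
  rw [not_not] at hne
  wlog h : a - b = c - d generalizing c d
  · rw [Multiset.pair_comm c d]
    refine this hcd.symm (by rw [hne]; ring) ?_
    rcases sq_eq_sq_iff_eq_or_eq_neg.1 hne with h' | h'
    · exact absurd h' h
    · rw [h']; ring
  obtain ⟨e, rfl⟩ : ∃ e, b = a - e := ⟨a - b, by ring⟩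
  obtain rfl : d = c - e := by linear_combination h
  have he : e ≠ 0 := by rintro rfl; simp at hab
  by_cases hac : a = c
  · subst hac
    have h1 : u + v ≠ 0 := fun h => huv (by linear_combination (u - v) * h)
    have h3 : u - v ≠ 0 := fun h => huv (by linear_combination (u + v) * h)
    refine exists_five_of_sq_ne h2 (s := e * (u + v)) (t := e * (u - v)) (w := 0)
      (mul_ne_zero he h1) (mul_ne_zero he h3) ?_ ?_ ?_
      (isSlotSum_quad u v a (a - e) a (a - e) rfl (by ring))
      (isSlotSum_quad u v (a - e) a (a - e) a
        (by simp only [Multiset.insert_eq_cons, ← Multiset.singleton_add]; abel) (by ring))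
      (isSlotSum_quad u v a (a - e) (a - e) a
        (by simp only [Multiset.insert_eq_cons, ← Multiset.singleton_add]; abel) (by ring))
      (isSlotSum_quad u v (a - e) a a (a - e)
        (by simp only [Multiset.insert_eq_cons, ← Multiset.singleton_add]; abel) (by ring))
      (isSlotSum_quad u v a a (a - e) (a - e)
        (by simp only [Multiset.insert_eq_cons, ← Multiset.singleton_add]; abel) (by ring))
    · intro h
      have : 2 ^ 2 * e ^ 2 * u * v = 0 := by linear_combination h
      simp_all
    · exact fun h => pow_ne_zero 2 (mul_ne_zero he h1) (by linear_combination -h)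
    · exact fun h => pow_ne_zero 2 (mul_ne_zero he h3) (by linear_combination -h)
  by_cases hc1 : c = a + e
  · subst hc1
    obtain ⟨X, hX, h⟩ := exists_five_isSlotSum_of_arith h2 h5 hu hv huv he (x := a)
    refine ⟨X, hX, fun z hz => ?_⟩
    convert h z hz using 1
    simp only [add_sub_cancel_right, Multiset.insert_eq_cons, ← Multiset.singleton_add]; abel
  by_cases hc2 : c = a - e
  · subst hc2
    obtain ⟨X, hX, h⟩ := exists_five_isSlotSum_of_arith h2 h5 hu hv huv he (x := a - e)
    refine ⟨X, hX, fun z hz => ?_⟩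
    convert h z hz using 1
    simp only [sub_add_cancel, Multiset.insert_eq_cons, ← Multiset.singleton_add]; abel
  obtain ⟨X, hX, h⟩ := exists_five_isSlotSum_of_sq_ne h2 hu hv huv (a := a) (b := c - e)
    (c := a - e) (d := c) (fun h => hc1 (by linear_combination -h)) (Ne.symm hc2) (by
      intro h
      have : 2 ^ 2 * e * (a - c) = 0 := by linear_combination h
      simp_all [sub_eq_zero])
  refine ⟨X, hX, fun z hz => ?_⟩
  convert h z hz using 1
  simp only [Multiset.insert_eq_cons, ← Multiset.singleton_add]; abel

theorem exists_three_isSlotSum {u a b c d : ZMod p} (h2 : (2 : ZMod p) ≠ 0) (hu : u ≠ 0)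
    (hab : a ≠ b) (hcd : c ≠ d) :
    ∃ X : Finset (ZMod p), 3 ≤ X.card ∧ ∀ z ∈ X, IsSlotSum {u, -u} ({a, b} + {c, d}) z := by
  suffices h : ∃ z, z ≠ (a - b) * u ∧ z ≠ (b - a) * u ∧
      IsSlotSum {u, -u} ({a, b} + {c, d}) z by
    obtain ⟨z, h1, h3, hz⟩ := h
    have hne : (a - b) * u ≠ (b - a) * u := fun h => by
      have : 2 * ((a - b) * u) = 0 := by linear_combination h
      exact mul_ne_zero h2 (mul_ne_zero (sub_ne_zero.2 hab) hu) this
    refine ⟨{z, (a - b) * u, (b - a) * u}, ?_, ?_⟩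
    · rw [Finset.card_eq_three.2 ⟨_, _, _, h1, h3, hne, rfl⟩]
    · simp only [Finset.mem_insert, Finset.mem_singleton]
      rintro y (rfl | rfl | rfl)
      · exact hz
      · exact (isSlotSum_pair u a b).mono (Multiset.le_add_right _ _)
      · exact (isSlotSum_pair u b a).mono (by
          rw [Multiset.pair_comm]; exact Multiset.le_add_right _ _)
  have hac : ({a, c} : Multiset (ZMod p)) ≤ {a, b} + {c, d} := by
    have : ({a, b} + {c, d} : Multiset (ZMod p)) = {a, c} + {b, d} := by
      simp only [Multiset.insert_eq_cons, ← Multiset.singleton_add]; abel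
    rw [this]; exact Multiset.le_add_right _ _
  have had : ({a, d} : Multiset (ZMod p)) ≤ {a, b} + {c, d} := by
    have : ({a, b} + {c, d} : Multiset (ZMod p)) = {a, d} + {b, c} := by
      simp only [Multiset.insert_eq_cons, ← Multiset.singleton_add]; abel
    rw [this]; exact Multiset.le_add_right _ _
  have hbc : ({b, c} : Multiset (ZMod p)) ≤ {a, b} + {c, d} := by
    have : ({a, b} + {c, d} : Multiset (ZMod p)) = {b, c} + {a, d} := by
      simp only [Multiset.insert_eq_cons, ← Multiset.singleton_add]; abel
    rw [this]; exact Multiset.le_add_right _ _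
  have hbd : ({b, d} : Multiset (ZMod p)) ≤ {a, b} + {c, d} := by
    have : ({a, b} + {c, d} : Multiset (ZMod p)) = {b, d} + {a, c} := by
      simp only [Multiset.insert_eq_cons, ← Multiset.singleton_add]; abel
    rw [this]; exact Multiset.le_add_right _ _
  by_cases hc1 : b = c
  · refine ⟨(b - c) * u, ?_, ?_, (isSlotSum_pair u b c).mono hbc⟩
    · simpa [hc1, hu, sub_eq_zero, eq_comm] using hab
    · simpa [hc1, hu, sub_eq_zero, eq_comm] using hab
  by_cases hd1 : b = d
  · refine ⟨(b - d) * u, ?_, ?_, (isSlotSum_pair u b d).mono hbd⟩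
    · simpa [hd1, hu, sub_eq_zero, eq_comm] using hab
    · simpa [hd1, hu, sub_eq_zero, eq_comm] using hab
  by_cases hc2 : a - c = b - a
  · refine ⟨(a - d) * u, ?_, ?_, (isSlotSum_pair u a d).mono had⟩
    · intro h
      exact hd1 (by linear_combination mul_right_cancel₀ hu h)
    · intro h
      exact hcd (by linear_combination mul_right_cancel₀ hu h - hc2)
  · refine ⟨(a - c) * u, ?_, ?_, (isSlotSum_pair u a c).mono hac⟩
    · intro h
      exact hc1 (by linear_combination mul_right_cancel₀ hu h)
    · intro h
      exact hc2 (mul_right_cancel₀ hu h)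

/-- A list of representatives of nonzero residues modulo sign. -/
def IsHalfSystem (us : List (ZMod p)) : Prop :=
  (∀ u ∈ us, u ≠ 0) ∧ us.Pairwise fun u v => u ^ 2 ≠ v ^ 2

theorem exists_finset_isSlotSum_of_pairs (h2 : (2 : ZMod p) ≠ 0) (h5 : (5 : ZMod p) ≠ 0) (m : ℕ)
    (us : List (ZMod p)) (hus : IsHalfSystem us) (hlen : us.length = 2 * m)
    (P : Multiset (ZMod p × ZMod p)) (hP : P.card = 2 * m) (hne : ∀ w ∈ P, w.1 ≠ w.2) :
    ∃ X : Finset (ZMod p), min p (1 + 4 * m) ≤ X.card ∧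
      ∀ z ∈ X, IsSlotSum (us + us.map Neg.neg : Multiset (ZMod p))
        (P.map Prod.fst + P.map Prod.snd) z := by
  induction m generalizing us P with
  | zero =>
    refine ⟨{0}, by simp, ?_⟩
    obtain rfl : us = [] := by simpa using hlen
    obtain rfl : P = 0 := by simpa using hP
    simp only [Finset.mem_singleton, forall_eq]
    exact ⟨0, by simp, by simp, by simp⟩
  | succ m ih =>
    obtain ⟨u, us, rfl⟩ := List.exists_cons_of_length_eq_add_one (n := 2 * m + 1) (by omega)
    obtain ⟨v, us, rfl⟩ := List.exists_cons_of_length_eq_add_one (l := us) (n := 2 * m)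
      (by simp at hlen; omega)
    obtain ⟨w, P, rfl, hP1⟩ := Multiset.card_eq_succ_iff.1 (show P.card = 2 * m + 1 + 1 by omega)
    obtain ⟨w', P, rfl, hP2⟩ := Multiset.card_eq_succ_iff.1 hP1
    obtain ⟨hne1, hne2, hne⟩ : w.1 ≠ w.2 ∧ w'.1 ≠ w'.2 ∧ ∀ w ∈ P, w.1 ≠ w.2 := by
      simpa only [Multiset.forall_mem_cons] using hne
    obtain ⟨hus0, hus⟩ := hus
    simp only [List.mem_cons, forall_eq_or_imp, List.pairwise_cons] at hus0 hus
    obtain ⟨hu, hv, hus0⟩ := hus0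
    obtain ⟨⟨huv, -⟩, -, hus⟩ := hus
    obtain ⟨X, hX, hXs⟩ := ih us ⟨hus0, hus⟩ (by simp at hlen; omega) P hP2 hne
    obtain ⟨Y, hY, hYs⟩ := exists_five_isSlotSum h2 h5 hu hv huv hne1 hne2
    obtain ⟨Z, hZ, hZs⟩ := exists_finset_isSlotSum_add (m₁ := 5) (by norm_num) (by omega)
      ((min_le_right _ _).trans hY) hYs hX hXs
    refine ⟨Z, le_trans (by gcongr; omega) hZ, fun z hz => ?_⟩
    convert hZs z hz using 1
    · simp only [List.map_cons, ← Multiset.cons_coe, Multiset.insert_eq_cons,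
        ← Multiset.singleton_add]
      abel
    · rw [Multiset.map_cons, Multiset.map_cons, Multiset.map_cons, Multiset.map_cons]
      simp only [Multiset.insert_eq_cons, ← Multiset.singleton_add]
      abel

theorem isSlotSum_replicate (A : Multiset (ZMod p)) (a : ZMod p) :
    IsSlotSum A (Multiset.replicate A.card a) (a * A.sum) :=
  ⟨A.map fun u => (u, a), by simp, by simp, by
    simp [Multiset.map_map, Multiset.sum_map_mul_right, mul_comm a]⟩

theorem exists_isSlotSum_of_card_eq {A B : Multiset (ZMod p)} (h : A.card = B.card) :
    ∃ z, IsSlotSum A B z := by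
  induction A using Quotient.inductionOn with | _ l
  induction B using Quotient.inductionOn with | _ l'
  have h : l.length = l'.length := h
  refine ⟨_, (l.zip l' : List _), ?_, ?_, rfl⟩
  · simp [List.map_fst_zip, h]
  · simp [List.map_snd_zip, h]

theorem Finset.exists_ne_mul_add_mul_eq {A : Finset (ZMod p)} {M : ℕ} (hp : p = 2 * M + 1)
    (hA : M + 2 ≤ A.card) {b c : ZMod p} (hb : b ≠ 0) (hc : c ≠ 0) (hbc : b + c ≠ 0)
    (C : ZMod p) : ∃ u ∈ A, ∃ v ∈ A, u ≠ v ∧ b * u + c * v = C := by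
  classical
  have hinj : Function.Injective fun u : ZMod p => (C - b * u) / c := fun u v h => by
    have : C - b * u = C - b * v := by simpa [hc, div_left_inj'] using h
    exact mul_left_cancel₀ hb (sub_right_injective this)
  have h1 := Finset.card_union_add_card_inter A (A.image fun u => (C - b * u) / c)
  rw [Finset.card_image_of_injective _ hinj] at h1
  have h2 := (A ∪ A.image fun u => (C - b * u) / c).card_le_univ
  rw [ZMod.card] at h2
  obtain ⟨v, hv, hne⟩ := Finset.exists_mem_ne
    (s := A ∩ A.image fun u => (C - b * u) / c) (by omega) (C / (b + c))
  obtain ⟨hvA, hv⟩ := Finset.mem_inter.1 hv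
  obtain ⟨u, hu, rfl⟩ := Finset.mem_image.1 hv
  refine ⟨u, hu, _, hvA, fun huv => hne ?_, by field_simp; ring⟩
  rw [← huv, eq_div_iff hbc]
  rw [eq_div_iff hc] at huv
  linear_combination huv

theorem Multiset.exists_cons_cons_add_ne {a : ZMod p} (h2 : (2 : ZMod p) ≠ 0)
    {R : Multiset (ZMod p)} (hR : 3 ≤ R.card) (ha : a ∉ R) :
    ∃ x y R', R = x ::ₘ y ::ₘ R' ∧ (x - a) + (y - a) ≠ 0 := by
  obtain ⟨n, hn⟩ := Nat.exists_eq_add_of_le' hR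
  obtain ⟨x, R, rfl, hR1⟩ := Multiset.card_eq_succ_iff.1 hn
  obtain ⟨y, R, rfl, hR2⟩ := Multiset.card_eq_succ_iff.1 hR1
  obtain ⟨z, R, rfl, hR3⟩ := Multiset.card_eq_succ_iff.1 hR2
  by_cases hxy : (x - a) + (y - a) = 0
  · by_cases hxz : (x - a) + (z - a) = 0
    · refine ⟨y, z, x ::ₘ R, ?_, fun hyz => ?_⟩
      · rw [Multiset.cons_swap x, Multiset.cons_swap x]
      · have : 2 * (x - a) = 0 := by linear_combination hxy + hxz - hyz
        simp_all [sub_eq_zero]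
    · exact ⟨x, z, y ::ₘ R, by rw [Multiset.cons_swap y], hxz⟩
  · exact ⟨x, y, z ::ₘ R, rfl, hxy⟩

theorem isSlotSum_zero_of_count {M : ℕ} (hp : p = 2 * M + 1) (h2 : (2 : ZMod p) ≠ 0)
    {S : Finset (ZMod p)} (hS : S.card = 2 * M) (hS0 : S.val.sum = 0)
    {B : Multiset (ZMod p)} (hB : B.card = 2 * M + 2) {a : ZMod p} (ha : M + 2 ≤ B.count a) :
    IsSlotSum S.val B 0 := by
  classical
  obtain ⟨R, haR, hBR⟩ : ∃ R, a ∉ R ∧ B = Multiset.replicate (B.count a) a + R :=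
    ⟨B.filter (¬ a = ·), by simp, by
      rw [← Multiset.filter_eq, Multiset.filter_add_not]⟩
  have hcard := congrArg Multiset.card hBR
  rw [Multiset.card_add, Multiset.card_replicate] at hcard
  generalize B.count a = k at *
  subst hBR
  rcases le_or_gt (2 * M) k with hk | hk
  · have h := isSlotSum_replicate S.val a
    rw [hS0, mul_zero, Finset.card_val, hS] at h
    exact h.mono (((Multiset.replicate_le_replicate a).2 hk).trans (Multiset.le_add_right _ _))
  obtain ⟨x, y, R, rfl, hxy⟩ := Multiset.exists_cons_cons_add_ne h2 (by omega) haR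
  simp only [Multiset.mem_cons, not_or, Multiset.card_cons] at haR hcard
  obtain ⟨S₁, hS₁, hc₁⟩ := Finset.exists_subset_card_eq (s := S) (n := R.card) (by omega)
  have hA : (S \ S₁).card + S₁.card = S.card := Finset.card_sdiff_add_card_eq_card hS₁
  obtain ⟨z, hz⟩ := exists_isSlotSum_of_card_eq (A := S₁.val) (B := R) (by simpa using hc₁)
  obtain ⟨u, hu, v, hv, huv, hC⟩ := Finset.exists_ne_mul_add_mul_eq hp (A := S \ S₁) (by omega)
    (sub_ne_zero.2 (Ne.symm haR.1)) (sub_ne_zero.2 (Ne.symm haR.2.1)) hxy (a * S₁.val.sum - z)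
  set A := ((S \ S₁).erase u).erase v with hAdef
  have hv' : v ∈ (S \ S₁).erase u := Finset.mem_erase.2 ⟨huv.symm, hv⟩
  have hAv : u ::ₘ v ::ₘ A.val = (S \ S₁).val := by
    rw [Finset.erase_val, Multiset.cons_erase hv', Finset.erase_val, Multiset.cons_erase hu]
  have hSv : S₁.val + (S \ S₁).val = S.val := by
    rw [Finset.sdiff_val, add_tsub_cancel_of_le (Finset.val_le_iff.2 hS₁)]
  have huvs : IsSlotSum {u, v} {x, y} (u * x + v * y) :=
    ⟨{(u, x), (v, y)}, by simp, by simp, by simp⟩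
  have key := (hz.add huvs).add (isSlotSum_replicate A.val a)
  rw [← hSv, ← hAv] at hS0 ⊢
  have hAc := congrArg Multiset.card hAv
  simp only [Multiset.card_cons, Finset.card_val] at hAc
  simp only [Multiset.sum_add, Multiset.sum_cons] at hS0
  convert key.mono (B' := Multiset.replicate k a + x ::ₘ y ::ₘ R) ?_ using 1
  · simp only [Multiset.insert_eq_cons, ← Multiset.singleton_add]; abel
  · linear_combination -a * hS0 - hC
  · have : (Multiset.replicate A.val.card a) ≤ Multiset.replicate k a :=
      (Multiset.replicate_le_replicate a).2 (by rw [Finset.card_val]; omega)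
    refine le_trans (add_le_add_right this _) (le_of_eq ?_)
    simp only [Multiset.insert_eq_cons, ← Multiset.singleton_add]; abel

theorem isSlotSum_zero_of_isHalfSystem {M : ℕ} (hp : p = 2 * M + 1) (hM : 3 ≤ M)
    {us : List (ZMod p)} (hus : IsHalfSystem us) (hlen : us.length = M)
    {B : Multiset (ZMod p)} (hB : B.card = 2 * M + 2) :
    IsSlotSum (us + us.map Neg.neg : Multiset (ZMod p)) B 0 := by
  classical
  have hne : ∀ n : ℕ, 0 < n → n < p → (n : ZMod p) ≠ 0 := fun n h0 hn h =>
    absurd (Nat.le_of_dvd h0 ((ZMod.natCast_eq_zero_iff n p).1 h)) (by omega)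
  have h2 : (2 : ZMod p) ≠ 0 := by simpa using hne 2 (by omega) (by omega)
  have h5 : (5 : ZMod p) ≠ 0 := by simpa using hne 5 (by omega) (by omega)
  by_cases hcount : ∃ a, M + 2 ≤ B.count a
  · obtain ⟨a, ha⟩ := hcount
    have hnd : (us + us.map Neg.neg : Multiset (ZMod p)).Nodup := by
      rw [Multiset.coe_add, Multiset.coe_nodup, List.nodup_append]
      have hnd : us.Nodup := hus.2.imp fun h e => h (by rw [e])
      refine ⟨hnd, hnd.map neg_injective, fun x hx y hy hxy => ?_⟩
      obtain ⟨y, hy', rfl⟩ := List.mem_map.1 hy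
      by_cases h : x = y
      · subst h
        have : 2 * x = 0 := by linear_combination hxy
        exact mul_ne_zero h2 (hus.1 x hx) this
      · have : Std.Symm fun u v : ZMod p => u ^ 2 ≠ v ^ 2 := ⟨fun _ _ h => Ne.symm h⟩
        exact hus.2.forall hx hy' h (by rw [hxy, neg_sq])
    refine isSlotSum_zero_of_count hp h2 (S := ⟨_, hnd⟩) ?_ ?_ hB ha
    · simp [hlen]; omega
    · rw [Multiset.sum_add, Multiset.sum_coe, Multiset.sum_coe, ← List.sum_neg, add_neg_cancel]
  push Not at hcount
  obtain ⟨P, hP, hPne, hPB⟩ := Multiset.exists_distinct_pairs (M + 1) B (by omega)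
    fun a => by have := hcount a; omega
  suffices h : ∃ X : Finset (ZMod p), p ≤ X.card ∧
      ∀ z ∈ X, IsSlotSum (us + us.map Neg.neg : Multiset (ZMod p))
        (P.map Prod.fst + P.map Prod.snd) z by
    obtain ⟨X, hX, h⟩ := h
    have : X = Finset.univ := Finset.eq_univ_of_card _ (by
      have := X.card_le_univ
      rw [ZMod.card] at *
      omega)
    exact (h 0 (this ▸ Finset.mem_univ 0)).mono hPB
  rcases Nat.even_or_odd' M with ⟨m, hm | hm⟩
  · obtain ⟨w, P, rfl, hP⟩ := Multiset.card_eq_succ_iff.1 hP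
    obtain ⟨X, hX, h⟩ := exists_finset_isSlotSum_of_pairs h2 h5 m us hus (by omega) P
      (by omega) (fun w hw => hPne w (Multiset.mem_cons_of_mem hw))
    refine ⟨X, by omega, fun z hz => (h z hz).mono ?_⟩
    simp only [Multiset.map_cons]
    exact add_le_add (Multiset.le_cons_self _ _) (Multiset.le_cons_self _ _)
  · obtain ⟨w, P, rfl, hP1⟩ := Multiset.card_eq_succ_iff.1 hP
    obtain ⟨w', P, rfl, hP2⟩ := Multiset.card_eq_succ_iff.1 (hP1.trans hm)
    obtain ⟨hne1, hne2, hPne⟩ : w.1 ≠ w.2 ∧ w'.1 ≠ w'.2 ∧ ∀ w ∈ P, w.1 ≠ w.2 := by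
      simpa only [Multiset.forall_mem_cons] using hPne
    obtain ⟨u, us, rfl⟩ := List.exists_cons_of_length_eq_add_one (hlen.trans hm)
    obtain ⟨hus0, hus⟩ := hus
    simp only [List.mem_cons, forall_eq_or_imp, List.pairwise_cons] at hus0 hus
    obtain ⟨X, hX, hXs⟩ := exists_finset_isSlotSum_of_pairs h2 h5 m us ⟨hus0.2, hus.2⟩
      (by simp at hlen; omega) P hP2 hPne
    obtain ⟨Y, hY, hYs⟩ := exists_three_isSlotSum h2 hus0.1 hne1 hne2
    obtain ⟨Z, hZ, hZs⟩ := exists_finset_isSlotSum_add (m₁ := 3) (by norm_num) (by omega)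
      ((min_le_right _ _).trans hY) hYs hX hXs
    refine ⟨Z, by omega, fun z hz => ?_⟩
    convert hZs z hz using 1
    · simp only [List.map_cons, ← Multiset.cons_coe, Multiset.insert_eq_cons,
        ← Multiset.singleton_add]
      abel
    · rw [Multiset.map_cons, Multiset.map_cons, Multiset.map_cons, Multiset.map_cons]
      simp only [Multiset.insert_eq_cons, ← Multiset.singleton_add]
      abel

end SlotSums

section AffineAction

variable {p : ℕ} [Fact p.Prime] {G : Type*} [Group G]

/-- `W` is nonempty and its linear parts multiply to one. -/
def IsKernelMultiset (α : G →* (ZMod p)ˣ) (W : Multiset G) : Prop :=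
  W ≠ 0 ∧ (W.map α).prod = 1

/-- `z` is the translation part of a product of the terms of `I` in some order. -/
def IsOrderedSum (β : G → ZMod p) (I : Multiset G) (z : ZMod p) : Prop :=
  ∃ l : List G, (l : Multiset G) = I ∧ β l.prod = z

variable {α : G →* (ZMod p)ˣ} {β : G → ZMod p}

theorem map_coe_prod (α : G →* (ZMod p)ˣ) (l : List G) :
    ((l : Multiset G).map α).prod = α l.prod := by
  rw [Multiset.map_coe, Multiset.prod_coe, map_list_prod]

theorem IsOrderedSum.add (hβ : ∀ g h, β (g * h) = β g + α g * β h) {I J : Multiset G}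
    {z w : ZMod p} (hI : IsOrderedSum β I z) (hα : (I.map α).prod = 1)
    (hJ : IsOrderedSum β J w) : IsOrderedSum β (I + J) (z + w) := by
  obtain ⟨l, rfl, rfl⟩ := hI
  obtain ⟨l', rfl, rfl⟩ := hJ
  refine ⟨l ++ l', by simp, ?_⟩
  rw [map_coe_prod] at hα
  rw [List.prod_append, hβ, hα, Units.val_one, one_mul]

theorem injOn_prod_drop {l : List G}
    (h : Minimal (IsKernelMultiset α) (l : Multiset G)) :
    Set.InjOn (fun k => α (l.drop k).prod) (Finset.range l.length) := by
  intro i hi j hj hij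
  wlog hlt : i < j generalizing i j
  · rcases eq_or_lt_of_le (not_lt.1 hlt) with h' | h'
    · exact h'.symm
    · exact (this hj hi hij.symm h').symm
  exfalso
  simp only [Finset.coe_range, Set.mem_Iio] at hi hj
  have hd : l.drop i = (l.drop i).take (j - i) ++ l.drop j := by
    conv_lhs => rw [← List.take_append_drop (j - i) (l.drop i), List.drop_drop]
    congr 2; omega
  have hlen : ((l.drop i).take (j - i)).length = j - i := by simp; omega
  generalize (l.drop i).take (j - i) = s at *
  have hs : s.Sublist l := by
    have h1 : s.Sublist (l.drop i) := by rw [hd]; exact List.sublist_append_left _ _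
    exact h1.trans (List.drop_sublist _ _)
  simp only [hd, List.prod_append, map_mul, mul_eq_right] at hij
  have hle := h.2 (y := (s : Multiset G)) ⟨by
    rw [Ne, Multiset.coe_eq_zero, ← List.length_eq_zero_iff]; omega,
    by rw [map_coe_prod, hij]⟩ (Multiset.coe_le.2 hs.subperm)
  have := Multiset.card_le_card hle
  simp only [Multiset.coe_card] at this
  omega

theorem card_le_of_minimal {W : Multiset G} (h : Minimal (IsKernelMultiset α) W) :
    W.card ≤ p - 1 := by
  induction W using Quotient.inductionOn with | _ l
  have := Finset.card_le_card_of_injOn _ (t := Finset.univ) (fun _ _ => Finset.mem_univ _)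
    (injOn_prod_drop h)
  rwa [Finset.card_range, Finset.card_univ, ZMod.card_units] at this

theorem exists_finset_isOrderedSum_of_minimal (hβ : ∀ g h, β (g * h) = β g + α g * β h)
    {W : Multiset G} (h : Minimal (IsKernelMultiset α) W) (h0 : ¬ IsOrderedSum β W 0) :
    ∃ Y : Finset (ZMod p), W.card ≤ Y.card ∧ ∀ z ∈ Y, IsOrderedSum β W z := by
  induction W using Quotient.inductionOn with | _ l
  have hc : β l.prod ≠ 0 := fun hc => h0 ⟨l, rfl, hc⟩
  refine ⟨(Finset.range l.length).image fun k => (α (l.drop k).prod : ZMod p) * β l.prod, ?_, ?_⟩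
  · rw [Finset.card_image_of_injOn, Finset.card_range]
    · exact le_rfl
    · intro i hi j hj hij
      exact injOn_prod_drop h hi hj (Units.ext (mul_right_cancel₀ hc hij))
  · intro z hz
    obtain ⟨k, -, rfl⟩ := Finset.mem_image.1 hz
    refine ⟨l.drop k ++ l.take k, Multiset.coe_eq_coe.2 ?_, ?_⟩
    · exact List.perm_append_comm.trans (by rw [List.take_append_drop])
    · have h1 : α (l.take k).prod * α (l.drop k).prod = 1 := by
        rw [← map_mul, List.prod_take_mul_prod_drop, ← map_coe_prod]; exact h.1.2
      have h2 : (α (l.take k).prod : ZMod p) * α (l.drop k).prod = 1 := by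
        rw [← Units.val_mul, h1, Units.val_one]
      have h3 : β l.prod = β (l.take k).prod + α (l.take k).prod * β (l.drop k).prod := by
        rw [← hβ, List.prod_take_mul_prod_drop]
      rw [List.prod_append, hβ, h3]
      linear_combination -β (l.drop k).prod * h2

open scoped Pointwise in
theorem exists_finset_isOrderedSum (hβ : ∀ g h, β (g * h) = β g + α g * β h)
    (J : Multiset G) (hJ : (J.map α).prod = 1)
    (h0 : ∀ I ≤ J, IsKernelMultiset α I → ¬ IsOrderedSum β I 0) :
    ∃ X : Finset (ZMod p), min p J.card ≤ X.card ∧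
      ∀ z ∈ X, ∃ I ≤ J, IsKernelMultiset α I ∧ IsOrderedSum β I z := by
  classical
  induction J using Multiset.strongInductionOn with | _ J ih
  rcases eq_or_ne J 0 with rfl | hne
  · exact ⟨∅, by simp, by simp⟩
  obtain ⟨W, hWJ, hW⟩ := exists_minimal_le_of_wellFoundedLT (IsKernelMultiset α) J ⟨hne, hJ⟩
  obtain ⟨K, rfl⟩ := Multiset.le_iff_exists_add.1 hWJ
  have hK : (K.map α).prod = 1 := by simpa [hW.1.2] using hJ
  have hWpos : 0 < W.card := Multiset.card_pos.2 hW.1.1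
  have hKW : K < W + K := lt_of_le_of_ne (Multiset.le_add_left _ _) fun h => by
    have := congrArg Multiset.card h
    rw [Multiset.card_add] at this
    omega
  obtain ⟨X, hX, hXs⟩ := ih K hKW hK fun I hI => h0 I (hI.trans hKW.le)
  obtain ⟨Y, hY, hYs⟩ := exists_finset_isOrderedSum_of_minimal hβ hW (h0 W hWJ hW.1)
  have hX0 : (0 : ZMod p) ∉ X := fun h => by
    obtain ⟨I, hI, hIk, hIs⟩ := hXs 0 h
    exact h0 I (hI.trans hKW.le) hIk hIs
  refine ⟨Y + insert 0 X, ?_, ?_⟩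
  · have := ZMod.cauchy_davenport (Fact.out : p.Prime) (s := Y) (t := insert 0 X)
      (Finset.card_pos.1 (by omega)) (Finset.insert_nonempty _ _)
    rw [Finset.card_insert_of_notMem hX0] at this
    rw [Multiset.card_add]
    omega
  · intro z hz
    obtain ⟨y, hy, x, hx, rfl⟩ := Finset.mem_add.1 hz
    rcases Finset.mem_insert.1 hx with rfl | hx
    · exact ⟨W, hWJ, hW.1, by simpa using hYs y hy⟩
    · obtain ⟨I, hI, hIk, hIs⟩ := hXs x hx
      refine ⟨W + I, add_le_add_right hI W, ⟨?_, ?_⟩, (hYs y hy).add hβ hW.1.2 hIs⟩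
      · intro h
        simp [hW.1.1] at h
      · simp [hW.1.2, hIk.2]

theorem card_lt_of_forall_not_isOrderedSum (hβ : ∀ g h, β (g * h) = β g + α g * β h)
    {J : Multiset G} (hJ : (J.map α).prod = 1)
    (h0 : ∀ I ≤ J, IsKernelMultiset α I → ¬ IsOrderedSum β I 0) : J.card < p := by
  by_contra! hp
  obtain ⟨X, hX, hXs⟩ := exists_finset_isOrderedSum hβ J hJ h0
  have : X = Finset.univ := Finset.eq_univ_of_card _ (by
    have := X.card_le_univ
    rw [ZMod.card] at *
    omega)
  obtain ⟨I, hI, hIk, hIs⟩ := hXs 0 (this ▸ Finset.mem_univ 0)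
  exact h0 I hI hIk hIs

theorem IsKernelMultiset.of_add {W K : Multiset G} (hW : (W.map α).prod = 1) (hK : K ≠ 0)
    (h : ((W + K).map α).prod = 1) : IsKernelMultiset α K :=
  ⟨hK, by simpa [hW] using h⟩

theorem IsKernelMultiset.add {W K : Multiset G} (hW : IsKernelMultiset α W)
    (hK : IsKernelMultiset α K) : IsKernelMultiset α (W + K) :=
  ⟨fun h => hW.1 (add_eq_zero.1 h).1, by simp [hW.2, hK.2]⟩

theorem Multiset.lt_of_le_of_card_lt {A : Type*} {s t : Multiset A} (h : s ≤ t)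
    (hc : s.card < t.card) : s < t :=
  lt_of_le_of_ne h fun h => by simp [h] at hc

theorem exists_minimal_two_mul_card {M : ℕ} (hp : p = 2 * M + 1) {T : Multiset G}
    (hT : IsKernelMultiset α T) (hcard : 3 * M + 1 ≤ T.card)
    (hlt : ∀ I < T, IsKernelMultiset α I → I.card ≤ 2 * M) (hM : 0 < M) :
    ∃ W ≤ T, Minimal (IsKernelMultiset α) W ∧ T.card ≤ 2 * W.card := by
  have hpos : ∀ {K : Multiset G}, IsKernelMultiset α K → 0 < K.card :=
    fun hK => Multiset.card_pos.2 hK.1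
  obtain ⟨W, hWT, hW⟩ := exists_minimal_le_of_wellFoundedLT (IsKernelMultiset α) T hT
  have hWc := card_le_of_minimal hW
  obtain ⟨K, rfl⟩ := Multiset.le_iff_exists_add.1 hWT
  rw [Multiset.card_add] at hcard
  have hK : IsKernelMultiset α K := .of_add hW.1.2 (by rintro rfl; simp at hcard; omega) hT.2
  rcases le_or_gt K.card W.card with hKW | hKW
  · exact ⟨W, hWT, hW, by rw [Multiset.card_add]; omega⟩
  obtain ⟨W₁, hWK, hW₁⟩ := exists_minimal_le_of_wellFoundedLT (IsKernelMultiset α) K hK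
  obtain ⟨K₁, rfl⟩ := Multiset.le_iff_exists_add.1 hWK
  rcases eq_or_ne K₁ 0 with rfl | hK₁
  · rw [add_zero] at hKW ⊢
    exact ⟨W₁, Multiset.le_add_left _ _, hW₁, by rw [Multiset.card_add]; omega⟩
  have hK₁ : IsKernelMultiset α K₁ := .of_add hW₁.1.2 hK₁ hK.2
  have := hpos hK₁
  have := hpos hW₁.1
  have := hpos hW.1
  have h1 := hlt (W + W₁) (Multiset.lt_of_le_of_card_lt
    (add_le_add_right (Multiset.le_add_right _ _) _) (by simp only [Multiset.card_add]; omega))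
    (hW.1.add hW₁.1)
  have h2 := hlt (W + K₁) (Multiset.lt_of_le_of_card_lt
    (add_le_add_right (Multiset.le_add_left _ _) _) (by simp only [Multiset.card_add]; omega))
    (hW.1.add hK₁)
  have h3 := hlt (W₁ + K₁) (Multiset.lt_of_le_of_card_lt (Multiset.le_add_left _ _)
    (by simp only [Multiset.card_add]; omega)) hK
  simp only [Multiset.card_add] at *
  omega

theorem exists_orderOf_eq_and_count {M : ℕ} (hp : p = 2 * M + 1) (hM : 3 ≤ M) {W : Multiset G}
    (hW : Minimal (IsKernelMultiset α) W) (hcard : 3 * M + 1 ≤ 2 * W.card) :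
    ∃ h : (ZMod p)ˣ, orderOf h = 2 * M ∧ M ≤ (W.map α).count h := by
  obtain ⟨w, U, rfl, hU⟩ := Multiset.card_eq_succ_iff.1
    (show W.card = W.card - 1 + 1 by omega)
  have hfree : ∀ V ≤ U.map α, V ≠ 0 → V.prod ≠ 1 := by
    intro V hV hV0 hV1
    obtain ⟨I, hI, rfl⟩ := Multiset.exists_le_map_eq α hV
    have := Multiset.card_le_card (hW.2 ⟨fun h => hV0 (by simp [h]), hV1⟩
      (hI.trans (Multiset.le_cons_self _ _)))
    have := Multiset.card_le_card hI
    rw [Multiset.card_cons] at *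
    omega
  have hc : Fintype.card (ZMod p)ˣ = 2 * M := by rw [ZMod.card_units]; omega
  rw [Multiset.card_cons] at hcard
  obtain ⟨h, hh⟩ := exists_lt_count_of_prod_ne_one (U.map α)
    (by rw [hc, Multiset.card_map]; omega) hfree
  rw [hc, Multiset.card_map] at hh
  refine ⟨h, ?_, ?_⟩
  · have hlt : M < orderOf h := by
      by_contra! hle
      refine hfree (Multiset.replicate (orderOf h) h) ?_ ?_ ?_
      · exact Multiset.le_count_iff_replicate_le.1 (show orderOf h ≤ (U.map α).count h by omega)
      · intro h0
        have h1 := congrArg Multiset.card h0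
        rw [Multiset.card_replicate, Multiset.card_zero] at h1
        exact (orderOf_pos h).ne' h1
      · rw [Multiset.prod_replicate, pow_orderOf_eq_one]
    obtain ⟨c, hc'⟩ := hc ▸ orderOf_dvd_card (x := h)
    have : c = 1 := by nlinarith
    rw [hc', this, mul_one]
  · rw [Multiset.map_cons]
    exact le_trans (by omega) (Multiset.count_le_count_cons _ _ _)

theorem exists_pow_eq_of_orderOf {A : Type*} [Group A] [Fintype A] {h : A}
    (hh : orderOf h = Fintype.card A) (a : A) : ∃ e, 1 ≤ e ∧ e ≤ Fintype.card A ∧ h ^ e = a := by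
  classical
  have hinj := Finset.card_image_of_injOn (s := Finset.Icc 1 (Fintype.card A))
    (f := fun e => h ^ e) fun i hi j hj hij => by
      simp only [Finset.coe_Icc, Set.mem_Icc] at hi hj
      rw [pow_eq_pow_iff_modEq, hh] at hij
      have hmod : i - 1 ≡ j - 1 [MOD Fintype.card A] := by
        refine Nat.ModEq.add_right_cancel' 1 ?_
        rwa [Nat.sub_add_cancel hi.1, Nat.sub_add_cancel hj.1]
      have := hmod.eq_of_lt_of_lt (by omega) (by omega)
      omega
  have := Finset.eq_univ_of_card _ (hinj.trans (by simp))
  obtain ⟨e, he, rfl⟩ := Finset.mem_image.1 (this ▸ Finset.mem_univ a)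
  exact ⟨e, (Finset.mem_Icc.1 he).1, (Finset.mem_Icc.1 he).2, rfl⟩

theorem card_lt_count_add {M : ℕ} (hp : p = 2 * M + 1) (hM : 0 < M) {T : Multiset G}
    (hT : IsKernelMultiset α T) (hcard : 3 * M + 1 ≤ T.card)
    (hlt : ∀ I < T, IsKernelMultiset α I → I.card ≤ 2 * M)
    {h : (ZMod p)ˣ} (hh : orderOf h = 2 * M) (hv : M ≤ (T.map α).count h) :
    T.card < (T.map α).count h + M := by
  have hc : Fintype.card (ZMod p)ˣ = 2 * M := by rw [ZMod.card_units]; omega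
  choose e he1 he2 he using exists_pow_eq_of_orderOf (hh.trans hc.symm)
  rw [hc] at he2
  obtain ⟨F, hhF, hF⟩ : ∃ F, h ∉ F ∧ T.map α = Multiset.replicate ((T.map α).count h) h + F :=
    ⟨(T.map α).filter (¬ h = ·), by simp, by
      rw [← Multiset.filter_eq, Multiset.filter_add_not]⟩
  have hcF := congrArg Multiset.card hF
  rw [Multiset.card_add, Multiset.card_replicate, Multiset.card_map] at hcF
  have key := card_lt_of_dvd_sum hM hv (F.map e) ?_ ?_
  · rw [Multiset.card_map] at key
    omega
  · intro k hk
    obtain ⟨a, ha, rfl⟩ := Multiset.mem_map.1 hk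
    refine ⟨?_, he2 a⟩
    rcases eq_or_ne (e a) 1 with h1 | h1
    · refine absurd ?_ hhF
      rwa [← pow_one h, ← h1, he]
    · have := he1 a
      omega
  · intro j hj V hV h0 hsum
    obtain ⟨V, hVF, rfl⟩ := Multiset.exists_le_map_eq e hV
    have hle : Multiset.replicate j h + V ≤ T.map α := by
      rw [hF]
      exact add_le_add ((Multiset.replicate_le_replicate h).2 hj) hVF
    obtain ⟨I, hI, hIV⟩ := Multiset.exists_le_map_eq α hle
    have hIc : I.card = j + V.card := by
      rw [← Multiset.card_map α I, hIV, Multiset.card_add, Multiset.card_replicate]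
    have hprod : (I.map α).prod = 1 := by
      have : V.prod = h ^ (V.map e).sum := by
        clear * - he
        induction V using Multiset.induction_on with
        | empty => simp
        | cons a V ih => simp [pow_add, he, ih]
      rw [hIV, Multiset.prod_add, Multiset.prod_replicate, this, ← pow_add, hsum, ← hh,
        pow_orderOf_eq_one]
    have hVsum : V.card ≤ (V.map e).sum := by
      have := Multiset.card_nsmul_le_sum (s := V.map e) (a := 1) (by simp [he1])
      simpa using this
    rw [Multiset.card_map] at h0 ⊢
    obtain ⟨K, rfl⟩ := Multiset.le_iff_exists_add.1 hI
    rw [Multiset.card_add] at hcard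
    have hK : IsKernelMultiset α K :=
      .of_add hprod (by rintro rfl; simp at hcard; omega) hT.2
    have := hlt K (Multiset.lt_of_le_of_card_lt (Multiset.le_add_left _ _)
      (by rw [Multiset.card_add]; omega)) hK
    omega

theorem sum_zipWith_pow_mul (hβ : ∀ g h, β (g * h) = β g + α g * β h) {h : (ZMod p)ˣ}
    (l : List G) (hl : ∀ g ∈ l, α g = h) (c : ZMod p) :
    (List.zipWith (· * ·) ((List.range l.length).map fun i => c * (h : ZMod p) ^ i)
      (l.map β)).sum = c * β l.prod := by
  induction l generalizing c with
  | nil =>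
    have : β 1 = 0 := by simpa using hβ 1 1
    simp [this]
  | cons g l ih =>
    obtain ⟨rfl, hl⟩ := List.forall_mem_cons.1 hl
    have := ih hl (c * α g)
    simp only [List.length_cons, List.range_succ_eq_map, List.map_cons, List.map_map,
      List.zipWith_cons_cons, List.sum_cons, List.prod_cons, hβ, pow_zero, mul_one, mul_add,
      ← mul_assoc, ← this]
    congr 4
    funext i
    simp [pow_succ', mul_assoc]

theorem coe_range_map_pow {M : ℕ} {h : (ZMod p)ˣ} (hM : 0 < M) (hh : orderOf h = 2 * M) :
    (((List.range M).map fun i => (h : ZMod p) ^ i) +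
      ((List.range M).map fun i => (h : ZMod p) ^ i).map Neg.neg : Multiset (ZMod p)) =
      ((List.range (2 * M)).map fun i => (h : ZMod p) ^ i : List (ZMod p)) := by
  have hneg : (h : ZMod p) ^ M = -1 := by
    have h1 : (h : ZMod p) ^ M * (h : ZMod p) ^ M = 1 := by
      rw [← pow_add, ← two_mul, ← hh, ← Units.val_pow_eq_pow_val, pow_orderOf_eq_one,
        Units.val_one]
    refine (mul_self_eq_one_iff.1 h1).resolve_left fun h2 => ?_
    have := Nat.le_of_dvd hM (orderOf_dvd_of_pow_eq_one (x := h) (n := M) (Units.ext (by simpa)))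
    omega
  rw [two_mul, List.range_add, List.map_append, Multiset.coe_add, List.map_map, List.map_map]
  congr 3
  funext i
  simp [pow_add, hneg]

theorem isHalfSystem_pow {M : ℕ} {h : (ZMod p)ˣ} (hh : orderOf h = 2 * M) :
    IsHalfSystem ((List.range M).map fun i => (h : ZMod p) ^ i) := by
  refine ⟨by simp, ?_⟩
  rw [List.pairwise_map]
  refine List.pairwise_lt_range.imp_of_mem fun {i j} hi hj hij heq => ?_
  rw [List.mem_range] at hi hj
  rw [← pow_mul, ← pow_mul] at heq
  have := pow_injOn_Iio_orderOf (x := h) (show i * 2 ∈ Set.Iio _ by simp [hh]; omega)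
    (show j * 2 ∈ Set.Iio _ by simp [hh]; omega) (Units.ext (by simpa using heq))
  omega

theorem exists_isOrderedSum_zero_of_map_eq_replicate
    (hβ : ∀ g h, β (g * h) = β g + α g * β h) {M : ℕ} (hp : p = 2 * M + 1) (hM : 3 ≤ M)
    {h : (ZMod p)ˣ} (hh : orderOf h = 2 * M) {B : Multiset G}
    (hB : B.map α = Multiset.replicate (2 * M + 2) h) :
    ∃ I ≤ B, I.card = 2 * M ∧ IsKernelMultiset α I ∧ IsOrderedSum β I 0 := by
  have hBc : B.card = 2 * M + 2 := by rw [← Multiset.card_map α, hB, Multiset.card_replicate]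
  obtain ⟨W, hWS, hWB, hW0⟩ := isSlotSum_zero_of_isHalfSystem hp hM (isHalfSystem_pow hh)
    (by simp) (B := B.map β) (by simpa using hBc)
  rw [coe_range_map_pow (by omega) hh] at hWS
  obtain ⟨w, rfl, hw⟩ := Multiset.exists_coe_eq_and_map_eq Prod.fst hWS
  obtain ⟨I, hI, hIw⟩ := Multiset.exists_le_map_eq β hWB
  rw [Multiset.map_coe] at hIw
  obtain ⟨l, rfl, hl⟩ := Multiset.exists_coe_eq_and_map_eq β hIw
  have hlen : l.length = 2 * M := by
    have h1 := congrArg List.length hw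
    have h2 := congrArg List.length hl
    simp at h1 h2
    omega
  have hα : ∀ g ∈ l, α g = h := fun g hg =>
    Multiset.eq_of_mem_replicate (n := 2 * M + 2) (hB ▸ Multiset.mem_map_of_mem α
      (Multiset.mem_of_le hI (Multiset.mem_coe.2 hg)))
  refine ⟨_, hI, by simpa using hlen, ⟨?_, ?_⟩, l, rfl, ?_⟩
  · rw [Ne, Multiset.coe_eq_zero, ← List.length_eq_zero_iff]
    omega
  · rw [Multiset.map_coe, Multiset.prod_coe, List.prod_eq_pow_card _ h (by simpa using hα),
      List.length_map, hlen, ← hh, pow_orderOf_eq_one]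
  · have := sum_zipWith_pow_mul hβ l hα 1
    simp only [one_mul] at this
    rw [← this, ← hW0, hlen, ← hw, hl, List.zipWith_map, List.zipWith_self]
    simp

theorem card_le_of_forall_lt_not_isOrderedSum (hβ : ∀ g h, β (g * h) = β g + α g * β h) {M : ℕ}
    (hp : p = 2 * M + 1) (hM : 3 ≤ M) {T : Multiset G} (hT : IsKernelMultiset α T)
    (h0 : ∀ I < T, IsKernelMultiset α I → ¬ IsOrderedSum β I 0) : T.card ≤ 3 * M := by
  by_contra! hcard
  have hlt : ∀ I < T, IsKernelMultiset α I → I.card ≤ 2 * M := fun I hI hIk => by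
    have := card_lt_of_forall_not_isOrderedSum hβ hIk.2 fun J hJ => h0 J (hJ.trans_lt hI)
    omega
  obtain ⟨W, hWT, hW, hWc⟩ := exists_minimal_two_mul_card hp hT hcard hlt (by omega)
  obtain ⟨h, hh, hv⟩ := exists_orderOf_eq_and_count hp hM hW (by omega)
  have hcount := card_lt_count_add hp (by omega) hT hcard hlt hh
    (hv.trans (Multiset.count_le_of_le _ (Multiset.map_le_map hWT)))
  obtain ⟨B, hBT, hB⟩ := Multiset.exists_le_map_eq α
    (Multiset.le_count_iff_replicate_le.1 (show 2 * M + 2 ≤ (T.map α).count h by omega))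
  obtain ⟨I, hI, hIc, hIk, hIs⟩ :=
    exists_isOrderedSum_zero_of_map_eq_replicate hβ hp hM hh hB
  exact h0 I (Multiset.lt_of_le_of_card_lt (hI.trans hBT) (by omega)) hIk hIs

end AffineAction

theorem exists_isProdOne_of_length_eq_card {G : Type*} [Group G] [Finite G] (S : List G)
    (hS : S.length = Nat.card G) : ∃ T : List G, T ≠ [] ∧ T.Sublist S ∧ IsProdOne T := by
  classical
  have := Fintype.ofFinite G
  obtain ⟨i, hi, j, hj, hij, h⟩ := Finset.exists_ne_map_eq_of_card_lt_of_maps_to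
    (s := Finset.range (S.length + 1)) (t := Finset.univ) (f := fun i => (S.take i).prod)
    (by simp [hS]) (fun _ _ => Finset.mem_univ _)
  wlog hlt : i < j generalizing i j
  · exact this j hj i hi hij.symm h.symm (by omega)
  have hd := List.take_append_drop i (S.take j)
  rw [List.take_take, min_eq_left hlt.le] at hd
  refine ⟨(S.take j).drop i, ?_, (List.drop_sublist _ _).trans (List.take_sublist _ _),
    _, List.Perm.refl _, ?_⟩
  · rw [Finset.mem_range] at hj
    rw [Ne, ← List.length_eq_zero_iff, List.length_drop, List.length_take]
    omega
  · have := congrArg List.prod hd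
    rw [List.prod_append] at this
    exact mul_eq_left.1 (this.trans h.symm)

section Coordinates

variable {p : ℕ} {G : Type*} [Group G] {x y : G} {g : ℕ}

theorem pow_mul_pow_of_rel (hrel : x ^ g * y = y * x) (i j : ℕ) :
    y ^ j * x ^ i = x ^ (i * g ^ j) * y ^ j := by
  have h1 : ∀ i, y * x ^ i = x ^ (i * g) * y := fun i => by
    have h : SemiconjBy y x (x ^ g) := hrel.symm
    rw [mul_comm, pow_mul]
    exact h.pow_right i
  induction j generalizing i with
  | zero => simp
  | succ j ih =>
    rw [pow_succ, mul_assoc, h1, ← mul_assoc, ih, mul_assoc, pow_succ, mul_assoc i, mul_comm g]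

theorem exists_pow_mul_pow_of_rel [Finite G] (hrel : x ^ g * y = y * x)
    (hgen : Subgroup.closure ({x, y} : Set G) = ⊤) (z : G) : ∃ i j : ℕ, x ^ i * y ^ j = z := by
  have hz : z ∈ Submonoid.closure ({x, y} : Set G) := by
    rw [← Subgroup.closure_toSubmonoid_of_finite, hgen]
    trivial
  induction hz using Submonoid.closure_induction with
  | mem z hz =>
    rcases hz with rfl | rfl
    · exact ⟨1, 0, by simp⟩
    · exact ⟨0, 1, by simp⟩
  | one => exact ⟨0, 0, by simp⟩
  | mul z w _ _ hz hw =>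
    obtain ⟨i, j, rfl⟩ := hz
    obtain ⟨i', j', rfl⟩ := hw
    refine ⟨i + i' * g ^ j, j + j', ?_⟩
    rw [mul_assoc, ← mul_assoc (y ^ j), pow_mul_pow_of_rel hrel, pow_add, pow_add]
    simp only [mul_assoc]

theorem eq_of_pow_mul_pow_eq [Fact p.Prime] (hx : orderOf x = p)
    (hy : orderOf y = p - 1) (hrel : x ^ g * y = y * x) {u : (ZMod p)ˣ} (hu : (u : ZMod p) = g)
    (hou : orderOf u = p - 1) {i j i' j' : ℕ}
    (h : x ^ i * y ^ j = x ^ i' * y ^ j') : (i : ZMod p) = i' ∧ u ^ j = u ^ j' := by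
  have hpow : ∀ i i' : ℕ, x ^ i = x ^ i' ↔ (i : ZMod p) = i' := fun i i' => by
    rw [pow_eq_pow_iff_modEq, hx, ZMod.natCast_eq_natCast_iff]
  have hconj : ∀ i j, x ^ i * y ^ j * x = x ^ (g ^ j) * (x ^ i * y ^ j) := fun i j => by
    have := pow_mul_pow_of_rel hrel 1 j
    rw [pow_one, one_mul] at this
    rw [mul_assoc, this, ← mul_assoc, ← mul_assoc, pow_mul_comm]
  have hj : u ^ j = u ^ j' := by
    have h1 := hconj i j
    rw [h, hconj i' j', mul_left_inj, hpow] at h1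
    refine Units.ext ?_
    push_cast at h1
    rw [Units.val_pow_eq_pow_val, Units.val_pow_eq_pow_val, hu, h1]
  refine ⟨?_, hj⟩
  have hyj : y ^ j = y ^ j' := by
    rw [pow_eq_pow_iff_modEq, hy, ← hou, ← pow_eq_pow_iff_modEq, hj]
  rwa [hyj, mul_left_inj, hpow] at h

theorem exists_affine_coordinates [Fact p.Prime] [Finite G] (hg : orderOf (g : ZMod p) = p - 1)
    (hp : 1 < p - 1)
    (hx : orderOf x = p) (hy : orderOf y = p - 1) (hrel : x ^ g * y = y * x)
    (hgen : Subgroup.closure ({x, y} : Set G) = ⊤) :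
    ∃ (α : G →* (ZMod p)ˣ) (β : G → ZMod p), (∀ z w, β (z * w) = β z + α z * β w) ∧
      ∀ z, α z = 1 → β z = 0 → z = 1 := by
  have hg0 : (g : ZMod p) ≠ 0 := fun h => by
    rw [h, orderOf_zero] at hg
    omega
  obtain ⟨u, hu⟩ : ∃ u : (ZMod p)ˣ, (u : ZMod p) = g := ⟨Units.mk0 _ hg0, rfl⟩
  have hou : orderOf u = p - 1 := by rw [← orderOf_units, hu, hg]
  choose i j hij using exists_pow_mul_pow_of_rel hrel hgen
  have hmul : ∀ z w, (i (z * w) : ZMod p) = (i z + i w * g ^ j z : ℕ) ∧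
      u ^ j (z * w) = u ^ (j z + j w) := fun z w => by
    refine eq_of_pow_mul_pow_eq hx hy hrel hu hou ?_
    rw [hij]
    conv_lhs => rw [← hij z, ← hij w]
    rw [mul_assoc, ← mul_assoc (y ^ j z), pow_mul_pow_of_rel hrel, pow_add, pow_add]
    simp only [mul_assoc]
  refine ⟨MonoidHom.mk' (fun z => u ^ j z) fun z w => by rw [(hmul z w).2, pow_add],
    fun z => i z, fun z w => ?_, fun z hα hβ => ?_⟩
  · change (i (z * w) : ZMod p) = i z + (u ^ j z : (ZMod p)ˣ) * i w
    rw [(hmul z w).1]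
    simp [hu, mul_comm]
  · have h1 : y ^ j z = 1 := by
      rw [← orderOf_dvd_iff_pow_eq_one, hy, ← hou]
      exact orderOf_dvd_of_pow_eq_one hα
    have h2 : x ^ i z = 1 := by
      rw [← orderOf_dvd_iff_pow_eq_one, hx]
      exact (ZMod.natCast_eq_zero_iff _ _).1 hβ
    rw [← hij z, h1, h2, one_mul]

end Coordinates

theorem exists_isProdOne_length_le {p : ℕ} [Fact p.Prime] {G : Type*} [Group G]
    {α : G →* (ZMod p)ˣ} {β : G → ZMod p} (hβ : ∀ z w, β (z * w) = β z + α z * β w)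
    (hker : ∀ z, α z = 1 → β z = 0 → z = 1) {M : ℕ} (hp : p = 2 * M + 1) (hM : 3 ≤ M)
    {S : List G} (hS : S ≠ []) (hS1 : IsProdOne S) :
    ∃ T : List G, T ≠ [] ∧ T.Sublist S ∧ T.length ≤ 3 * M ∧ IsProdOne T := by
  obtain ⟨l, hl, hl1⟩ := hS1
  have hα1 : ((S : Multiset G).map α).prod = 1 := by
    rw [← Multiset.coe_eq_coe.2 hl, map_coe_prod, hl1, map_one]
  have hβ1 : β 1 = 0 := by simpa using hβ 1 1
  obtain ⟨T, hTS, hT⟩ := exists_minimal_le_of_wellFoundedLT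
    (fun I => IsKernelMultiset α I ∧ IsOrderedSum β I 0) (S : Multiset G)
    ⟨⟨by simpa using hS, hα1⟩, l, Multiset.coe_eq_coe.2 hl, by rw [hl1, hβ1]⟩
  have hcard := card_le_of_forall_lt_not_isOrderedSum hβ hp hM hT.1.1
    fun I hI hIk hIs => hT.not_prop_of_lt hI ⟨hIk, hIs⟩
  obtain ⟨⟨hT0, hTα⟩, t, rfl, ht⟩ := hT.1
  rw [map_coe_prod] at hTα
  obtain ⟨T, hTt, hTS⟩ := Multiset.coe_le.1 hTS
  refine ⟨T, ?_, hTS, by rw [hTt.length_eq]; exact hcard, t, hTt.symm, hker _ hTα ht⟩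
  rintro rfl
  exact hT0 (by simpa using hTt)

/-- For a prime `p > 5` and `G = Hol(Z_p)`, `e(G) ≤ p + (p-3)/2` and hence
`f(G) ≤ p + (p-3)/2`. -/
theorem hol_upper_bound (p g : ℕ) (hp : p.Prime) (hp5 : 5 < p)
    (hg : orderOf (g : ZMod p) = p - 1)
    (G : Type*) [Group G] [Finite G] (x y : G)
    (hordx : orderOf x = p) (hordy : orderOf y = p - 1)
    (hrel : x ^ g * y = y * x)
    (hgen : Subgroup.closure ({x, y} : Set G) = ⊤) :
    eC G ≤ p + (p - 3) / 2 ∧ fC G ≤ p + (p - 3) / 2 := by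
  have : Fact p.Prime := ⟨hp⟩
  obtain ⟨M, hM⟩ := hp.odd_of_ne_two (by omega)
  obtain ⟨α, β, hβ, hker⟩ := exists_affine_coordinates hg (by omega) hordx hordy hrel hgen
  have hbound : p + (p - 3) / 2 = 3 * M := by omega
  rw [hbound]
  refine ⟨Nat.sInf_le ⟨by omega, fun S hS hS1 =>
    exists_isProdOne_length_le hβ hker hM (by omega) hS hS1⟩,
    Nat.sInf_le ⟨by omega, fun S hS => ?_⟩⟩
  have hd := Nat.sInf_mem (s := {m | 0 < m ∧ ∀ S : List G, S.length = m →
    ∃ T : List G, T ≠ [] ∧ T.Sublist S ∧ IsProdOne T})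
    ⟨Nat.card G, Nat.card_pos, exists_isProdOne_of_length_eq_card⟩
  obtain ⟨T, hT0, hTS, hT1⟩ := hd.2 S hS
  obtain ⟨V, hV0, hVT, hVc, hV1⟩ :=
    exists_isProdOne_length_le hβ hker hM (by omega) hT0 hT1
  exact ⟨V, hV0, hVT.trans hTS, hVc, hV1⟩
end

section
/- For every prime p > 5, e(Hol(Z_p)) >= p + 1. Moreover, e(Hol(Z_5)) = 6. -/
open List Subgroup

/-- A product-one sublist of `cs.map f` comes from a subpermutation of `cs`. -/
theorem exists_subperm_of_isProdOne {ι G : Type*} [Group G] {f : ι → G} {cs : List ι} {T : List G}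
    (hT : T.Sublist (cs.map f)) (h : IsProdOne T) :
    ∃ d : List ι, d.Subperm cs ∧ d.length = T.length ∧ (d.map f).prod = 1 := by
  obtain ⟨l, hl, hprod⟩ := h
  obtain ⟨d, hd, rfl⟩ := List.sublist_map_iff.1 hT
  have hcomp : Relation.Comp (· ~ ·) (fun (l : List G) (d : List ι) => l = d.map f) l d :=
    ⟨_, hl, rfl⟩
  have hcomp' : Relation.Comp (fun (l : List G) (d : List ι) => l = d.map f) (· ~ ·) l d := by
    rw [List.eq_map_comp_perm]; exact hl
  obtain ⟨d', rfl, hd'⟩ := hcomp'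
  exact ⟨d', hd'.subperm.trans hd.subperm, by simp [hd'.length_eq], hprod⟩

/-- A subpermutation with product one yields a product-one sublist. -/
theorem List.Subperm.exists_isProdOne {G : Type*} [Group G] {l S : List G}
    (h : l.Subperm S) (hl : l.prod = 1) :
    ∃ T : List G, T.Sublist S ∧ T.length = l.length ∧ IsProdOne T := by
  obtain ⟨T, hT, hTS⟩ := h
  exact ⟨T, hTS, hT.length_eq, l, hT.symm, hl⟩

theorem exists_sublist_isProdOne_length_le_card {G : Type*} [Group G] [Finite G] (S : List G)
    (hS : S ≠ []) (h : IsProdOne S) :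
    ∃ T : List G, T ≠ [] ∧ T.Sublist S ∧ T.length ≤ Nat.card G ∧ IsProdOne T := by
  by_cases hlen : S.length ≤ Nat.card G
  · exact ⟨S, hS, List.Sublist.refl _, hlen, h⟩
  have := Fintype.ofFinite G
  obtain ⟨i, j, hij, heq⟩ := Fintype.exists_ne_map_eq_of_card_lt
    (fun i : Fin (Nat.card G + 1) => (S.take i).prod) (by simp)
  wlog hlt : i < j generalizing i j
  · exact this j i hij.symm heq.symm (lt_of_le_of_ne (not_lt.1 hlt) hij.symm)
  have hsplit : (S.take j) = S.take i ++ (S.take j).drop i := by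
    conv_lhs => rw [← List.take_append_drop i (S.take j)]
    rw [List.take_take, min_eq_left (by exact_mod_cast hlt.le)]
  have hj : (j : ℕ) < Nat.card G + 1 := j.2
  have hlt' : (i : ℕ) < j := hlt
  refine ⟨(S.take j).drop i, ?_, (List.drop_sublist _ _).trans (List.take_sublist _ _), ?_, ?_⟩
  · rw [← List.length_pos_iff_ne_nil, List.length_drop, List.length_take]
    omega
  · rw [List.length_drop, List.length_take]
    omega
  · refine ⟨_, List.Perm.refl _, ?_⟩
    have heq' : (S.take i).prod = (S.take j).prod := heq
    rw [hsplit, List.prod_append] at heq'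
    simpa using heq'

/-- The exponent of `x` in `(x ^ b₀ * y) * (x ^ b₁ * y) * ⋯` when `y * x = x ^ γ * y`. -/
def twistedSum {R : Type*} [CommRing R] (γ : R) (bs : List ℤ) : R :=
  bs.foldr (fun (b : ℤ) (s : R) => (b : R) + γ * s) 0

section twistedSum

variable {R : Type*} [CommRing R] (γ : R)

@[simp]
theorem twistedSum_nil : twistedSum γ [] = 0 := rfl

@[simp]
theorem twistedSum_cons (b : ℤ) (bs : List ℤ) :
    twistedSum γ (b :: bs) = b + γ * twistedSum γ bs := rfl

theorem twistedSum_replicate_zero_append (n : ℕ) (bs : List ℤ) :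
    twistedSum γ (List.replicate n 0 ++ bs) = γ ^ n * twistedSum γ bs := by
  induction n with
  | zero => simp
  | succ n ih => simp [List.replicate_succ, ih, pow_succ']; ring

theorem intCast_twistedSum (g : ℤ) (bs : List ℤ) :
    ((twistedSum g bs : ℤ) : R) = twistedSum (g : R) bs := by
  induction bs with
  | nil => simp
  | cons b bs ih => simp [ih]

theorem twistedSum_eq_zero_or_pow {ε : ℤ} {bs : List ℤ} (h : ∀ b ∈ bs, b = 0 ∨ b = ε)
    (hcount : bs.count ε ≤ 1) :
    twistedSum γ bs = 0 ∨ ∃ k < bs.length, twistedSum γ bs = ε * γ ^ k := by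
  induction bs with
  | nil => simp
  | cons b bs ih =>
    have h' : ∀ b ∈ bs, b = 0 ∨ b = ε := fun c hc => h c (List.mem_cons_of_mem _ hc)
    have hzero : bs.count ε = 0 → twistedSum γ bs = 0 := by
      intro hc
      clear ih hcount h
      induction bs with
      | nil => simp
      | cons c cs ihc =>
        rw [List.count_eq_zero] at hc ihc
        simp only [List.mem_cons, not_or] at hc
        have hc0 : c = 0 := (h' c (by simp)).resolve_right (Ne.symm hc.1)
        simp [hc0, ihc (fun d hd => h' d (List.mem_cons_of_mem _ hd)) hc.2]
    by_cases hb : b = ε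
    · subst hb
      right
      exact ⟨0, by simp, by simp [hzero (by simpa using hcount)]⟩
    · have hb0 : b = 0 := (h b (by simp)).resolve_right hb
      subst hb0
      rw [List.count_cons_of_ne hb] at hcount
      rcases ih h' hcount with h0 | ⟨k, hk, hs⟩
      · left; simp [h0]
      · right
        exact ⟨k + 1, by simpa using hk, by simp [hs, pow_succ]; ring⟩

theorem twistedSum_ne_zero [IsDomain R] {N : ℕ} (h0 : γ ≠ 0)
    (hγ : ∀ k, 0 < k → k < N → γ ^ k ≠ 1) {bs : List ℤ}
    (h : ∀ b ∈ bs, b = 0 ∨ b = 1 ∨ b = -1) (h1 : bs.count 1 ≤ 1) (h2 : bs.count (-1) ≤ 1)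
    (hlen : bs.length ≤ N) (hne : ∃ b ∈ bs, b ≠ 0) : twistedSum γ bs ≠ 0 := by
  induction bs with
  | nil => simp at hne
  | cons b bs ih =>
    have h' : ∀ b ∈ bs, b = 0 ∨ b = 1 ∨ b = -1 := fun c hc => h c (List.mem_cons_of_mem _ hc)
    have hlen' : bs.length + 1 ≤ N := by simpa using hlen
    rcases h b (by simp) with rfl | rfl | rfl
    · rw [List.count_cons_of_ne (by decide)] at h1 h2
      have := ih h' h1 h2 (by omega) (by simpa using hne)
      simp [h0, this]
    · rw [List.count_cons_of_ne (by decide)] at h2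
      rw [List.count_cons_self] at h1
      have h1' : (1 : ℤ) ∉ bs := List.count_eq_zero.1 (by omega)
      rcases twistedSum_eq_zero_or_pow γ (ε := -1) (bs := bs)
        (fun c hc => by
          rcases h' c hc with e | e | e
          · exact Or.inl e
          · exact absurd (e ▸ hc) h1'
          · exact Or.inr e) h2 with hs | ⟨k, hk, hs⟩
      · simp [hs]
      · rw [twistedSum_cons, hs]
        intro h
        refine hγ (k + 1) (by omega) (by omega) ?_
        push_cast at h
        linear_combination -h
    · rw [List.count_cons_of_ne (by decide)] at h1
      rw [List.count_cons_self] at h2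
      have h2' : (-1 : ℤ) ∉ bs := List.count_eq_zero.1 (by omega)
      rcases twistedSum_eq_zero_or_pow γ (ε := 1) (bs := bs)
        (fun c hc => by
          rcases h' c hc with e | e | e
          · exact Or.inl e
          · exact Or.inr e
          · exact absurd (e ▸ hc) h2') h1 with hs | ⟨k, hk, hs⟩
      · simp [hs]
      · rw [twistedSum_cons, hs]
        intro h
        refine hγ (k + 1) (by omega) (by omega) ?_
        push_cast at h
        linear_combination h

end twistedSum

section Metacyclic

variable {G : Type*} [Group G] {x y : G}

theorem conj_zpow_of_rel {g : ℕ} (hxy : x ^ g * y = y * x) (s : ℤ) :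
    y * x ^ s = x ^ ((g : ℤ) * s) * y := by
  have : x ^ g = y * x * y⁻¹ := by rw [← hxy]; group
  rw [zpow_mul, zpow_natCast, this, conj_zpow]
  group

theorem prod_map_zpow_mul {g : ℕ} (hxy : x ^ g * y = y * x) (bs : List ℤ) :
    (bs.map fun b => x ^ b * y).prod = x ^ twistedSum (g : ℤ) bs * y ^ bs.length := by
  induction bs with
  | nil => simp
  | cons b bs ih =>
    rw [List.map_cons, List.prod_cons, ih, twistedSum_cons, List.length_cons, Int.cast_id, zpow_add,
      pow_succ']
    calc x ^ b * y * (x ^ twistedSum (g : ℤ) bs * y ^ bs.length)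
        = x ^ b * (y * x ^ twistedSum (g : ℤ) bs) * y ^ bs.length := by group
      _ = _ := by rw [conj_zpow_of_rel hxy]; group

theorem zpow_mul_zpow_eq_one (hco : (orderOf x).Coprime (orderOf y)) {s k : ℤ}
    (h : x ^ s * y ^ k = 1) : (orderOf x : ℤ) ∣ s ∧ (orderOf y : ℤ) ∣ k := by
  have hx : x ^ s = 1 := by
    rw [← orderOf_eq_one_iff]
    refine Nat.eq_one_of_dvd_coprimes hco ?_ ?_
    · exact orderOf_dvd_of_mem_zpowers ⟨s, rfl⟩
    · rw [eq_inv_of_mul_eq_one_left h, orderOf_inv]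
      exact orderOf_dvd_of_mem_zpowers ⟨k, rfl⟩
  rw [hx, one_mul] at h
  exact ⟨orderOf_dvd_iff_zpow_eq_one.2 hx, orderOf_dvd_iff_zpow_eq_one.2 h⟩

end Metacyclic

theorem exists_map_some_of_none_notMem {α : Type*} {l : List (Option α)} (h : none ∉ l) :
    ∃ bs : List α, bs.map some = l := by
  induction l with
  | nil => exact ⟨[], rfl⟩
  | cons a l ih =>
    simp only [List.mem_cons, not_or] at h
    obtain ⟨bs, rfl⟩ := ih h.2
    obtain ⟨b, rfl⟩ := Option.ne_none_iff_exists.1 (Ne.symm h.1)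
    exact ⟨b :: bs, rfl⟩

theorem succ_le_eC {p g : ℕ} {G : Type*} [Group G] [Finite G] {x y : G} (hp : p.Prime)
    (h5 : 5 ≤ p) (hg : orderOf (g : ZMod p) = p - 1) (hx : orderOf x = p) (hy : orderOf y = p - 1)
    (hxy : x ^ g * y = y * x) : p + 1 ≤ eC G := by
  have : Fact p.Prime := ⟨hp⟩
  have hco : (orderOf x).Coprime (orderOf y) := by
    rw [hx, hy, Nat.Prime.coprime_iff_not_dvd hp]
    exact Nat.not_dvd_of_pos_of_lt (by omega) (by omega)
  have hgpow : (g : ZMod p) ^ (p - 1) = 1 := hg ▸ pow_orderOf_eq_one _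
  have hg0 : (g : ZMod p) ≠ 0 := by
    intro h0
    rw [h0, zero_pow (by omega)] at hgpow
    exact zero_ne_one hgpow
  have hgne : ∀ k, 0 < k → k < p - 1 → (g : ZMod p) ^ k ≠ 1 := fun k hk hk' =>
    pow_ne_one_of_lt_orderOf hk.ne' (hg ▸ hk')
  let f : Option ℤ → G := fun o => o.elim (y⁻¹ * x ^ (2 : ℤ)) fun b => x ^ b * y
  let cs : List (Option ℤ) := none :: some 1 :: some (-1) :: List.replicate (p - 2) (some 0)
  have hf : ∀ bs : List ℤ, ((bs.map some).map f).prod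
      = x ^ twistedSum (g : ℤ) bs * y ^ bs.length := by
    intro bs
    rw [← prod_map_zpow_mul hxy, List.map_map]
    rfl
  have hS : IsProdOne (cs.map f) := by
    obtain ⟨h, hh⟩ : ∃ h, p - 1 = 2 * h := by
      obtain ⟨k, hk⟩ := hp.odd_of_ne_two (by omega)
      exact ⟨k, by omega⟩
    let bs : List ℤ := -1 :: (List.replicate (h - 1) 0 ++ 1 :: List.replicate h 0)
    refine ⟨(none :: bs.map some).map f, List.Perm.map f ?_, ?_⟩
    · refine List.Perm.cons _ ?_
      simp only [bs, List.map_cons, List.map_append, List.map_replicate]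
      refine (List.Perm.cons _ List.perm_middle).trans ((List.Perm.swap _ _ _).trans ?_)
      rw [List.replicate_append_replicate, show h - 1 + h = p - 2 by omega]
    · have hpow : (g : ZMod p) ^ h = -1 := by
        have h2 : ((g : ZMod p) ^ h) ^ 2 = 1 := by rw [← pow_mul, mul_comm, ← hh, hgpow]
        exact (mul_self_eq_one_iff.1 (by rwa [← sq])).resolve_left (hgne h (by omega) (by omega))
      have hsum : ((2 + twistedSum (g : ℤ) bs : ℤ) : ZMod p) = 0 := by
        have hr : twistedSum (g : ZMod p) (List.replicate h 0) = 0 := by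
          simpa using twistedSum_replicate_zero_append (g : ZMod p) h []
        rw [Int.cast_add, intCast_twistedSum]
        simp only [bs, twistedSum_cons, twistedSum_replicate_zero_append, Int.cast_natCast, hr]
        push_cast
        have : (g : ZMod p) * g ^ (h - 1) = g ^ h := by
          rw [← pow_succ']; congr 1; omega
        linear_combination this + hpow
      have hx1 : x ^ (2 + twistedSum (g : ℤ) bs) = 1 := by
        rw [← orderOf_dvd_iff_zpow_eq_one, hx]
        exact (ZMod.intCast_zmod_eq_zero_iff_dvd _ _).1 hsum
      have hlen : bs.length = (p - 1) + 1 := by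
        simp [bs]; omega
      rw [List.map_cons, List.prod_cons, hf, hlen, pow_succ, ← hy, pow_orderOf_eq_one, one_mul]
      change y⁻¹ * x ^ (2 : ℤ) * _ = 1
      rw [mul_assoc, ← mul_assoc (x ^ (2 : ℤ)), ← zpow_add, hx1]
      simp
  refine le_csInf ⟨Nat.card G, Nat.card_pos, exists_sublist_isProdOne_length_le_card⟩ ?_
  rintro m ⟨-, hm⟩
  by_contra! hlt
  obtain ⟨T, hT0, hTS, hTm, hT⟩ := hm (cs.map f) (by simp [cs]) hS
  obtain ⟨d, hd, hdT, hprod⟩ := exists_subperm_of_isProdOne hTS hT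
  have hdpos : 0 < d.length := hdT ▸ List.length_pos_iff_ne_nil.2 hT0
  have hdp : d.length ≤ p := by omega
  have hmem : ∀ b : ℤ, some b ∈ d → b = 0 ∨ b = 1 ∨ b = -1 := by
    intro b hb
    have := hd.subset hb
    simp only [cs, List.mem_cons, List.mem_replicate, Option.some.injEq, reduceCtorEq,
      false_or] at this
    tauto
  have hc1 : d.count (some 1) ≤ 1 := (hd.count_le _).trans (by simp [cs, List.count_replicate])
  have hc2 : d.count (some (-1)) ≤ 1 := (hd.count_le _).trans (by simp [cs, List.count_replicate])
  have hc0 : d.count (some 0) ≤ p - 2 := (hd.count_le _).trans (by simp [cs])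
  have hcn : d.count none ≤ 1 := (hd.count_le _).trans (by simp [cs, List.count_replicate])
  by_cases hn : none ∈ d
  · obtain ⟨l₁, l₂, rfl⟩ := List.append_of_mem hn
    have hn' : none ∉ l₂ ++ l₁ := by
      rw [← List.count_eq_zero]
      simp only [List.count_append, List.count_cons_self] at hcn ⊢
      omega
    obtain ⟨bs, hbs⟩ := exists_map_some_of_none_notMem hn'
    have hprod' : f none * (x ^ twistedSum (g : ℤ) bs * y ^ bs.length) = 1 := by
      rw [← hf, hbs]
      rw [List.map_append, List.map_cons, List.prod_append, List.prod_cons] at hprod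
      rw [List.map_append, List.prod_append, ← mul_assoc]
      exact mul_eq_one_comm.1 hprod
    have hone : x ^ (2 + twistedSum (g : ℤ) bs) * y ^ ((bs.length : ℤ) - 1) = 1 := by
      have h1 : x ^ (2 : ℤ) * (x ^ twistedSum (g : ℤ) bs * y ^ bs.length) = y := by
        have h2 : y⁻¹ * x ^ (2 : ℤ) * (x ^ twistedSum (g : ℤ) bs * y ^ bs.length) = 1 := hprod'
        rw [mul_assoc] at h2
        exact (inv_mul_eq_one.1 h2).symm
      rw [zpow_add, zpow_sub, zpow_natCast, zpow_one, ← mul_assoc, mul_assoc (x ^ (2 : ℤ)), h1,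
        mul_inv_cancel]
    obtain ⟨hd1, hd2⟩ := zpow_mul_zpow_eq_one hco hone
    rw [hx] at hd1
    rw [hy] at hd2
    have hl : bs.length + 1 ≤ p := by
      have := congrArg List.length hbs
      simp only [List.length_map, List.length_append, List.length_cons] at this hdp
      omega
    have hl1 : bs.length = 1 := by
      have := Int.eq_zero_of_abs_lt_dvd hd2 (by rw [abs_lt]; omega)
      omega
    obtain ⟨b, rfl⟩ := List.length_eq_one_iff.1 hl1
    have hb : some b ∈ l₂ ++ l₁ := by rw [← hbs]; simp
    have hb' := hmem b (by simp only [List.mem_append, List.mem_cons] at hb ⊢; tauto)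
    simp only [twistedSum_cons, twistedSum_nil, Int.cast_id, mul_zero, add_zero] at hd1
    have := Int.eq_zero_of_abs_lt_dvd hd1 (by rw [abs_lt]; omega)
    omega
  · obtain ⟨bs, rfl⟩ := exists_map_some_of_none_notMem hn
    rw [hf, ← zpow_natCast] at hprod
    obtain ⟨hd1, hd2⟩ := zpow_mul_zpow_eq_one hco hprod
    rw [hx] at hd1
    rw [hy] at hd2
    have hcount : ∀ b : ℤ, (bs.map some).count (some b) = bs.count b := fun b =>
      List.count_map_of_injective _ _ (Option.some_injective _) _
    rw [List.length_map] at hdpos hdp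
    rw [hcount] at hc0 hc1 hc2
    have hl : bs.length = p - 1 := by
      have hd3 : (((p - 1 : ℕ)) : ℤ) ∣ (bs.length : ℤ) - (p - 1 : ℕ) := dvd_sub_self_right.2 hd2
      have := Int.eq_zero_of_abs_lt_dvd hd3 (by rw [abs_lt]; omega)
      omega
    refine twistedSum_ne_zero (g : ZMod p) hg0 hgne (fun b hb => hmem b (by simpa using hb)) hc1 hc2
      hl.le ?_ ?_
    · by_contra! hall
      rw [List.count_eq_length.2 fun b hb => (hall b hb).symm] at hc0
      omega
    · have := (ZMod.intCast_zmod_eq_zero_iff_dvd _ _).2 hd1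
      rwa [intCast_twistedSum, Int.cast_natCast] at this

/-- `evalWith n f` is `f n`, arranged so that kernel reduction evaluates `n` first. -/
def evalWith {α : Type} (n : ℕ) (f : ℕ → α) : α :=
  Nat.rec (f 0) (fun k _ => f (Nat.succ k)) n

theorem evalWith_eq {α : Type} (n : ℕ) (f : ℕ → α) : evalWith n f = f n := by
  cases n <;> rfl

/-- With `5 * k + b` standing for `x ^ b * y ^ k` in the holomorph of `ZMod 5`, the code of a
product of two elements. -/
def mulCode (i j : ℕ) : ℕ :=
  5 * ((i / 5 + j / 5) % 4) + (i + 2 ^ (i / 5) * j) % 5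

/-- The code of the inverse of an element of the holomorph of `ZMod 5`. -/
def invCode (i : ℕ) : ℕ :=
  5 * ((4 - i / 5) % 4) + 2 ^ ((4 - i / 5) % 4) * (5 - i % 5) % 5

/-- The image under `f` of the set of codes whose indicator bits are those of `A`. -/
def maskMap (f : ℕ → ℕ) (A : ℕ) : ℕ :=
  Nat.rec 0 (fun i B => Nat.lor B (Nat.shiftLeft (Nat.land (Nat.shiftRight A i) 1) (f i))) 20

/-- The union of `B` with the left and right translates of `A` by `g`. -/
def extendMask (B A g : ℕ) : ℕ :=
  Nat.lor (Nat.lor B (maskMap (mulCode g) A)) (maskMap (fun i => mulCode i g) A)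

/-- Some of the products of ordered subsequences, respectively proper subsequences, of a list. -/
def masks : List ℕ → ℕ × ℕ
  | [] => (1, 0)
  | g :: t => (extendMask (masks t).1 (masks t).1 g, extendMask (masks t).1 (masks t).2 g)

/-- A sufficient condition for a list to have a proper nonempty product-one subsequence. -/
def hasShortCut : List ℕ → Bool
  | [] => false
  | g :: t => (masks t).2.testBit (invCode g)

/-- Exhaustive check that each extension of `t` by at most `n` codes, nondecreasing and at least
`m`, is not a product-one sequence of length at least seven without proper nonempty product-one
subsequences. -/
def search : ℕ → List ℕ → ℕ → ℕ → ℕ → Bool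
  | 0, _, _, _, _ => false
  | n + 1, t, A, Q, m => (List.range 20).all fun g =>
      g.blt m ||
        ((Nat.ble 2 n || Q.testBit (invCode g) ||
            !Nat.beq (((g :: t).map (· / 5)).sum % 4) 0 || hasShortCut ((g :: t).rotate 2)) &&
          (A.testBit (invCode g) ||
            evalWith (extendMask A A g) fun A' => evalWith (extendMask A Q g) fun Q' =>
              search n (g :: t) A' Q' g))

set_option maxRecDepth 100000 in
theorem search_eq_true : search 8 [] 1 0 0 = true := by decide +kernel

theorem mulCode_invCode : ∀ g < 20, mulCode g (invCode g) = 0 := by decide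

theorem testBit_maskMap {f : ℕ → ℕ} {A j : ℕ} (h : (maskMap f A).testBit j) :
    ∃ i, A.testBit i ∧ f i = j := by
  unfold maskMap at h
  generalize 20 = n at h
  induction n with
  | zero => simp at h
  | succ n ih =>
    change (Nat.rec 0 _ n ||| ((A >>> n) &&& 1) <<< f n : ℕ).testBit j = true at h
    rw [Nat.testBit_lor, Bool.or_eq_true] at h
    rcases h with h | h
    · exact ih h
    · rw [Nat.testBit_shiftLeft, Bool.and_eq_true, decide_eq_true_eq, Nat.testBit_land,
        Bool.and_eq_true, Nat.testBit_one_eq_true_iff_self_eq_zero, Nat.testBit_shiftRight] at h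
      obtain ⟨h1, h2, h3⟩ := h
      exact ⟨n, by simpa [h3] using h2, by omega⟩

/-- Every code in `A` is the code of the product of some list satisfying `P`. -/
def Represents {G : Type*} [Group G] (e : ℕ → G) (A : ℕ) (P : List ℕ → Prop) : Prop :=
  ∀ i, A.testBit i → ∃ l, P l ∧ (l.map e).prod = e i

section Codes

variable {G : Type*} [Group G] {e : ℕ → G}

theorem Represents.extendMask (he : ∀ i j, e (mulCode i j) = e i * e j) {A B g : ℕ}
    {P P' : List ℕ → Prop} (hB : Represents e B P') (hA : Represents e A P)
    (hl : ∀ l, P l → P' (g :: l)) (hr : ∀ l, P l → P' (l ++ [g])) :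
    Represents e (extendMask B A g) P' := by
  intro i hi
  change (B ||| maskMap (mulCode g) A ||| maskMap (fun i => mulCode i g) A).testBit i = true at hi
  rw [Nat.testBit_lor, Nat.testBit_lor, Bool.or_eq_true, Bool.or_eq_true] at hi
  rcases hi with (hi | hi) | hi
  · exact hB i hi
  · obtain ⟨j, hj, rfl⟩ := testBit_maskMap hi
    obtain ⟨l, hl', hprod⟩ := hA j hj
    exact ⟨g :: l, hl l hl', by simp [hprod, he]⟩
  · obtain ⟨j, hj, rfl⟩ := testBit_maskMap hi
    obtain ⟨l, hl', hprod⟩ := hA j hj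
    exact ⟨l ++ [g], hr l hl', by simp [hprod, he]⟩

theorem represents_one (h0 : e 0 = 1) : Represents e 1 (fun l => l.Subperm []) := by
  intro i hi
  rw [Nat.testBit_one_eq_true_iff_self_eq_zero] at hi
  exact ⟨[], List.Subperm.refl _, by simp [hi, h0]⟩

theorem represents_zero (P : List ℕ → Prop) : Represents e 0 P := by
  intro i hi
  simp at hi

theorem Represents.subperm_cons (he : ∀ i j, e (mulCode i j) = e i * e j) {A g : ℕ} {t : List ℕ}
    (hA : Represents e A (fun l => l.Subperm t)) :
    Represents e (_root_.extendMask A A g) (fun l => l.Subperm (g :: t)) := by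
  refine Represents.extendMask he (fun i hi => ?_) hA (fun l hl => (List.subperm_cons g).2 hl)
    (fun l hl => ?_)
  · obtain ⟨l, hl, hprod⟩ := hA i hi
    exact ⟨l, hl.trans (List.sublist_cons_self _ _).subperm, hprod⟩
  · exact (List.perm_append_singleton g l).subperm.trans ((List.subperm_cons g).2 hl)

theorem Represents.proper_subperm_cons (he : ∀ i j, e (mulCode i j) = e i * e j) {A Q g : ℕ}
    {t : List ℕ} (hA : Represents e A (fun l => l.Subperm t))
    (hQ : Represents e Q (fun l => l.Subperm t ∧ l.length < t.length)) :
    Represents e (_root_.extendMask A Q g)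
      (fun l => l.Subperm (g :: t) ∧ l.length < (g :: t).length) := by
  refine Represents.extendMask he (fun i hi => ?_) hQ
    (fun l hl => ⟨(List.subperm_cons g).2 hl.1, by simpa using hl.2⟩)
    (fun l hl => ⟨(List.perm_append_singleton g l).subperm.trans ((List.subperm_cons g).2 hl.1),
      by simpa using hl.2⟩)
  obtain ⟨l, hl, hprod⟩ := hA i hi
  exact ⟨l, ⟨hl.trans (List.sublist_cons_self _ _).subperm, 
    by simpa [Nat.lt_succ_iff] using hl.length_le⟩, hprod⟩

theorem represents_masks (he : ∀ i j, e (mulCode i j) = e i * e j) (h0 : e 0 = 1) (t : List ℕ) :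
    Represents e (masks t).1 (fun l => l.Subperm t) ∧
      Represents e (masks t).2 (fun l => l.Subperm t ∧ l.length < t.length) := by
  induction t with
  | nil => exact ⟨represents_one h0, represents_zero _⟩
  | cons g t ih => exact ⟨ih.1.subperm_cons he, ih.1.proper_subperm_cons he ih.2⟩

theorem exists_code_prod (he : ∀ i j, e (mulCode i j) = e i * e j) (h0 : e 0 = 1) (l : List ℕ) :
    ∃ i, (l.map e).prod = e i ∧ i / 5 % 4 = (l.map (· / 5)).sum % 4 := by
  induction l with
  | nil => exact ⟨0, by simp [h0]⟩
  | cons a l ih =>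
    obtain ⟨i, hi, hk⟩ := ih
    refine ⟨mulCode a i, by simp [hi, he], ?_⟩
    rw [List.map_cons, List.sum_cons, mulCode]
    omega

theorem mul_invCode (he : ∀ i j, e (mulCode i j) = e i * e j) (h0 : e 0 = 1) {g : ℕ}
    (hg : g < 20) : e g * e (invCode g) = 1 := by
  rw [← he, mulCode_invCode g hg, h0]

theorem search_ne_true (he : ∀ i j, e (mulCode i j) = e i * e j) (h0 : e 0 = 1) {c : List ℕ}
    (hc : ∀ a ∈ c, a < 20) (h7 : 7 ≤ c.length) (hk : (c.map (· / 5)).sum % 4 = 0)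
    (hmin : ∀ l : List ℕ, l.Subperm c → l ≠ [] → (l.map e).prod = 1 → c.length ≤ l.length)
    (n : ℕ) {t r : List ℕ} {A Q m : ℕ} (hn : n + t.length = 8) (hperm : c.Perm (t ++ r))
    (hr : r ≠ []) (hsort : r.Pairwise (· ≤ ·)) (hm : ∀ a ∈ r, m ≤ a)
    (hA : Represents e A (fun l => l.Subperm t))
    (hQ : Represents e Q (fun l => l.Subperm t ∧ l.length < t.length)) :
    search n t A Q m ≠ true := by
  have hbit : ∀ {B g : ℕ} {s : List ℕ} {P : List ℕ → Prop}, g < 20 → Represents e B P →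
      (g :: s).Subperm c → (∀ l, P l → l.Subperm s ∧ l.length + 1 < c.length) →
      B.testBit (invCode g) ≠ true := by
    intro B g s P hg hB hs hP hb
    obtain ⟨l, hl, hprod⟩ := hB _ hb
    obtain ⟨hls, hlen⟩ := hP l hl
    have := hmin (g :: l) (((List.subperm_cons g).2 hls).trans hs) (by simp)
      (by simp [hprod, mul_invCode he h0 hg])
    simp at this
    omega
  induction n generalizing t r A Q m with
  | zero => simp [search]
  | succ n ih =>
    obtain ⟨g, r, rfl⟩ := List.exists_cons_of_ne_nil hr
    intro hs
    have hperm' : c.Perm ((g :: t) ++ r) := hperm.trans List.perm_middle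
    have hlen : c.length = t.length + 1 + r.length := by
      rw [hperm'.length_eq, List.length_append, List.length_cons]
    have hsub : (g :: t).Subperm c :=
      (List.sublist_append_left _ r).subperm.trans hperm'.symm.subperm
    have hg : g < 20 := hc g (hsub.subset (by simp))
    have hm' : ¬ g < m := not_lt.2 (hm g (by simp))
    rw [search, List.all_eq_true] at hs
    have hs' := hs g (by simpa using hg)
    simp only [evalWith_eq, Bool.or_eq_true, Bool.and_eq_true] at hs'
    rcases hs' with hs' | ⟨hleaf, hrec⟩
    · exact hm' (by simpa using hs')
    rcases eq_or_ne r [] with rfl | hr'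
    · simp only [List.append_nil] at hperm'
      simp only [List.length_nil, add_zero] at hlen
      rcases hleaf with ((h | h) | h) | h
      · have := Nat.le_of_ble_eq_true h
        omega
      · exact hbit hg hQ hsub (fun l hl => ⟨hl.1, by omega⟩) h
      · rw [(hperm'.map (· / 5)).sum_eq] at hk
        rw [hk] at h
        simp at h
      · have hrot := hperm'.trans (List.rotate_perm (g :: t) 2).symm
        generalize (g :: t).rotate 2 = s at h hrot
        cases s with
        | nil => simp [hasShortCut] at h
        | cons a s =>
          have := hrot.length_eq
          simp only [List.length_cons] at this
          exact hbit (hc a (hrot.symm.subset (by simp))) (represents_masks he h0 s).2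
            hrot.symm.subperm (fun l hl => ⟨hl.1, by omega⟩) h
    · have hrpos := List.length_pos_iff_ne_nil.2 hr'
      rcases hrec with h | h
      · exact hbit hg hA hsub (fun l hl => ⟨hl, by have := hl.length_le; omega⟩) h
      · exact ih (by simp only [List.length_cons]; omega) hperm' hr' hsort.of_cons
          (fun a ha => List.rel_of_pairwise_cons hsort ha) (hA.subperm_cons he)
          (hA.proper_subperm_cons he hQ) h

theorem eC_le_six_of_codes (he : ∀ i j, e (mulCode i j) = e i * e j) (h0 : e 0 = 1)
    (hsurj : ∀ w, ∃ i < 20, e i = w) (hone : ∀ i, e i = 1 → i / 5 % 4 = 0) : eC G ≤ 6 := by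
  refine Nat.sInf_le ⟨by norm_num, fun S hS hprod => ?_⟩
  choose code hcode hecode using hsurj
  have hmap : (S.map code).map e = S := by simp [Function.comp_def, hecode]
  have hex : ∃ n, ∃ l : List ℕ, l.Subperm (S.map code) ∧ l ≠ [] ∧ (l.map e).prod = 1 ∧
      l.length = n := by
    obtain ⟨d, hd, hlen, hp⟩ := exists_subperm_of_isProdOne (f := e) (cs := S.map code)
      (T := S) (by rw [hmap]) hprod
    refine ⟨_, d, hd, ?_, hp, rfl⟩
    rwa [← List.length_pos_iff_ne_nil, hlen, List.length_pos_iff_ne_nil]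
  classical
  obtain ⟨d, hd, hd0, hdp, hdn⟩ := Nat.find_spec hex
  have hmin : ∀ l : List ℕ, l.Subperm d → l ≠ [] → (l.map e).prod = 1 → d.length ≤ l.length :=
    fun l hl hl0 hlp => hdn ▸ Nat.find_min' hex ⟨l, hl.trans hd, hl0, hlp, rfl⟩
  by_cases h6 : d.length ≤ 6
  · obtain ⟨d', hd', hsub⟩ := hd
    have hsub' : (d.map e).Subperm S :=
      hmap ▸ (hd'.symm.map e).subperm.trans (hsub.map e).subperm
    obtain ⟨T, hT, hlen, hTp⟩ := hsub'.exists_isProdOne hdp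
    rw [List.length_map] at hlen
    exact ⟨T, List.length_pos_iff_ne_nil.1 (hlen ▸ List.length_pos_iff_ne_nil.2 hd0), hT,
      by omega, hTp⟩
  · exfalso
    have hk : (d.map (· / 5)).sum % 4 = 0 := by
      obtain ⟨i, hi, hk⟩ := exists_code_prod he h0 d
      rw [← hk, hone i (hi ▸ hdp)]
    have hd20 : ∀ a ∈ d, a < 20 := by
      intro a ha
      obtain ⟨w, -, rfl⟩ := List.mem_map.1 (hd.subset ha)
      exact hcode w
    have hsorted : (d.mergeSort).Pairwise (· ≤ ·) := by
      simpa using List.pairwise_mergeSort (le := fun a b : ℕ => decide (a ≤ b))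
        (by simpa using fun a b c => le_trans) (by simpa using le_total) d
    have hperm := List.mergeSort_perm d (fun a b => decide (a ≤ b))
    exact search_ne_true he h0 hd20 (by omega) hk hmin 8 (t := []) (by simp) hperm.symm
      (fun h => hd0 (by rw [h] at hperm; exact hperm.nil_eq.symm)) hsorted (fun a _ => Nat.zero_le a)
      (represents_one h0) (represents_zero _) search_eq_true

end Codes

theorem eC_le_six {G : Type*} [Group G] [Finite G] {x y : G} (hx : orderOf x = 5)
    (hy : orderOf y = 4) (hxy : x ^ 2 * y = y * x) (hcl : Subgroup.closure ({x, y} : Set G) = ⊤) :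
    eC G ≤ 6 := by
  let e : ℕ → G := fun i => x ^ i * y ^ (i / 5)
  have hconj : ∀ k s : ℕ, y ^ k * x ^ s = x ^ (2 ^ k * s) * y ^ k := by
    intro k s
    induction k with
    | zero => simp
    | succ k ih =>
      have h1 := conj_zpow_of_rel hxy ((2 ^ k * s : ℕ) : ℤ)
      have h2 : y * x ^ (2 ^ k * s) = x ^ (2 * (2 ^ k * s)) * y := by exact_mod_cast h1
      rw [pow_succ', mul_assoc, ih, ← mul_assoc, h2, mul_assoc, pow_succ', mul_assoc]
  have he : ∀ i j, e (mulCode i j) = e i * e j := by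
    intro i j
    have hdiv : mulCode i j / 5 = (i / 5 + j / 5) % 4 := by rw [mulCode]; omega
    have hxm : x ^ mulCode i j = x ^ (i + 2 ^ (i / 5) * j) := by
      rw [← pow_mod_orderOf x (mulCode i j), ← pow_mod_orderOf x (i + _), hx, mulCode,
        Nat.mul_add_mod, Nat.mod_mod]
    have hym : y ^ (mulCode i j / 5) = y ^ (i / 5 + j / 5) := by
      rw [hdiv, ← hy, pow_mod_orderOf]
    change x ^ mulCode i j * y ^ (mulCode i j / 5) = x ^ i * y ^ (i / 5) * (x ^ j * y ^ (j / 5))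
    rw [hxm, hym, pow_add, pow_add, mul_assoc, mul_assoc, ← mul_assoc (y ^ (i / 5)), hconj]
    group
  have h0 : e 0 = 1 := by simp [e]
  refine eC_le_six_of_codes he h0 ?_ ?_
  · have hred : ∀ i, ∃ j < 20, e j = e i := fun i =>
      ⟨mulCode i 0, by rw [mulCode]; omega, by rw [he, h0, mul_one]⟩
    intro w
    have hw : w ∈ Subgroup.closure ({x, y} : Set G) := hcl ▸ Subgroup.mem_top w
    induction hw using Subgroup.closure_induction with
    | mem w hw =>
      rcases hw with rfl | rfl
      · exact ⟨1, by norm_num, by simp [e]⟩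
      · refine ⟨5, by norm_num, ?_⟩
        change x ^ 5 * w ^ 1 = w
        rw [← hx, pow_orderOf_eq_one, one_mul, pow_one]
    | one => exact ⟨0, by norm_num, h0⟩
    | mul a b _ _ ha hb =>
      obtain ⟨i, -, rfl⟩ := ha
      obtain ⟨j, -, rfl⟩ := hb
      rw [← he]
      exact hred _
    | inv a _ ha =>
      obtain ⟨i, hi, rfl⟩ := ha
      rw [inv_eq_of_mul_eq_one_right (mul_invCode he h0 hi)]
      exact hred _
  · intro i hi
    have h1 : x ^ (i : ℤ) * y ^ ((i / 5 : ℕ) : ℤ) = 1 := by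
      rw [zpow_natCast, zpow_natCast]; exact hi
    have := (zpow_mul_zpow_eq_one (by rw [hx, hy]; decide) h1).2
    rw [hy] at this
    omega

theorem eC_eq_six {g : ℕ} {G : Type*} [Group G] [Finite G] {x y : G}
    (hg : orderOf (g : ZMod 5) = 4) (hx : orderOf x = 5) (hy : orderOf y = 4)
    (hxy : x ^ g * y = y * x) (hcl : Subgroup.closure ({x, y} : Set G) = ⊤) : eC G = 6 := by
  refine le_antisymm ?_ (succ_le_eC (p := 5) (by norm_num) le_rfl hg hx hy hxy)
  have hcases : g % 5 = 2 ∨ g % 5 = 3 := by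
    have hfin : ∀ a : ZMod 5, a ^ 4 = 1 → a ^ 2 ≠ 1 → a = (2 : ℕ) ∨ a = (3 : ℕ) := by decide
    rcases hfin g (hg ▸ pow_orderOf_eq_one _)
      (pow_ne_one_of_lt_orderOf (by norm_num) (by rw [hg]; norm_num)) with h | h
    · exact Or.inl ((ZMod.natCast_eq_natCast_iff' _ _ _).1 h)
    · exact Or.inr ((ZMod.natCast_eq_natCast_iff' _ _ _).1 h)
  rw [← pow_mod_orderOf, hx] at hxy
  rcases hcases with h | h
  · rw [h] at hxy
    exact eC_le_six hx hy hxy hcl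
  · rw [h] at hxy
    refine eC_le_six (y := y⁻¹) hx (by rw [orderOf_inv, hy]) ?_ ?_
    · have h3 : (y⁻¹ * x * y) ^ 3 = x := by
        have : (y⁻¹ * x * y) ^ 3 = y⁻¹ * x ^ 3 * y := by
          simpa using conj_pow (a := y⁻¹) (b := x) (i := 3)
        rw [this, mul_assoc, hxy]; group
      have h5 : (y⁻¹ * x * y) ^ 5 = 1 := by
        have : (y⁻¹ * x * y) ^ 5 = y⁻¹ * x ^ 5 * y := by
          simpa using conj_pow (a := y⁻¹) (b := x) (i := 5)
        rw [this, ← hx, pow_orderOf_eq_one]; group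
      have h2 : x ^ 2 = y⁻¹ * x * y := by
        rw [← h3, ← pow_mul]
        calc (y⁻¹ * x * y) ^ (3 * 2) = (y⁻¹ * x * y) ^ 5 * (y⁻¹ * x * y) := by rw [← pow_succ]
          _ = _ := by rw [h5, one_mul, h3]
      rw [h2]; group
    · rw [← hcl, eq_comm]
      refine le_antisymm ?_ ?_ <;> rw [Subgroup.closure_le] <;> rintro w (rfl | rfl)
      · exact Subgroup.subset_closure (by simp)
      · exact inv_mem_iff.1 (Subgroup.subset_closure (by simp))
      · exact Subgroup.subset_closure (by simp)
      · exact inv_mem (Subgroup.subset_closure (by simp))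

/-- For every prime `p > 5`, `e(Hol(Z_p)) ≥ p + 1`; moreover `e(Hol(Z_5)) = 6`. -/
theorem hol_e_lower_bound :
    (∀ (p g : ℕ) (G : Type) [Group G] [Finite G] (x y : G),
      p.Prime → 5 < p → orderOf (g : ZMod p) = p - 1 →
      orderOf x = p → orderOf y = p - 1 → x ^ g * y = y * x →
      Subgroup.closure ({x, y} : Set G) = ⊤ → p + 1 ≤ eC G) ∧
    (∀ (g : ℕ) (G : Type) [Group G] [Finite G] (x y : G),
      orderOf (g : ZMod 5) = 4 →
      orderOf x = 5 → orderOf y = 4 → x ^ g * y = y * x →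
      Subgroup.closure ({x, y} : Set G) = ⊤ → eC G = 6) :=
  ⟨fun _ _ _ _ _ _ _ hp h5 hg hx hy hxy _ => succ_le_eC hp h5.le hg hx hy hxy,
    fun _ _ _ _ _ _ hg hx hy hxy hcl => eC_eq_six hg hx hy hxy hcl⟩
end
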